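/- arXiv:2512.23164 — 3 statements merged into one kernel-verified Lean document; each statement's English description precedes it below -/
import Mathlib

section
/- For every 0 < ν ≤ 1, let μ_ν be the Student-t distribution with ν degrees of freedom, i.e. the probability measure on ℝ with density t ↦ (Γ((ν+1)/2)/(√(πν)·Γ(ν/2)))·(1 + t²/ν)^{−(ν+1)/2}. Then the pushforward of μ_ν under the map t ↦ |t| (the half Student-t distribution) is infinitely divisible. -/
open MeasureTheory Real

/-- The `n`-fold convolution power of a measure on `ℝ`. -/
noncomputable def convPow (ν : Measure ℝ) : ℕ → Measure ℝ
  | 0 => Measure.dirac 0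
  | n + 1 => (convPow ν n).conv ν

/-- A probability measure on `ℝ` is infinitely divisible if for every positive integer `n`
it is the `n`-fold convolution of some probability measure with itself. -/
def IsInfinitelyDivisible (μ : Measure ℝ) : Prop :=
  ∀ n : ℕ, 0 < n → ∃ ν : Measure ℝ, IsProbabilityMeasure ν ∧ μ = convPow ν n

/-- The Student-t distribution with `ν` degrees of freedom: density
`Γ((ν+1)/2)/(√(πν)·Γ(ν/2)) · (1 + t²/ν)^{−(ν+1)/2}` w.r.t. Lebesgue. -/
noncomputable def studentT (ν : ℝ) : Measure ℝ :=
  volume.withDensity fun t =>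
    ENNReal.ofReal (Real.Gamma ((ν + 1) / 2) / (Real.sqrt (π * ν) * Real.Gamma (ν / 2)) *
      (1 + t ^ 2 / ν) ^ (-((ν + 1) / 2)))

open Set Filter Topology
open scoped ENNReal NNReal BoundedContinuousFunction

/-- The Laplace transform of a measure on `ℝ`, with values in `ℝ≥0∞`. -/
noncomputable def laplaceTransform (μ : Measure ℝ) (s : ℝ) : ℝ≥0∞ :=
  ∫⁻ x, ENNReal.ofReal (exp (-s * x)) ∂μ

lemma laplaceTransform_conv (μ ν : Measure ℝ) [SFinite ν] (s : ℝ) :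
    laplaceTransform (μ.conv ν) s = laplaceTransform μ s * laplaceTransform ν s := by
  unfold laplaceTransform
  rw [Measure.lintegral_conv (by fun_prop)]
  simp_rw [mul_add, exp_add, ENNReal.ofReal_mul (exp_pos _).le]
  rw [← lintegral_mul_const _ (by fun_prop)]
  refine lintegral_congr fun x => ?_
  rw [lintegral_const_mul _ (by fun_prop)]

instance isFiniteMeasure_convPow (ν : Measure ℝ) [IsFiniteMeasure ν] (n : ℕ) :
    IsFiniteMeasure (convPow ν n) := by
  induction n with
  | zero => unfold convPow; infer_instance
  | succ n ih => unfold convPow; infer_instance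

lemma laplaceTransform_convPow (ν : Measure ℝ) [SFinite ν] (n : ℕ) (s : ℝ) :
    laplaceTransform (convPow ν n) s = laplaceTransform ν s ^ n := by
  induction n with
  | zero => simp [convPow, laplaceTransform]
  | succ n ih => rw [convPow, laplaceTransform_conv, ih, pow_succ]

lemma laplaceTransform_map_mul (μ : Measure ℝ) (c s : ℝ) :
    laplaceTransform (μ.map (c * ·)) s = laplaceTransform μ (s * c) := by
  unfold laplaceTransform
  rw [lintegral_map (by fun_prop) (by fun_prop)]
  simp only [neg_mul, mul_assoc]

lemma ae_nonneg_conv {μ ν : Measure ℝ} [SFinite ν] [SFinite μ] (hμ : ∀ᵐ x ∂μ, 0 ≤ x)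
    (hν : ∀ᵐ x ∂ν, 0 ≤ x) : ∀ᵐ x ∂(μ.conv ν), 0 ≤ x := by
  unfold Measure.conv
  rw [ae_map_iff (by fun_prop) measurableSet_Ici]
  rw [Measure.ae_prod_iff_ae_ae (by measurability)]
  filter_upwards [hμ] with x hx
  filter_upwards [hν] with y hy
  exact add_nonneg hx hy

lemma ae_nonneg_convPow {ν : Measure ℝ} [IsFiniteMeasure ν] (hν : ∀ᵐ x ∂ν, 0 ≤ x) (n : ℕ) :
    ∀ᵐ x ∂(convPow ν n), 0 ≤ x := by
  induction n with
  | zero => simp [convPow]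
  | succ n ih => exact ae_nonneg_conv ih hν

/-- Finite measures on `[0, 1]` are determined by their moments. -/
lemma ext_of_moments {μ ν : Measure ℝ} [IsFiniteMeasure μ] [IsFiniteMeasure ν]
    (hμ : ∀ᵐ x ∂μ, |x| ≤ 1) (hν : ∀ᵐ x ∂ν, |x| ≤ 1)
    (h : ∀ n : ℕ, ∫ x, x ^ n ∂μ = ∫ x, x ^ n ∂ν) : μ = ν := by
  have key (ρ : Measure ℝ) [IsFiniteMeasure ρ] (hρ : ∀ᵐ x ∂ρ, |x| ≤ 1) (t : ℝ) :
      charFun ρ t = ∑' n : ℕ, (t * Complex.I) ^ n / n.factorial * ((∫ x, x ^ n ∂ρ : ℝ) : ℂ) := by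
    have hb (n : ℕ) : ∀ᵐ x ∂ρ, ‖(t * Complex.I) ^ n / n.factorial * ((x ^ n : ℝ) : ℂ)‖
        ≤ |t| ^ n / n.factorial := by
      filter_upwards [hρ] with x hx
      have : |x| ^ n ≤ 1 := pow_le_one₀ (abs_nonneg _) hx
      simpa using mul_le_of_le_one_right (by positivity) this
    have hi (n : ℕ) : Integrable (fun x : ℝ => (t * Complex.I) ^ n / n.factorial *
        ((x ^ n : ℝ) : ℂ)) ρ :=
      Integrable.of_bound (by fun_prop) _ (hb n)
    have hs : Summable fun n : ℕ => ∫ x, ‖(t * Complex.I) ^ n / n.factorial *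
        ((x ^ n : ℝ) : ℂ)‖ ∂ρ := by
      refine Summable.of_nonneg_of_le (fun n => integral_nonneg fun _ => norm_nonneg _)
        (fun n => ?_) ((Real.summable_pow_div_factorial |t|).mul_right (ρ.real univ))
      refine (integral_mono_ae (hi n).norm (integrable_const _) (hb n)).trans ?_
      simp [mul_comm]
    rw [charFun_apply_real]
    have := (hasSum_integral_of_summable_integral_norm hi hs).tsum_eq
    simp_rw [← integral_complex_ofReal, ← integral_const_mul]
    rw [this]
    refine integral_congr_ae (Eventually.of_forall fun x => ?_)
    simp only
    rw [Complex.exp_eq_exp_ℂ, NormedSpace.exp_eq_tsum_div]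
    refine tsum_congr fun n => ?_
    push_cast
    ring
  refine Measure.ext_of_charFun (funext fun t => ?_)
  rw [key μ hμ, key ν hν]
  simp_rw [h]

/-- Finite measures on `[0, ∞)` are determined by their Laplace transform. -/
lemma ext_of_laplaceTransform {μ ν : Measure ℝ} [IsFiniteMeasure μ] [IsFiniteMeasure ν]
    (hμ : ∀ᵐ x ∂μ, 0 ≤ x) (hν : ∀ᵐ x ∂ν, 0 ≤ x)
    (h : ∀ s : ℝ, 0 ≤ s → laplaceTransform μ s = laplaceTransform ν s) : μ = ν := by
  have hm : Measurable fun x : ℝ => exp (-x) := by fun_prop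
  have hmoment (ρ : Measure ℝ) (n : ℕ) :
      ∫ y, y ^ n ∂(ρ.map fun x : ℝ => exp (-x)) = (laplaceTransform ρ n).toReal := by
    rw [integral_map hm.aemeasurable (by fun_prop), laplaceTransform,
      integral_eq_lintegral_of_nonneg_ae (Eventually.of_forall fun x => by positivity)
        (by fun_prop)]
    simp_rw [← exp_nat_mul, mul_neg, neg_mul]
  have hle {ρ : Measure ℝ} (hρ : ∀ᵐ x ∂ρ, 0 ≤ x) :
      ∀ᵐ y ∂(ρ.map fun x : ℝ => exp (-x)), |y| ≤ 1 := by
    rw [ae_map_iff hm.aemeasurable (measurableSet_le (by fun_prop) (by fun_prop))]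
    filter_upwards [hρ] with x hx
    rw [abs_of_pos (exp_pos _)]
    exact exp_le_one_iff.mpr (by linarith)
  have heq : (μ.map fun x : ℝ => exp (-x)) = ν.map fun x : ℝ => exp (-x) :=
    ext_of_moments (hle hμ) (hle hν) fun n => by
      rw [hmoment, hmoment, h n (by positivity)]
  have hback (ρ : Measure ℝ) :
      (ρ.map fun x : ℝ => exp (-x)).map (fun y => -Real.log y) = ρ := by
    rw [Measure.map_map (by fun_prop) hm]
    convert Measure.map_id
    ext x
    simp
  rw [← hback μ, heq, hback ν]

/-- The compound Poisson distribution with jump measure `ρ`. -/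
noncomputable def compoundPoisson (ρ : Measure ℝ) : Measure ℝ :=
  ENNReal.ofReal (exp (-(ρ.real univ))) •
    Measure.sum fun n : ℕ => ENNReal.ofReal (n.factorial : ℝ)⁻¹ • convPow ρ n

lemma laplaceTransform_compoundPoisson (ρ : Measure ℝ) [IsFiniteMeasure ρ] {s : ℝ}
    (hs : laplaceTransform ρ s ≠ ∞) :
    laplaceTransform (compoundPoisson ρ) s =
      ENNReal.ofReal (exp ((laplaceTransform ρ s).toReal - ρ.real univ)) := by
  set a := (laplaceTransform ρ s).toReal with ha
  have h0 : 0 ≤ a := ENNReal.toReal_nonneg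
  have hsum : ∑' n : ℕ, ENNReal.ofReal (a ^ n / n.factorial) = ENNReal.ofReal (exp a) := by
    rw [← ENNReal.ofReal_tsum_of_nonneg (fun n => by positivity)
      (Real.summable_pow_div_factorial a), Real.exp_eq_exp_ℝ, NormedSpace.exp_eq_tsum_div]
  rw [compoundPoisson, laplaceTransform, lintegral_smul_measure, lintegral_sum_measure,
    sub_eq_neg_add, exp_add, ENNReal.ofReal_mul (exp_pos _).le, ← hsum, smul_eq_mul]
  congr 1
  refine tsum_congr fun n => ?_
  rw [lintegral_smul_measure, ← laplaceTransform, laplaceTransform_convPow, smul_eq_mul,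
    ← ENNReal.ofReal_toReal hs, ← ha, ← ENNReal.ofReal_pow h0,
    ← ENNReal.ofReal_mul (by positivity), div_eq_inv_mul]

lemma isProbabilityMeasure_of_laplaceTransform {μ : Measure ℝ} (h : laplaceTransform μ 0 = 1) :
    IsProbabilityMeasure μ :=
  ⟨by simpa [laplaceTransform] using h⟩

lemma ae_nonneg_compoundPoisson {ρ : Measure ℝ} [IsFiniteMeasure ρ] (hρ : ∀ᵐ x ∂ρ, 0 ≤ x) :
    ∀ᵐ x ∂(compoundPoisson ρ), 0 ≤ x := by
  refine Measure.ae_smul_measure ?_ _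
  rw [Measure.ae_sum_iff' measurableSet_Ici]
  exact fun n => Measure.ae_smul_measure (ae_nonneg_convPow hρ n) _

lemma laplaceTransform_gammaMeasure {a r s : ℝ} (ha : 0 < a) (hr : 0 < r) (hs : 0 ≤ s) :
    laplaceTransform (ProbabilityTheory.gammaMeasure a r) s =
      ENNReal.ofReal ((r / (r + s)) ^ a) := by
  have hrs : 0 < r + s := by linarith
  have hpt (x : ℝ) : ProbabilityTheory.gammaPDF a r x * ENNReal.ofReal (exp (-s * x)) =
      ENNReal.ofReal ((r / (r + s)) ^ a) * ProbabilityTheory.gammaPDF a (r + s) x := by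
    rw [ProbabilityTheory.gammaPDF, ProbabilityTheory.gammaPDF,
      ← ENNReal.ofReal_mul' (exp_pos _).le, ← ENNReal.ofReal_mul (by positivity)]
    congr 1
    unfold ProbabilityTheory.gammaPDFReal
    split_ifs with hx
    · have : exp (-((r + s) * x)) = exp (-(r * x)) * exp (-s * x) := by
        rw [← exp_add]; ring_nf
      rw [this, div_rpow hr.le hrs.le]
      have : (r + s) ^ a ≠ 0 := (rpow_pos_of_pos hrs a).ne'
      field_simp
    · simp
  have hmeas : Measurable (ProbabilityTheory.gammaPDF a r) :=
    (ProbabilityTheory.measurable_gammaPDFReal a r).ennreal_ofReal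
  have hmeas' : Measurable (ProbabilityTheory.gammaPDF a (r + s)) :=
    (ProbabilityTheory.measurable_gammaPDFReal a (r + s)).ennreal_ofReal
  rw [laplaceTransform, ProbabilityTheory.gammaMeasure,
    lintegral_withDensity_eq_lintegral_mul _ hmeas (by fun_prop)]
  simp only [Pi.mul_apply, hpt]
  rw [lintegral_const_mul _ hmeas', ProbabilityTheory.lintegral_gammaPDF_eq_one ha hrs, mul_one]

lemma ae_nonneg_gammaMeasure (a r : ℝ) : ∀ᵐ x ∂(ProbabilityTheory.gammaMeasure a r), 0 ≤ x := by
  have hmeas : Measurable (ProbabilityTheory.gammaPDF a r) :=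
    (ProbabilityTheory.measurable_gammaPDFReal a r).ennreal_ofReal
  rw [ProbabilityTheory.gammaMeasure, ae_withDensity_iff hmeas]
  refine Eventually.of_forall fun x hx => ?_
  by_contra! h
  exact hx (ProbabilityTheory.gammaPDF_of_neg h)

/-- A distribution on `[0, ∞)` whose Laplace transform is that of the convolution of an
exponential and a compound Poisson distribution is infinitely divisible. -/
lemma isInfinitelyDivisible_of_laplaceTransform {μ ρ : Measure ℝ} [IsFiniteMeasure ρ]
    (hμ : ∀ᵐ x ∂μ, 0 ≤ x) (hρ : ∀ᵐ x ∂ρ, 0 ≤ x) {r : ℝ} (hr : 0 < r)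
    (h : ∀ s : ℝ, 0 ≤ s → laplaceTransform μ s =
      ENNReal.ofReal (r / (r + s) * exp ((laplaceTransform ρ s).toReal - ρ.real univ))) :
    IsInfinitelyDivisible μ := by
  have hfin (s : ℝ) (hs : 0 ≤ s) : laplaceTransform ρ s ≠ ∞ := by
    refine ne_top_of_le_ne_top (measure_ne_top ρ univ) ?_
    rw [← lintegral_one]
    refine lintegral_mono_ae ?_
    filter_upwards [hρ] with x hx
    rw [ENNReal.ofReal_le_one, exp_le_one_iff]
    nlinarith
  have hρ0 : (laplaceTransform ρ 0).toReal = ρ.real univ := by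
    simp [laplaceTransform, Measure.real]
  intro n hn
  have hn' : (0 : ℝ) < n := by exact_mod_cast hn
  set c : ℝ≥0 := (n : ℝ≥0)⁻¹ with hc
  have hcr : (n : ℝ)⁻¹ = c := by simp [hc]
  have hcs (s : ℝ) : (laplaceTransform (c • ρ) s) = ENNReal.ofReal (n : ℝ)⁻¹ *
      laplaceTransform ρ s := by
    rw [laplaceTransform, laplaceTransform, lintegral_smul_measure]
    rw [ENNReal.smul_def, smul_eq_mul, hcr, ENNReal.ofReal_coe_nnreal]
  have hcu : (c • ρ).real univ = (n : ℝ)⁻¹ * ρ.real univ := by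
    rw [measureReal_nnreal_smul_apply, hcr]
  set σ := (ProbabilityTheory.gammaMeasure (n : ℝ)⁻¹ r).conv (compoundPoisson (c • ρ)) with hσ
  have := ProbabilityTheory.isProbabilityMeasure_gammaMeasure (inv_pos.2 hn') hr
  have hCP (s : ℝ) (hs : 0 ≤ s) : laplaceTransform (compoundPoisson (c • ρ)) s =
      ENNReal.ofReal (exp ((n : ℝ)⁻¹ * ((laplaceTransform ρ s).toReal - ρ.real univ))) := by
    have hne : laplaceTransform (c • ρ) s ≠ ∞ := by
      rw [hcs]; exact ENNReal.mul_ne_top ENNReal.ofReal_ne_top (hfin s hs)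
    rw [laplaceTransform_compoundPoisson _ hne, hcu, hcs, ENNReal.toReal_mul,
      ENNReal.toReal_ofReal (by positivity), mul_sub]
  have hCPprob : IsProbabilityMeasure (compoundPoisson (c • ρ)) :=
    isProbabilityMeasure_of_laplaceTransform (by simp [hCP 0 le_rfl, hρ0])
  have hσprob : IsProbabilityMeasure σ := by rw [hσ]; infer_instance
  have hμprob : IsProbabilityMeasure μ :=
    isProbabilityMeasure_of_laplaceTransform (by simp [h 0 le_rfl, hρ0, hr.ne'])
  have hσnonneg : ∀ᵐ x ∂σ, 0 ≤ x :=
    ae_nonneg_conv (ae_nonneg_gammaMeasure _ _)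
      (ae_nonneg_compoundPoisson (Measure.ae_smul_measure hρ _))
  refine ⟨σ, hσprob, ext_of_laplaceTransform hμ (ae_nonneg_convPow hσnonneg n) fun s hs => ?_⟩
  have hrs : 0 < r / (r + s) := by positivity
  rw [laplaceTransform_convPow, h s hs, hσ, laplaceTransform_conv,
    laplaceTransform_gammaMeasure (inv_pos.2 hn') hr hs, hCP s hs,
    ← ENNReal.ofReal_mul (by positivity), ← ENNReal.ofReal_pow (by positivity), mul_pow,
    rpow_inv_natCast_pow hrs.le hn.ne', ← exp_nat_mul, ← mul_assoc,
    mul_inv_cancel₀ hn'.ne', one_mul]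

lemma integrableOn_mul_exp_neg_two_mul :
    IntegrableOn (fun y : ℝ => 2 * y * exp (-2 * y)) (Ioi 0) := by
  have := (integrableOn_rpow_mul_exp_neg_mul_rpow (p := 1) (s := 1) (b := 2)
    (by norm_num) one_pos (by norm_num)).const_mul 2
  simpa only [IntegrableOn, rpow_one, mul_assoc] using this

lemma integral_mul_exp_neg_two_mul : ∫ y in Ioi (0 : ℝ), 2 * y * exp (-2 * y) = 1 / 2 := by
  have h := Real.integral_rpow_mul_exp_neg_mul_Ioi (a := 2) (r := 2) (by norm_num) (by norm_num)
  norm_num [rpow_one] at h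
  simp_rw [mul_assoc]
  rw [integral_const_mul]
  simp only [neg_mul]
  rw [h]
  norm_num

/-- The renewal equation `z(x) = x h(x) + ∫₀ˣ h(y) z(x - y) dy` has a continuous nonnegative
solution. -/
lemma exists_renewal_solution {h : ℝ → ℝ} (hc : Continuous h) (h0 : ∀ y, 0 ≤ y → 0 ≤ h y)
    (hle : ∀ y, 0 ≤ y → h y ≤ 2 * y) :
    ∃ z : ℝ → ℝ, Continuous z ∧ (∀ x, 0 ≤ z x) ∧ (∀ x ≤ 0, z x = 0) ∧
      ∀ x, 0 ≤ x → z x = x * h x + ∫ y in (0 : ℝ)..x, h y * z (x - y) := by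
  set H : ℝ → ℝ := fun y => h y * exp (-2 * y) with hH
  have hHc : Continuous H := by fun_prop
  have hH0 {y : ℝ} (hy : 0 ≤ y) : 0 ≤ H y := mul_nonneg (h0 y hy) (exp_pos _).le
  have hHle {y : ℝ} (hy : 0 ≤ y) : H y ≤ 2 * y * exp (-2 * y) :=
    mul_le_mul_of_nonneg_right (hle y hy) (exp_pos _).le
  have hHi : IntegrableOn H (Ioi 0) := by
    refine integrableOn_mul_exp_neg_two_mul.mono' hHc.aestronglyMeasurable ?_
    refine (ae_restrict_iff' measurableSet_Ioi).2 (Eventually.of_forall fun y hy => ?_)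
    rw [norm_of_nonneg (hH0 (le_of_lt hy))]
    exact hHle (le_of_lt hy)
  have hHint : ∫ y in Ioi 0, H y ≤ 1 / 2 := by
    rw [← integral_mul_exp_neg_two_mul]
    exact setIntegral_mono_on hHi integrableOn_mul_exp_neg_two_mul measurableSet_Ioi
      fun y hy => hHle (le_of_lt hy)
  set G : ℝ → ℝ := fun x => max x 0 * H (max x 0) with hG
  have hGc : Continuous G := by fun_prop
  have hG0 (x : ℝ) : 0 ≤ G x := mul_nonneg (le_max_right _ _) (hH0 (le_max_right _ _))
  have hG1 (x : ℝ) : G x ≤ 1 := by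
    set w := max x 0 with hw
    have hw0 : 0 ≤ w := le_max_right _ _
    have h1 : G x ≤ w * (2 * w * exp (-2 * w)) := mul_le_mul_of_nonneg_left (hHle hw0) hw0
    have h2 := quadratic_le_exp_of_nonneg (x := 2 * w) (by positivity)
    have h3 : exp (-2 * w) * exp (2 * w) = 1 := by rw [← exp_add]; simp
    nlinarith [exp_pos (-2 * w)]
  -- integrals against bounded continuous functions
  have hprod (u : ℝ →ᵇ ℝ) (x : ℝ) : IntegrableOn (fun y => H y * u (x - y)) (Ioi 0) := by
    refine Integrable.mul_bdd (c := ‖u‖) hHi (by fun_prop) ?_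
    exact Eventually.of_forall fun y => u.norm_coe_le_norm _
  have hbound (u : ℝ →ᵇ ℝ) (x : ℝ) : |∫ y in Ioi 0, H y * u (x - y)| ≤ 1 / 2 * ‖u‖ := by
    calc |∫ y in Ioi 0, H y * u (x - y)| ≤ ∫ y in Ioi 0, H y * ‖u‖ := by
          rw [← Real.norm_eq_abs]
          refine norm_integral_le_of_norm_le (hHi.mul_const ‖u‖) ?_
          refine (ae_restrict_iff' measurableSet_Ioi).2 (Eventually.of_forall fun y hy => ?_)
          rw [norm_mul, norm_of_nonneg (hH0 (le_of_lt hy))]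
          exact mul_le_mul_of_nonneg_left (u.norm_coe_le_norm _) (hH0 (le_of_lt hy))
      _ ≤ 1 / 2 * ‖u‖ := by
          rw [integral_mul_const]
          exact mul_le_mul_of_nonneg_right hHint (norm_nonneg _)
  have hcont (u : ℝ →ᵇ ℝ) : Continuous fun x => G x + ∫ y in Ioi 0, H y * u (x - y) := by
    refine hGc.add (continuous_of_dominated (bound := fun y => |H y| * ‖u‖) ?_ ?_ ?_ ?_)
    · exact fun x => Continuous.aestronglyMeasurable (by fun_prop)
    · refine fun x => Eventually.of_forall fun y => ?_
      rw [norm_mul]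
      exact mul_le_mul_of_nonneg_left (u.norm_coe_le_norm _) (norm_nonneg _)
    · exact hHi.norm.mul_const _
    · exact Eventually.of_forall fun y => by fun_prop
  let T : (ℝ →ᵇ ℝ) → (ℝ →ᵇ ℝ) := fun u =>
    BoundedContinuousFunction.ofNormedAddCommGroup _ (hcont u) (1 + 1 / 2 * ‖u‖) fun x => by
      refine (norm_add_le _ _).trans (add_le_add ?_ (hbound u x))
      rw [norm_of_nonneg (hG0 x)]
      exact hG1 x
  have hT (u : ℝ →ᵇ ℝ) (x : ℝ) : T u x = G x + ∫ y in Ioi 0, H y * u (x - y) := rfl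
  set S : Set (ℝ →ᵇ ℝ) := {u | (∀ x, 0 ≤ u x) ∧ ∀ x ≤ 0, u x = 0} with hS
  have hSclosed : IsClosed S := by
    have hev (x : ℝ) : Continuous fun u : ℝ →ᵇ ℝ => u x := by fun_prop
    simp only [hS, ofPred_and, ofPred_forall]
    exact (isClosed_iInter fun x => isClosed_le continuous_const (hev x)).inter
      (isClosed_iInter fun x => isClosed_iInter fun _ => isClosed_eq (hev x) continuous_const)
  have hmaps : MapsTo T S S := by
    rintro u ⟨hu0, hu⟩
    refine ⟨fun x => ?_, fun x hx => ?_⟩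
    · exact add_nonneg (hG0 x) (setIntegral_nonneg measurableSet_Ioi fun y hy =>
        mul_nonneg (hH0 (le_of_lt hy)) (hu0 _))
    · rw [hT, setIntegral_eq_zero_of_forall_eq_zero]
      · simp [hG, hx]
      · intro y hy
        rw [hu (x - y) (by linarith [mem_Ioi.1 hy]), mul_zero]
  have hdist (u v : ℝ →ᵇ ℝ) : dist (T u) (T v) ≤ 1 / 2 * dist u v := by
    refine (BoundedContinuousFunction.dist_le (by positivity)).2 fun x => ?_
    rw [hT, hT, dist_add_left, Real.dist_eq, ← integral_sub (hprod u x) (hprod v x), dist_eq_norm]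
    convert hbound (u - v) x using 3
    ext y
    simp [mul_sub]
  have hcontr : ContractingWith (1 / 2) (hmaps.restrict T S S) := by
    refine ⟨by norm_num, LipschitzWith.of_dist_le_mul fun u v => ?_⟩
    rw [Subtype.dist_eq, Subtype.dist_eq]
    simpa using hdist u v
  obtain ⟨u, ⟨hu0, hu⟩, hfix, -⟩ := hcontr.exists_fixedPoint' hSclosed.isComplete hmaps
    (x := 0) (by simp [hS]) (edist_ne_top _ _)
  have hux (x : ℝ) : u x = G x + ∫ y in Ioi 0, H y * u (x - y) := by
    conv_lhs => rw [← hfix]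
    rfl
  refine ⟨fun x => exp (2 * x) * u x, by fun_prop, fun x => mul_nonneg (exp_pos _).le (hu0 x),
    fun x hx => by simp [hu x hx], fun x hx => ?_⟩
  have hxx : exp (2 * x) * exp (-2 * x) = 1 := by rw [← exp_add]; simp
  simp only
  rw [hux, mul_add, ← integral_const_mul]
  congr 1
  · simp only [hG, hH, max_eq_left hx]
    linear_combination x * h x * hxx
  · rw [intervalIntegral.integral_of_le hx]
    have : ∀ y : ℝ, exp (2 * x) * (H y * u (x - y)) = h y * (exp (2 * (x - y)) * u (x - y)) := by
      intro y
      have : exp (2 * (x - y)) = exp (2 * x) * exp (-2 * y) := by rw [← exp_add]; ring_nf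
      rw [this]
      ring
    simp_rw [this]
    refine setIntegral_eq_of_subset_of_forall_sdiff_eq_zero measurableSet_Ioi Ioc_subset_Ioi_self ?_
    rintro y ⟨hy, hyx⟩
    have : x < y := by
      by_contra! hle
      exact hyx ⟨hy, hle⟩
    rw [hu (x - y) (by linarith)]
    simp

/-- Integrated form of the renewal equation. -/
lemma integral_mul_renewal_solution {f h z : ℝ → ℝ} (hfh : ∀ x, HasDerivAt f (-h x) x)
    (hf0 : f 0 = 1) (hc : Continuous h) (hz : Continuous z) (hz0 : ∀ x ≤ 0, z x = 0)
    (hzh : ∀ x, 0 ≤ x → z x = x * h x + ∫ y in (0 : ℝ)..x, h y * z (x - y))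
    {x : ℝ} (hx : 0 ≤ x) :
    ∫ y in (0 : ℝ)..x, f y * z (x - y) = (∫ y in (0 : ℝ)..x, f y) - x * f x := by
  have hfc : Continuous f := continuous_iff_continuousAt.2 fun x => (hfh x).continuousAt
  set Z : ℝ → ℝ := fun v => ∫ t in (0 : ℝ)..v, z t with hZ
  have hZd (v : ℝ) : HasDerivAt Z (z v) v := by
    exact intervalIntegral.integral_hasDerivAt_right (hz.intervalIntegrable _ _)
      (hz.stronglyMeasurableAtFilter _ _) hz.continuousAt
  have hZc : Continuous Z := continuous_iff_continuousAt.2 fun x => (hZd x).continuousAt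
  have hZ0 {v : ℝ} (hv : v ≤ 0) : Z v = 0 := by
    rw [hZ]
    simp only
    rw [intervalIntegral.integral_congr (g := fun _ => 0)]
    · simp
    · intro t ht
      rw [uIcc_of_ge hv] at ht
      exact hz0 t ht.2
  have hparts : ∫ y in (0 : ℝ)..x, h y * Z (x - y) = Z x - ∫ y in (0 : ℝ)..x, f y * z (x - y) := by
    have hd (y : ℝ) : HasDerivAt (fun y => f y * Z (x - y))
        (-(h y * Z (x - y) + f y * z (x - y))) y := by
      have h1 : HasDerivAt (fun y => Z (x - y)) (z (x - y) * -1) y :=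
        (hZd (x - y)).comp y ((hasDerivAt_id y).const_sub x)
      exact ((hfh y).fun_mul h1).congr_deriv (by ring)
    have := intervalIntegral.integral_eq_sub_of_hasDerivAt (a := 0) (b := x) (fun y _ => hd y)
      (Continuous.intervalIntegrable (by fun_prop) _ _)
    rw [intervalIntegral.integral_neg, intervalIntegral.integral_add
      (Continuous.intervalIntegrable (by fun_prop) _ _)
      (Continuous.intervalIntegrable (by fun_prop) _ _), sub_self, hZ0 le_rfl, hf0, sub_zero] at this
    linarith
  have hth : ∫ t in (0 : ℝ)..x, t * h t = (∫ y in (0 : ℝ)..x, f y) - x * f x := by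
    have hd (y : ℝ) : HasDerivAt (fun y => y * f y) (f y - y * h y) y := by
      exact ((hasDerivAt_id' y).fun_mul (hfh y)).congr_deriv (by ring)
    have := intervalIntegral.integral_eq_sub_of_hasDerivAt (a := 0) (b := x) (fun y _ => hd y)
      (Continuous.intervalIntegrable (by fun_prop) _ _)
    rw [intervalIntegral.integral_sub
      (Continuous.intervalIntegrable (by fun_prop) _ _)
      (Continuous.intervalIntegrable (by fun_prop) _ _)] at this
    linarith
  have hzx : EqOn z (fun t => t * h t + ∫ y in (0 : ℝ)..x, h y * z (t - y)) (uIcc 0 x) := by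
    intro t ht
    rw [uIcc_of_le hx] at ht
    simp only
    rw [hzh t ht.1, ← intervalIntegral.integral_add_adjacent_intervals (a := 0) (b := t) (c := x)
      (Continuous.intervalIntegrable (by fun_prop) _ _)
      (Continuous.intervalIntegrable (by fun_prop) _ _)]
    have : ∫ y in t..x, h y * z (t - y) = 0 := by
      rw [intervalIntegral.integral_congr (g := fun _ => 0)]
      · simp
      · intro y hy
        rw [uIcc_of_le ht.2] at hy
        simp [hz0 (t - y) (by linarith [hy.1])]
    rw [this, add_zero]
  have hswap : ∫ t in (0 : ℝ)..x, ∫ y in (0 : ℝ)..x, h y * z (t - y) =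
      ∫ y in (0 : ℝ)..x, h y * Z (x - y) := by
    rw [intervalIntegral_intervalIntegral_swap]
    · refine intervalIntegral.integral_congr fun y hy => ?_
      rw [uIcc_of_le hx] at hy
      rw [intervalIntegral.integral_const_mul, intervalIntegral.integral_comp_sub_right, zero_sub,
        ← intervalIntegral.integral_add_adjacent_intervals (b := 0)
          (hz.intervalIntegrable _ _) (hz.intervalIntegrable _ _),
        intervalIntegral.integral_symm 0 (-y)]
      change h y * (-Z (-y) + Z (x - y)) = _
      rw [hZ0 (by linarith [hy.1]), neg_zero, zero_add]
    · refine IntegrableOn.mono_set (t := uIcc 0 x ×ˢ uIcc 0 x) ?_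
        (prod_mono uIoc_subset_uIcc uIoc_subset_uIcc)
      refine ContinuousOn.integrableOn_compact (isCompact_uIcc.prod isCompact_uIcc) ?_
      refine Continuous.continuousOn ?_
      unfold Function.uncurry
      fun_prop
  have hmain : Z x = (∫ t in (0 : ℝ)..x, t * h t) + ∫ y in (0 : ℝ)..x, h y * Z (x - y) := by
    rw [← hswap]
    change (∫ t in (0 : ℝ)..x, z t) = _
    rw [intervalIntegral.integral_congr hzx, intervalIntegral.integral_add
      (Continuous.intervalIntegrable (by fun_prop) _ _)
      (Continuous.intervalIntegrable ?_ _ _)]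
    refine intervalIntegral.continuous_parametric_intervalIntegral_of_continuous' ?_ _ _
    fun_prop
  linarith

/-- The unnormalised Student-t density `(1 + x²)^(-a)`. -/
noncomputable def tDensity (a x : ℝ) : ℝ := (1 + x ^ 2) ^ (-a)

/-- Minus the derivative of `tDensity`. -/
noncomputable def tDensityDecay (a x : ℝ) : ℝ := tDensity a x * (2 * a * x / (1 + x ^ 2))

lemma tDensity_pos (a x : ℝ) : 0 < tDensity a x := rpow_pos_of_pos (by positivity) _

lemma tDensity_zero (a : ℝ) : tDensity a 0 = 1 := by simp [tDensity]

lemma continuous_tDensity (a : ℝ) : Continuous (tDensity a) :=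
  Continuous.rpow_const (by fun_prop) fun x => Or.inl (by positivity)

lemma continuous_tDensityDecay (a : ℝ) : Continuous (tDensityDecay a) :=
  (continuous_tDensity a).mul (Continuous.div₀ (by fun_prop) (by fun_prop) fun x => by positivity)

lemma tDensity_le_one {a : ℝ} (ha : 0 ≤ a) (x : ℝ) : tDensity a x ≤ 1 :=
  rpow_le_one_of_one_le_of_nonpos (by nlinarith [sq_nonneg x]) (by linarith)

lemma hasDerivAt_tDensity (a x : ℝ) : HasDerivAt (tDensity a) (-tDensityDecay a x) x := by
  have h1 : HasDerivAt (fun x : ℝ => 1 + x ^ 2) (2 * x) x := by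
    simpa using (hasDerivAt_pow 2 x).const_add 1
  have h2 : HasDerivAt (tDensity a) _ x := h1.rpow_const (p := -a) (Or.inl (by positivity))
  convert h2 using 1
  rw [tDensityDecay, tDensity, rpow_sub_one (by positivity)]
  ring

lemma tDensityDecay_nonneg {a x : ℝ} (ha : 0 ≤ a) (hx : 0 ≤ x) : 0 ≤ tDensityDecay a x :=
  mul_nonneg (tDensity_pos a x).le (by positivity)

lemma tDensityDecay_le {a x : ℝ} (ha : 0 ≤ a) (ha1 : a ≤ 1) (hx : 0 ≤ x) :
    tDensityDecay a x ≤ 2 * x := by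
  have h1 : 2 * a * x / (1 + x ^ 2) ≤ 2 * x := by
    rw [div_le_iff₀ (by positivity)]
    nlinarith [mul_nonneg hx (sub_nonneg.2 ha1), mul_nonneg hx (sq_nonneg x)]
  calc tDensityDecay a x ≤ 1 * (2 * a * x / (1 + x ^ 2)) :=
        mul_le_mul_of_nonneg_right (tDensity_le_one ha x) (by positivity)
    _ ≤ 2 * x := by rwa [one_mul]

lemma one_div_le_tDensity {a : ℝ} (ha1 : a ≤ 1) (x : ℝ) :
    1 / (1 + x ^ 2) ≤ tDensity a x := by
  rw [one_div, ← rpow_neg_one]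
  exact rpow_le_rpow_of_exponent_le (by nlinarith [sq_nonneg x]) (by linarith)

lemma integral_tDensityDecay (a x : ℝ) :
    ∫ y in (0 : ℝ)..x, tDensityDecay a y = 1 - tDensity a x := by
  have := intervalIntegral.integral_eq_sub_of_hasDerivAt (a := 0) (b := x)
    (fun y _ => hasDerivAt_tDensity a y)
    ((continuous_tDensityDecay a).neg.intervalIntegrable _ _)
  rw [intervalIntegral.integral_neg, tDensity_zero] at this
  linarith

lemma tDensity_mul_hazard_sub_le {a x y : ℝ} (ha : 0 ≤ a) (ha1 : a ≤ 1) (hy : 0 ≤ y)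
    (hyx : y ≤ x) :
    tDensity a y * (2 * a * x / (1 + x ^ 2) - 2 * a * y / (1 + y ^ 2)) ≤
      tDensity a x * (2 * (x - y) * max (1 - x * y) 0) := by
  have hX : 0 < 1 + x ^ 2 := by positivity
  have hY : 0 < 1 + y ^ 2 := by positivity
  have hid : 2 * a * x / (1 + x ^ 2) - 2 * a * y / (1 + y ^ 2) =
      2 * a * (x - y) * (1 - x * y) / ((1 + x ^ 2) * (1 + y ^ 2)) := by
    field_simp
    ring
  have hfx := tDensity_pos a x
  have hfy := tDensity_pos a y
  have hd : 0 ≤ x - y := sub_nonneg.2 hyx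
  rw [hid]
  rcases le_total (1 - x * y) 0 with hn | hp
  · rw [max_eq_right hn, mul_zero, mul_zero]
    refine mul_nonpos_of_nonneg_of_nonpos hfy.le (div_nonpos_of_nonpos_of_nonneg ?_ (by positivity))
    exact mul_nonpos_of_nonneg_of_nonpos (by positivity) hn
  · rw [max_eq_left hp]
    have hratio : tDensity a y ≤ tDensity a x * ((1 + x ^ 2) / (1 + y ^ 2)) := by
      have h1 : 1 ≤ (1 + x ^ 2) / (1 + y ^ 2) := by
        rw [le_div_iff₀ hY]; nlinarith
      have h2 : ((1 + x ^ 2) / (1 + y ^ 2)) ^ a ≤ (1 + x ^ 2) / (1 + y ^ 2) := by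
        simpa using rpow_le_rpow_of_exponent_le h1 ha1
      have h3 : tDensity a y = tDensity a x * ((1 + x ^ 2) / (1 + y ^ 2)) ^ a := by
        rw [tDensity, tDensity, rpow_neg hX.le, rpow_neg hY.le, div_rpow hX.le hY.le]
        have : (1 + x ^ 2) ^ a ≠ 0 := (rpow_pos_of_pos hX a).ne'
        field_simp
      rw [h3]
      exact mul_le_mul_of_nonneg_left h2 hfx.le
    calc tDensity a y * (2 * a * (x - y) * (1 - x * y) / ((1 + x ^ 2) * (1 + y ^ 2)))
        ≤ tDensity a x * ((1 + x ^ 2) / (1 + y ^ 2)) *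
          (2 * a * (x - y) * (1 - x * y) / ((1 + x ^ 2) * (1 + y ^ 2))) :=
          mul_le_mul_of_nonneg_right hratio (by positivity)
      _ = tDensity a x * (2 * (x - y) * (1 - x * y) * (a / (1 + y ^ 2) ^ 2)) := by
          field_simp
      _ ≤ tDensity a x * (2 * (x - y) * (1 - x * y)) := by
          refine mul_le_mul_of_nonneg_left (mul_le_of_le_one_right (by positivity) ?_) hfx.le
          rw [div_le_one (by positivity)]
          nlinarith [sq_nonneg y, sq_nonneg (y ^ 2)]

lemma integral_sub_mul_one_sub (x b : ℝ) :
    ∫ y in (0 : ℝ)..b, 2 * (x - y) * (1 - x * y) =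
      2 * x * b - (1 + x ^ 2) * b ^ 2 + 2 / 3 * x * b ^ 3 := by
  have hd (y : ℝ) : HasDerivAt
      (fun y : ℝ => 2 * x * y - (1 + x ^ 2) * y ^ 2 + 2 / 3 * x * y ^ 3)
      (2 * (x - y) * (1 - x * y)) y := by
    exact ((((hasDerivAt_id' y).const_mul (2 * x)).fun_sub
      ((hasDerivAt_pow 2 y).const_mul (1 + x ^ 2))).fun_add
      ((hasDerivAt_pow 3 y).const_mul (2 / 3 * x))).congr_deriv (by push_cast; ring)
  rw [intervalIntegral.integral_eq_sub_of_hasDerivAt (fun y _ => hd y)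
    (Continuous.intervalIntegrable (by fun_prop) _ _)]
  ring

lemma exp_neg_le_of_le_one {x : ℝ} (hx : 0 ≤ x) (hx1 : x ≤ 1) :
    exp (-4 * x) ≤ 1 / (1 + x ^ 2) * (1 - x ^ 2 + x ^ 4 / 3) := by
  have h1 := quadratic_le_exp_of_nonneg (x := 4 * x) (by positivity)
  have h2 : exp (-4 * x) * exp (4 * x) = 1 := by rw [← exp_add]; simp
  have hx2 : x ^ 2 ≤ 1 := by nlinarith
  have hP : 1 / 3 ≤ 1 - x ^ 2 + x ^ 4 / 3 := by nlinarith [sq_nonneg (1 - x ^ 2)]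
  have h3 : 1 + x ^ 2 ≤ (1 - x ^ 2 + x ^ 4 / 3) * exp (4 * x) := by
    have : (1 - x ^ 2 + x ^ 4 / 3) * (1 + 4 * x + (4 * x) ^ 2 / 2) ≤
        (1 - x ^ 2 + x ^ 4 / 3) * exp (4 * x) := mul_le_mul_of_nonneg_left h1 (by linarith)
    nlinarith [mul_nonneg (sub_nonneg.2 hP) (by positivity : 0 ≤ 4 * x + 8 * x ^ 2),
      sq_nonneg (x ^ 2)]
  rw [one_div, ← div_eq_inv_mul, le_div_iff₀ (by positivity)]
  have hpos := exp_pos (-4 * x)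
  calc exp (-4 * x) * (1 + x ^ 2) ≤ exp (-4 * x) * ((1 - x ^ 2 + x ^ 4 / 3) * exp (4 * x)) :=
        mul_le_mul_of_nonneg_left h3 hpos.le
    _ = 1 - x ^ 2 + x ^ 4 / 3 := by linear_combination (1 - x ^ 2 + x ^ 4 / 3) * h2

lemma exp_neg_le_of_one_le {x : ℝ} (hx1 : 1 ≤ x) :
    exp (-4 * x) ≤ 1 / (1 + x ^ 2) * (1 / (3 * x ^ 2)) := by
  have h1 := pow_div_factorial_le_exp (x := 4 * x) (by positivity) 4
  have h2 : exp (-4 * x) * exp (4 * x) = 1 := by rw [← exp_add]; simp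
  have hpos := exp_pos (-4 * x)
  have h3 : (1 + x ^ 2) * (3 * x ^ 2) ≤ exp (4 * x) := by
    refine le_trans ?_ h1
    have : (Nat.factorial 4 : ℝ) = 24 := by norm_num [Nat.factorial]
    rw [this]
    nlinarith [mul_nonneg (sq_nonneg x) (by nlinarith : 0 ≤ x ^ 2 - 1)]
  rw [div_mul_div_comm, le_div_iff₀ (by positivity), one_mul]
  calc exp (-4 * x) * ((1 + x ^ 2) * (3 * x ^ 2)) ≤ exp (-4 * x) * exp (4 * x) :=
        mul_le_mul_of_nonneg_left h3 hpos.le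
    _ = 1 := h2

lemma integral_two_mul_sub_mul_max_of_le_one {x : ℝ} (hx : 0 ≤ x) (hx1 : x ≤ 1) :
    ∫ y in (0 : ℝ)..x, 2 * (x - y) * max (1 - x * y) 0 = x ^ 2 - x ^ 4 / 3 := by
  rw [intervalIntegral.integral_congr (g := fun y => 2 * (x - y) * (1 - x * y)),
    integral_sub_mul_one_sub]
  · ring
  · intro y hy
    rw [uIcc_of_le hx] at hy
    simp only
    rw [max_eq_left (by nlinarith [hy.1, hy.2])]

lemma integral_two_mul_sub_mul_max_of_one_le {x : ℝ} (hx1 : 1 ≤ x) :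
    ∫ y in (0 : ℝ)..x, 2 * (x - y) * max (1 - x * y) 0 = 1 - 1 / (3 * x ^ 2) := by
  have hx : 0 < x := by linarith
  have hxi : 1 / x ≤ x := by rw [div_le_iff₀ hx]; nlinarith
  rw [← intervalIntegral.integral_add_adjacent_intervals (b := 1 / x)
      (Continuous.intervalIntegrable (by fun_prop) _ _)
      (Continuous.intervalIntegrable (by fun_prop) _ _),
    intervalIntegral.integral_congr (a := 0) (g := fun y => 2 * (x - y) * (1 - x * y)),
    integral_sub_mul_one_sub, intervalIntegral.integral_congr (a := 1 / x) (g := fun _ => 0)]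
  · simp only [intervalIntegral.integral_zero]
    field_simp
    ring
  · intro y hy
    rw [uIcc_of_le hxi] at hy
    have := (div_le_iff₀ hx).1 hy.1
    simp only
    rw [max_eq_right (by linarith), mul_zero]
  · intro y hy
    rw [uIcc_of_le (by positivity)] at hy
    have := (le_div_iff₀ hx).1 hy.2
    simp only
    rw [max_eq_left (by linarith)]

/-- The kernel `k` solving `x f(x) = ∫₀ˣ f(y) k(x - y) dy` for `f = tDensity a`: it is the density
of `x ↦ x ν(dx)`, for `ν` the Lévy measure of the normalised `f`. -/
lemma exists_levy_kernel {a : ℝ} (ha : 0 ≤ a) (ha1 : a ≤ 1) :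
    ∃ k : ℝ → ℝ, Continuous k ∧ (∀ x, k x ≤ 1) ∧ (∀ x, 0 ≤ x → exp (-4 * x) ≤ k x) ∧
      ∀ x, 0 ≤ x → ∫ y in (0 : ℝ)..x, tDensity a y * k (x - y) = x * tDensity a x := by
  obtain ⟨z, hz, hz0, hz1, hzh⟩ := exists_renewal_solution (continuous_tDensityDecay a)
    (fun y hy => tDensityDecay_nonneg ha hy) (fun y hy => tDensityDecay_le ha ha1 hy)
  have hfc := continuous_tDensity a
  have hhc := continuous_tDensityDecay a
  set k : ℝ → ℝ := fun x => 1 - z x with hk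
  have hkc : Continuous k := by fun_prop
  have hk1 (x : ℝ) : k x ≤ 1 := sub_le_self _ (hz0 x)
  have hconv {x : ℝ} (hx : 0 ≤ x) :
      ∫ y in (0 : ℝ)..x, tDensity a y * k (x - y) = x * tDensity a x := by
    have := integral_mul_renewal_solution (hasDerivAt_tDensity a) (tDensity_zero a) hhc hz hz1
      hzh hx
    simp only [hk, mul_sub, mul_one]
    rw [intervalIntegral.integral_sub (Continuous.intervalIntegrable (by fun_prop) _ _)
      (Continuous.intervalIntegrable (by fun_prop) _ _), this]
    ring
  have hkh {x : ℝ} (hx : 0 ≤ x) : k x = tDensity a x - x * tDensityDecay a x +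
      ∫ y in (0 : ℝ)..x, tDensityDecay a y * k (x - y) := by
    simp only [hk, mul_sub, mul_one]
    rw [intervalIntegral.integral_sub (Continuous.intervalIntegrable (by fun_prop) _ _)
      (Continuous.intervalIntegrable (by fun_prop) _ _), integral_tDensityDecay, hzh x hx]
    ring
  have hkey {x : ℝ} (hx : 0 ≤ x) : k x = tDensity a x -
      ∫ y in (0 : ℝ)..x, tDensity a y *
        (2 * a * x / (1 + x ^ 2) - 2 * a * y / (1 + y ^ 2)) * k (x - y) := by
    have h1 : ∫ y in (0 : ℝ)..x, tDensity a y *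
        (2 * a * x / (1 + x ^ 2) - 2 * a * y / (1 + y ^ 2)) * k (x - y) =
        ∫ y in (0 : ℝ)..x, (2 * a * x / (1 + x ^ 2) * (tDensity a y * k (x - y)) -
          tDensityDecay a y * k (x - y)) :=
      intervalIntegral.integral_congr fun y _ => by
        simp only [tDensityDecay]
        ring
    rw [h1, intervalIntegral.integral_sub (Continuous.intervalIntegrable (by fun_prop) _ _)
      (Continuous.intervalIntegrable (by fun_prop) _ _), intervalIntegral.integral_const_mul,
      hconv hx, hkh hx, tDensityDecay]
    ring
  have hlower {x : ℝ} (hx : 0 ≤ x) (hnn : ∀ y, 0 ≤ y → y < x → 0 ≤ k y) :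
      exp (-4 * x) ≤ k x := by
    have hle : ∫ y in (0 : ℝ)..x, tDensity a y *
        (2 * a * x / (1 + x ^ 2) - 2 * a * y / (1 + y ^ 2)) * k (x - y) ≤
        ∫ y in (0 : ℝ)..x, tDensity a x * (2 * (x - y) * max (1 - x * y) 0) := by
      have hr : Continuous fun y : ℝ => 2 * a * x / (1 + x ^ 2) - 2 * a * y / (1 + y ^ 2) :=
        continuous_const.sub (Continuous.div₀ (by fun_prop) (by fun_prop) fun y => by positivity)
      refine intervalIntegral.integral_mono_on_of_le_Ioo hx
        (Continuous.intervalIntegrable ((hfc.mul hr).mul (by fun_prop)) _ _)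
        (Continuous.intervalIntegrable (by fun_prop) _ _) fun y hy => ?_
      have hky : 0 ≤ k (x - y) := hnn _ (by linarith [hy.2]) (by linarith [hy.1])
      have hM : 0 ≤ tDensity a x * (2 * (x - y) * max (1 - x * y) 0) :=
        mul_nonneg (tDensity_pos a x).le
          (mul_nonneg (by linarith [hy.2]) (le_max_right _ _))
      calc _ ≤ tDensity a x * (2 * (x - y) * max (1 - x * y) 0) * k (x - y) :=
            mul_le_mul_of_nonneg_right
              (tDensity_mul_hazard_sub_le ha ha1 hy.1.le hy.2.le) hky
        _ ≤ _ := mul_le_of_le_one_right hM (hk1 _)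
    rw [intervalIntegral.integral_const_mul] at hle
    have hlow : tDensity a x * (1 - ∫ y in (0 : ℝ)..x, 2 * (x - y) * max (1 - x * y) 0) ≤ k x := by
      rw [hkey hx]
      linarith
    refine le_trans ?_ hlow
    rcases le_total x 1 with h1 | h1
    · rw [integral_two_mul_sub_mul_max_of_le_one hx h1]
      refine (exp_neg_le_of_le_one hx h1).trans ?_
      rw [show 1 - x ^ 2 + x ^ 4 / 3 = 1 - (x ^ 2 - x ^ 4 / 3) by ring]
      exact mul_le_mul_of_nonneg_right (one_div_le_tDensity ha1 x) (by nlinarith)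
    · rw [integral_two_mul_sub_mul_max_of_one_le h1, sub_sub_cancel]
      exact (exp_neg_le_of_one_le h1).trans
        (mul_le_mul_of_nonneg_right (one_div_le_tDensity ha1 x) (by positivity))
  have hpos : ∀ x, 0 ≤ x → 0 < k x := by
    by_contra! hne
    set S : Set ℝ := {x | 0 ≤ x ∧ k x ≤ 0} with hS
    have hSne : S.Nonempty := hne
    have hSc : IsClosed S :=
      (isClosed_le continuous_const continuous_id).inter (isClosed_le hkc continuous_const)
    have hSb : BddBelow S := ⟨0, fun x hx => hx.1⟩
    have hmem := hSc.csInf_mem hSne hSb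
    have := hlower hmem.1 fun y hy0 hy => by
      by_contra! hky
      exact (notMem_of_lt_csInf hy hSb) ⟨hy0, hky.le⟩
    linarith [exp_pos (-4 * sInf S), hmem.2]
  exact ⟨k, hkc, hk1, fun x hx => hlower hx fun y hy _ => (hpos y hy).le, fun x hx => hconv hx⟩

lemma integrableOn_exp_neg_mul_mul {φ : ℝ → ℝ} (hφ : Measurable φ) {M : ℝ}
    (hM : ∀ u, 0 < u → |φ u| ≤ M) {s : ℝ} (hs : 0 < s) :
    IntegrableOn (fun u => exp (-s * u) * φ u) (Ioi 0) := by
  refine (exp_neg_integrableOn_Ioi 0 hs).mul_bdd (c := M) hφ.aestronglyMeasurable ?_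
  filter_upwards [ae_restrict_mem measurableSet_Ioi] with u hu using hM u hu

lemma integrableOn_mul_exp_neg_mul {s : ℝ} (hs : 0 < s) :
    IntegrableOn (fun u => u * exp (-s * u)) (Ioi 0) := by
  simpa using integrableOn_rpow_mul_exp_neg_mul_rpow (p := 1) (s := 1) (by norm_num) one_pos hs

/-- Differentiation of a Laplace integral under the integral sign. -/
lemma hasDerivAt_laplace {φ : ℝ → ℝ} (hφ : Measurable φ) {M : ℝ}
    (hM : ∀ u, 0 < u → |φ u| ≤ M) {s : ℝ} (hs : 0 < s) :
    HasDerivAt (fun s => ∫ u in Ioi (0 : ℝ), exp (-s * u) * φ u)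
      (-∫ u in Ioi (0 : ℝ), u * (exp (-s * u) * φ u)) s := by
  have key := hasDerivAt_integral_of_dominated_loc_of_deriv_le (μ := volume.restrict (Ioi (0 : ℝ)))
    (F := fun s u => exp (-s * u) * φ u) (F' := fun s u => -(u * (exp (-s * u) * φ u)))
    (x₀ := s) (s := Ioi (s / 2)) (bound := fun u => u * exp (-(s / 2) * u) * M)
    (Ioi_mem_nhds (by linarith))
    (Eventually.of_forall fun t => (Measurable.aestronglyMeasurable (by fun_prop)))
    (integrableOn_exp_neg_mul_mul hφ hM hs) (Measurable.aestronglyMeasurable (by fun_prop))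
    ?_ ((integrableOn_mul_exp_neg_mul (half_pos hs)).mul_const M) ?_
  · rw [← integral_neg]
    exact key.2
  · filter_upwards [ae_restrict_mem measurableSet_Ioi] with u hu t ht
    have hu : 0 < u := hu
    have ht : s / 2 < t := ht
    rw [norm_neg, norm_mul, norm_mul, norm_of_nonneg hu.le, norm_of_nonneg (exp_pos _).le,
      norm_eq_abs, ← mul_assoc]
    have : exp (-t * u) ≤ exp (-(s / 2) * u) := exp_le_exp.2 (by nlinarith)
    gcongr
    exact hM u hu
  · filter_upwards with u t _
    have h1 : HasDerivAt (fun t => -t * u) (-1 * u) t := (hasDerivAt_neg t).mul_const u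
    exact (h1.exp.mul_const (φ u)).congr_deriv (by ring)

/-- Laplace transforms turn the convolution identity `f ⋆ k = x f` into `-L' = L K`. -/
lemma integral_mul_exp_of_posConvolution {f k : ℝ → ℝ} (hf : Measurable f) (hk : Measurable k)
    {M N : ℝ} (hM : ∀ u, 0 < u → |f u| ≤ M) (hN : ∀ u, 0 < u → |k u| ≤ N)
    (h : ∀ x, 0 ≤ x → ∫ y in (0 : ℝ)..x, f y * k (x - y) = x * f x) {s : ℝ} (hs : 0 < s) :
    ∫ u in Ioi (0 : ℝ), u * (exp (-s * u) * f u) =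
      (∫ u in Ioi (0 : ℝ), exp (-s * u) * f u) * ∫ u in Ioi (0 : ℝ), exp (-s * u) * k u := by
  rw [← ContinuousLinearMap.mul_apply' ℝ ℝ, ← integral_posConvolution
    (integrableOn_exp_neg_mul_mul hf hM hs) (integrableOn_exp_neg_mul_mul hk hN hs)]
  refine setIntegral_congr_fun measurableSet_Ioi fun x hx => ?_
  have hx : 0 < x := hx
  simp only [ContinuousLinearMap.mul_apply']
  rw [mul_left_comm, ← h x hx.le, ← intervalIntegral.integral_const_mul]
  refine intervalIntegral.integral_congr fun y _ => ?_
  have : exp (-s * x) = exp (-s * y) * exp (-s * (x - y)) := by rw [← exp_add]; ring_nf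
  simp only [this]
  ring

lemma tendsto_laplaceTransform_zero (ρ : Measure ℝ) (hρ : ∀ᵐ x ∂ρ, 0 ≤ x) :
    Tendsto (fun n : ℕ => laplaceTransform ρ (1 / ((n : ℝ) + 1))) atTop (𝓝 (ρ univ)) := by
  rw [← lintegral_one]
  refine lintegral_tendsto_of_tendsto_of_monotone (fun n => by fun_prop) ?_ ?_
  · filter_upwards [hρ] with x hx m n hmn
    refine ENNReal.ofReal_le_ofReal (exp_le_exp.2 ?_)
    have := mul_le_mul_of_nonneg_right (Nat.one_div_le_one_div (α := ℝ) hmn) hx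
    linarith
  · filter_upwards with x
    have h1 : Tendsto (fun n : ℕ => -(1 / ((n : ℝ) + 1)) * x) atTop (𝓝 0) := by
      simpa using tendsto_one_div_add_atTop_nhds_zero_nat.neg.mul_const x
    simpa using ENNReal.tendsto_ofReal ((continuous_exp.tendsto 0).comp h1)

lemma tendsto_laplace_zero {f : ℝ → ℝ} (hf : IntegrableOn f (Ioi 0)) :
    Tendsto (fun n : ℕ => ∫ u in Ioi (0 : ℝ), exp (-(1 / ((n : ℝ) + 1)) * u) * f u) atTop
      (𝓝 (∫ u in Ioi (0 : ℝ), f u)) := by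
  refine tendsto_integral_of_dominated_convergence (fun u => ‖f u‖)
    (fun n => (Measurable.aestronglyMeasurable (by fun_prop)).mul hf.1) hf.norm (fun n => ?_) ?_
  · filter_upwards [ae_restrict_mem measurableSet_Ioi] with u hu
    have hu : 0 < u := hu
    rw [norm_mul, norm_of_nonneg (exp_pos _).le]
    refine mul_le_of_le_one_left (norm_nonneg _) (exp_le_one_iff.2 ?_)
    rw [neg_mul, neg_nonpos]
    positivity
  · filter_upwards with u
    have h1 : Tendsto (fun n : ℕ => -(1 / ((n : ℝ) + 1)) * u) atTop (𝓝 0) := by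
      simpa using tendsto_one_div_add_atTop_nhds_zero_nat.neg.mul_const u
    simpa using ((continuous_exp.tendsto 0).comp h1).mul_const (f u)

/-- If `f ⋆ k = x f` on the half-line with `exp (-4x) ≤ k ≤ 1`, then `f`, once normalised, is
the law of the sum of an exponential and an independent compound Poisson variable. -/
lemma exists_laplace_eq {f k : ℝ → ℝ} (hf : Measurable f) (hk : Measurable k)
    (hf0 : ∀ u, 0 < u → 0 < f u) (hf1 : ∀ u, 0 < u → f u ≤ 1) (hfi : IntegrableOn f (Ioi 0))
    (hk1 : ∀ u, k u ≤ 1) (hk0 : ∀ u, 0 ≤ u → exp (-4 * u) ≤ k u)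
    (h : ∀ x, 0 ≤ x → ∫ y in (0 : ℝ)..x, f y * k (x - y) = x * f x) :
    ∃ ρ : Measure ℝ, IsFiniteMeasure ρ ∧ (∀ᵐ x ∂ρ, 0 ≤ x) ∧ ∀ s, 0 ≤ s →
      ∫ u in Ioi (0 : ℝ), exp (-s * u) * f u = (∫ u in Ioi (0 : ℝ), f u) *
        (4 / (4 + s) * exp ((laplaceTransform ρ s).toReal - ρ.real univ)) := by
  have hfM (u : ℝ) (hu : 0 < u) : |f u| ≤ 1 := by
    rw [abs_of_pos (hf0 u hu)]; exact hf1 u hu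
  have hkM (u : ℝ) (hu : 0 < u) : |k u| ≤ 1 := by
    rw [abs_of_nonneg ((exp_pos _).le.trans (hk0 u hu.le))]; exact hk1 u
  set φ : ℝ → ℝ := fun u => (k u - exp (-4 * u)) / u with hφ
  have hφm : Measurable φ := by fun_prop
  have hφ0 (u : ℝ) (hu : 0 < u) : 0 ≤ φ u := div_nonneg (sub_nonneg.2 (hk0 u hu.le)) hu.le
  have hφM (u : ℝ) (hu : 0 < u) : |φ u| ≤ 4 := by
    rw [abs_of_nonneg (hφ0 u hu), hφ, div_le_iff₀ hu]
    linarith [add_one_le_exp (-4 * u), hk1 u]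
  set ρ : Measure ℝ := (volume.restrict (Ioi 0)).withDensity fun u => ENNReal.ofReal (φ u) with hρ
  have hρ0 : ∀ᵐ x ∂ρ, 0 ≤ x := by
    refine withDensity_absolutelyContinuous _ _ ?_
    filter_upwards [ae_restrict_mem measurableSet_Ioi] with u hu using le_of_lt hu
  set F : ℝ → ℝ := fun s => ∫ u in Ioi (0 : ℝ), exp (-s * u) * f u with hF
  set K : ℝ → ℝ := fun s => ∫ u in Ioi (0 : ℝ), exp (-s * u) * k u with hK
  set E : ℝ → ℝ := fun s => ∫ u in Ioi (0 : ℝ), exp (-s * u) * φ u with hE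
  have hE0 (s : ℝ) : 0 ≤ E s := by
    refine setIntegral_nonneg measurableSet_Ioi fun u hu => ?_
    exact mul_nonneg (exp_pos _).le (hφ0 u hu)
  have hρE {s : ℝ} (hs : 0 < s) : laplaceTransform ρ s = ENNReal.ofReal (E s) := by
    rw [hE, ofReal_integral_eq_lintegral_ofReal (integrableOn_exp_neg_mul_mul hφm hφM hs),
      laplaceTransform, hρ, lintegral_withDensity_eq_lintegral_mul _ (by fun_prop) (by fun_prop)]
    · refine lintegral_congr fun u => ?_
      rw [Pi.mul_apply, mul_comm, ENNReal.ofReal_mul (exp_pos _).le]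
    · filter_upwards [ae_restrict_mem measurableSet_Ioi] with u hu
      exact mul_nonneg (exp_pos _).le (hφ0 u hu)
  have hFd {s : ℝ} (hs : 0 < s) : HasDerivAt F (-(F s * K s)) s :=
    (hasDerivAt_laplace hf hfM hs).congr_deriv
      (by rw [integral_mul_exp_of_posConvolution hf hk hfM hkM h hs])
  have hEd {s : ℝ} (hs : 0 < s) : HasDerivAt E (-(K s - 1 / (4 + s))) s := by
    refine (hasDerivAt_laplace hφm hφM hs).congr_deriv ?_
    have h1 : ∫ u in Ioi (0 : ℝ), exp (-(4 + s) * u) = 1 / (4 + s) := by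
      rw [integral_exp_mul_Ioi (by linarith)]
      rw [mul_zero, exp_zero, neg_div_neg_eq]
    rw [← h1, hK, ← integral_sub (integrableOn_exp_neg_mul_mul hk hkM hs)
      (exp_neg_integrableOn_Ioi 0 (by linarith))]
    congr 1
    refine setIntegral_congr_fun measurableSet_Ioi fun u hu => ?_
    have hu : u ≠ 0 := ne_of_gt hu
    have : exp (-(4 + s) * u) = exp (-s * u) * exp (-4 * u) := by rw [← exp_add]; ring_nf
    simp only [hφ, this]
    field_simp
  have hFpos {s : ℝ} (hs : 0 < s) : 0 < F s := by
    refine (setIntegral_pos_iff_support_of_nonneg_ae ?_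
      (integrableOn_exp_neg_mul_mul hf hfM hs)).2 ?_
    · filter_upwards [ae_restrict_mem measurableSet_Ioi] with u hu
      exact mul_nonneg (exp_pos _).le (hf0 u hu).le
    · rw [inter_eq_right.2, volume_Ioi]
      · exact ENNReal.zero_lt_top
      · exact fun u hu => (mul_pos (exp_pos (-s * u)) (hf0 u hu)).ne'
  obtain ⟨C, hC, hFC⟩ : ∃ C, 0 < C ∧ ∀ s, 0 < s → F s * (4 + s) = C * exp (E s) := by
    set G : ℝ → ℝ := fun s => F s * (4 + s) * exp (-E s) with hG
    have hGd {s : ℝ} (hs : 0 < s) : HasDerivAt G 0 s := by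
      refine (((hFd hs).fun_mul ((hasDerivAt_id' s).const_add 4)).fun_mul
        (hEd hs).fun_neg.exp).congr_deriv ?_
      have : 4 + s ≠ 0 := by positivity
      field_simp
      ring
    refine ⟨G 1, mul_pos (mul_pos (hFpos one_pos) (by norm_num)) (exp_pos _), fun s hs => ?_⟩
    rw [isOpen_Ioi.is_const_of_deriv_eq_zero isPreconnected_Ioi
      (fun s hs => (hGd hs).differentiableAt.differentiableWithinAt) (fun s hs => (hGd hs).deriv)
      (mem_Ioi.2 one_pos) (mem_Ioi.2 hs), hG]
    simp only
    rw [mul_assoc, ← exp_add, neg_add_cancel, exp_zero, mul_one]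
  set m := ∫ u in Ioi (0 : ℝ), f u with hm
  have hFm {s : ℝ} (hs : 0 < s) : F s ≤ m := by
    refine setIntegral_mono_on (integrableOn_exp_neg_mul_mul hf hfM hs) hfi measurableSet_Ioi
      fun u hu => mul_le_of_le_one_left (hf0 u hu).le (exp_le_one_iff.2 ?_)
    have hu : 0 < u := hu
    rw [neg_mul, neg_nonpos]
    positivity
  have hn (n : ℕ) : 0 < 1 / ((n : ℝ) + 1) := Nat.one_div_pos_of_nat
  have hEb (n : ℕ) : E (1 / ((n : ℝ) + 1)) ≤ 5 * m / C := by
    have h1 : 1 / ((n : ℝ) + 1) ≤ 1 := by simpa using Nat.one_div_le_one_div (α := ℝ) n.zero_le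
    have h2 := hFC _ (hn n)
    have h3 := add_one_le_exp (E (1 / ((n : ℝ) + 1)))
    rw [le_div_iff₀ hC]
    nlinarith [hFm (hn n), hFpos (hn n)]
  have hlim := tendsto_laplaceTransform_zero ρ hρ0
  have hfin : ρ univ ≤ ENNReal.ofReal (5 * m / C) := by
    refine le_of_tendsto' hlim fun n => ?_
    rw [hρE (hn n)]
    exact ENNReal.ofReal_le_ofReal (hEb n)
  have hρf : IsFiniteMeasure ρ := ⟨hfin.trans_lt ENNReal.ofReal_lt_top⟩
  have hEr {s : ℝ} (hs : 0 < s) : (laplaceTransform ρ s).toReal = E s := by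
    rw [hρE hs, ENNReal.toReal_ofReal (hE0 s)]
  have hmC : m * 4 = C * exp (ρ.real univ) := by
    have h1 := (ENNReal.tendsto_toReal (measure_ne_top ρ univ)).comp hlim
    have h2 := ((continuous_exp.tendsto _).comp h1).const_mul C
    have h3 := (tendsto_laplace_zero hfi).mul
      ((tendsto_one_div_add_atTop_nhds_zero_nat (𝕜 := ℝ)).const_add 4)
    rw [add_zero] at h3
    refine tendsto_nhds_unique h3 (h2.congr fun n => ?_)
    simp only [Function.comp_apply]
    rw [hEr (hn n), ← hFC _ (hn n)]
  refine ⟨ρ, hρf, hρ0, fun s hs => ?_⟩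
  rcases hs.eq_or_lt with rfl | hs
  · simp [laplaceTransform, measureReal_def, hm]
  · rw [hEr hs, exp_sub]
    have := hFC s hs
    have h4 : 4 + s ≠ 0 := by positivity
    change F s = _
    field_simp
    linear_combination exp (ρ.real univ) * this - exp (E s) * hmC

lemma integrable_tDensity {a : ℝ} (ha : 1 / 2 < a) : Integrable (tDensity a) := by
  have := integrable_rpow_neg_one_add_norm_sq (μ := (volume : Measure ℝ)) (r := 2 * a)
    (by rw [Module.finrank_self, Nat.cast_one]; linarith)
  refine this.congr (Eventually.of_forall fun x => ?_)
  simp only [tDensity, norm_eq_abs, sq_abs]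
  ring_nf

lemma lintegral_rpow_mul_exp_neg_mul_Ioi {a r : ℝ} (ha : 0 < a) (hr : 0 < r) :
    ∫⁻ s in Ioi (0 : ℝ), ENNReal.ofReal (s ^ (a - 1) * exp (-(r * s))) =
      ENNReal.ofReal ((1 / r) ^ a * Gamma a) := by
  rw [← integral_rpow_mul_exp_neg_mul_Ioi ha hr, ofReal_integral_eq_lintegral_ofReal]
  · simpa [IntegrableOn] using integrableOn_rpow_mul_exp_neg_mul_rpow (p := 1) (s := a - 1) (by linarith)
      one_pos hr
  · filter_upwards [ae_restrict_mem measurableSet_Ioi] with s hs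
    have hs : 0 < s := hs
    exact mul_nonneg (rpow_nonneg hs.le _) (exp_pos _).le

lemma integral_tDensity {a : ℝ} (ha : 1 / 2 < a) :
    ∫ t, tDensity a t = √π * Gamma (a - 1 / 2) / Gamma a := by
  have hG : 0 < Gamma a := Gamma_pos_of_pos (by linarith)
  have hG' : 0 < Gamma (a - 1 / 2) := Gamma_pos_of_pos (by linarith)
  have h0 : 0 ≤ √π * Gamma (a - 1 / 2) := by positivity
  have h1 : ENNReal.ofReal (∫ t, tDensity a t * Gamma a) =
      ENNReal.ofReal (√π * Gamma (a - 1 / 2)) := by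
    rw [ofReal_integral_eq_lintegral_ofReal ((integrable_tDensity ha).mul_const _)
      (Eventually.of_forall fun t => mul_nonneg (tDensity_pos a t).le hG.le)]
    calc ∫⁻ t, ENNReal.ofReal (tDensity a t * Gamma a)
        = ∫⁻ t : ℝ, ∫⁻ s in Ioi (0 : ℝ),
            ENNReal.ofReal (s ^ (a - 1) * exp (-((1 + t ^ 2) * s))) := by
          refine lintegral_congr fun t => ?_
          have ht : 0 < 1 + t ^ 2 := by positivity
          rw [lintegral_rpow_mul_exp_neg_mul_Ioi (by linarith) ht, tDensity, one_div,
            inv_rpow ht.le, rpow_neg ht.le]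
      _ = ∫⁻ s in Ioi (0 : ℝ), ∫⁻ t : ℝ,
            ENNReal.ofReal (s ^ (a - 1) * exp (-((1 + t ^ 2) * s))) :=
          lintegral_lintegral_swap (Measurable.aemeasurable (by unfold Function.uncurry; fun_prop))
      _ = ∫⁻ s in Ioi (0 : ℝ), ENNReal.ofReal √π *
            ENNReal.ofReal (s ^ (a - 1 / 2 - 1) * exp (-(1 * s))) := by
          refine setLIntegral_congr_fun measurableSet_Ioi fun s hs => ?_
          have hs : 0 < s := hs
          have hsplit (t : ℝ) : s ^ (a - 1) * exp (-((1 + t ^ 2) * s)) =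
              s ^ (a - 1) * exp (-s) * exp (-s * t ^ 2) := by
            rw [mul_assoc, ← exp_add]; ring_nf
          simp only [hsplit]
          rw [← ofReal_integral_eq_lintegral_ofReal ((integrable_exp_neg_mul_sq hs).const_mul _)
            (Eventually.of_forall fun t => by positivity), integral_const_mul, integral_gaussian,
            ← ENNReal.ofReal_mul (by positivity), sqrt_div pi_pos.le, sub_right_comm,
            rpow_sub hs _ (1 / 2), ← sqrt_eq_rpow, one_mul]
          congr 1
          ring
      _ = ENNReal.ofReal (√π * Gamma (a - 1 / 2)) := by
          rw [lintegral_const_mul _ (by fun_prop),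
            lintegral_rpow_mul_exp_neg_mul_Ioi (by linarith) one_pos,
            ← ENNReal.ofReal_mul (by positivity), div_one, one_rpow, one_mul]
  rw [ENNReal.ofReal_eq_ofReal_iff (integral_nonneg fun t => mul_nonneg (tDensity_pos a t).le hG.le)
    h0, integral_mul_const] at h1
  rw [eq_div_iff hG.ne', h1]

lemma tDensity_abs (a x : ℝ) : tDensity a |x| = tDensity a x := by simp [tDensity]

lemma integral_Ioi_tDensity {a : ℝ} (ha : 1 / 2 < a) :
    ∫ u in Ioi (0 : ℝ), tDensity a u = √π * Gamma (a - 1 / 2) / Gamma a / 2 := by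
  have h := integral_comp_abs (f := tDensity a)
  simp only [tDensity_abs] at h
  rw [← integral_tDensity ha, h, mul_div_cancel_left₀ _ two_ne_zero]

lemma studentT_density_eq {ν : ℝ} (hν : 0 < ν) (t : ℝ) :
    Gamma ((ν + 1) / 2) / (√(π * ν) * Gamma (ν / 2)) * (1 + t ^ 2 / ν) ^ (-((ν + 1) / 2)) =
      (2 * √ν * ∫ u in Ioi (0 : ℝ), tDensity ((ν + 1) / 2) u)⁻¹ *
        tDensity ((ν + 1) / 2) ((√ν)⁻¹ * t) := by
  rw [integral_Ioi_tDensity (by linarith), tDensity, mul_pow, inv_pow,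
    sq_sqrt hν.le, sqrt_mul pi_pos.le, show (ν + 1) / 2 - 1 / 2 = ν / 2 by ring,
    inv_mul_eq_div ν]
  congr 1
  field_simp

lemma laplaceTransform_half_studentT {ν : ℝ} (hν : 0 < ν) {s : ℝ} (hs : 0 ≤ s) :
    laplaceTransform ((studentT ν).map fun t => |t|) s =
      ENNReal.ofReal ((∫ u in Ioi (0 : ℝ), exp (-(√ν * s) * u) * tDensity ((ν + 1) / 2) u) /
        ∫ u in Ioi (0 : ℝ), tDensity ((ν + 1) / 2) u) := by
  set a := (ν + 1) / 2 with ha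
  set m := ∫ u in Ioi (0 : ℝ), tDensity a u with hm
  have hν' : 0 < √ν := sqrt_pos.2 hν
  have hm0 : 0 ≤ m := setIntegral_nonneg measurableSet_Ioi fun u _ => (tDensity_pos a u).le
  have hc := continuous_tDensity a
  set H : ℝ → ℝ := fun u => exp (-(√ν * s) * u) * tDensity a u with hH
  rw [laplaceTransform, lintegral_map (by fun_prop) (by fun_prop), studentT]
  simp_rw [studentT_density_eq hν, ← ha, ← hm]
  rw [lintegral_withDensity_eq_lintegral_mul _ (by fun_prop) (by fun_prop)]
  have habs (t : ℝ) : tDensity a ((√ν)⁻¹ * |t|) = tDensity a ((√ν)⁻¹ * t) := by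
    rw [← tDensity_abs a ((√ν)⁻¹ * t), abs_mul, abs_of_pos (inv_pos.2 hν')]
  have hpt (t : ℝ) : ((fun t => ENNReal.ofReal ((2 * √ν * m)⁻¹ * tDensity a ((√ν)⁻¹ * t))) *
      fun t => ENNReal.ofReal (exp (-s * |t|))) t =
      ENNReal.ofReal ((2 * √ν * m)⁻¹ * H ((√ν)⁻¹ * |t|)) := by
    rw [Pi.mul_apply, ← ENNReal.ofReal_mul (mul_nonneg (by positivity) (tDensity_pos a _).le), hH]
    simp only [habs]
    rw [show -(√ν * s) * ((√ν)⁻¹ * |t|) = -s * |t| by field_simp]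
    ring_nf
  simp only [hpt]
  have hHi : Integrable fun t => H ((√ν)⁻¹ * |t|) := by
    have h1 := ((integrable_tDensity (a := a) (by linarith)).comp_mul_left'
      (inv_pos.2 hν').ne')
    refine h1.mono (Measurable.aestronglyMeasurable (by fun_prop))
      (Eventually.of_forall fun t => ?_)
    simp only [hH, habs]
    rw [norm_mul, norm_of_nonneg (exp_pos _).le]
    refine mul_le_of_le_one_left (norm_nonneg _) (exp_le_one_iff.2 ?_)
    rw [neg_mul, neg_nonpos]
    positivity
  rw [← ofReal_integral_eq_lintegral_ofReal (hHi.const_mul _) (Eventually.of_forall fun t =>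
      mul_nonneg (by positivity) (mul_nonneg (exp_pos _).le (tDensity_pos a _).le)),
    integral_const_mul, integral_comp_abs (f := fun t => H ((√ν)⁻¹ * t)),
    integral_comp_mul_left_Ioi H 0 (inv_pos.2 hν'), mul_zero, inv_inv, smul_eq_mul]
  congr 1
  field_simp

/-- For `0 < ν ≤ 1`, the half Student-t distribution is infinitely divisible. -/
theorem half_studentT_infinitelyDivisible (ν : ℝ) (hν0 : 0 < ν) (hν1 : ν ≤ 1) :
    IsInfinitelyDivisible (Measure.map (fun t : ℝ => |t|) (studentT ν)) := by
  have hν' : 0 < √ν := sqrt_pos.2 hν0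
  obtain ⟨k, hkc, hk1, hk0, hk⟩ := exists_levy_kernel (a := (ν + 1) / 2) (by linarith) (by linarith)
  have hfi := (integrable_tDensity (a := (ν + 1) / 2) (by linarith))
  obtain ⟨ρ, hρf, hρ0, hρ⟩ := exists_laplace_eq (continuous_tDensity _).measurable hkc.measurable
    (fun u _ => tDensity_pos _ u) (fun u _ => tDensity_le_one (by linarith) u) hfi.integrableOn
    hk1 hk0 hk
  have hm : ∫ u in Ioi (0 : ℝ), tDensity ((ν + 1) / 2) u ≠ 0 := by
    have h1 := Gamma_pos_of_pos (s := (ν + 1) / 2) (by linarith)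
    have h2 := Gamma_pos_of_pos (s := (ν + 1) / 2 - 1 / 2) (by linarith)
    rw [integral_Ioi_tDensity (by linarith)]
    positivity
  refine isInfinitelyDivisible_of_laplaceTransform (ρ := ρ.map (√ν * ·)) (r := 4 / √ν) ?_ ?_
    (by positivity) fun s hs => ?_
  · rw [ae_map_iff (by fun_prop) measurableSet_Ici]
    exact Eventually.of_forall fun t => abs_nonneg t
  · rw [ae_map_iff (by fun_prop) measurableSet_Ici]
    filter_upwards [hρ0] with x hx using mul_nonneg hν'.le hx
  · rw [laplaceTransform_half_studentT hν0 hs, hρ _ (by positivity), laplaceTransform_map_mul,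
      mul_div_cancel_left₀ _ hm, measureReal_def, measureReal_def,
      Measure.map_apply (by fun_prop) .univ, preimage_univ, mul_comm s]
    congr 2
    field_simp
end

section
/- Let ρ, μ, γ > 0. If ρ > 2, or μ < γ·ρ, or (ρ = 2 and μ < 3γ), then the three-parametric Mittag-Leffler function E^γ_{ρ,μ} takes a negative value on the negative half line; that is, there exists t > 0 with E^γ_{ρ,μ}(−t) < 0. -/
/-- The three-parametric Mittag-Leffler function
`E^γ_{ρ,μ}(z) = Σ_{n≥0} Γ(γ+n)/(Γ(γ)Γ(1+n)Γ(μ+ρn)) · z^n`. -/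
noncomputable def mittagLeffler3 (ρ μ γ : ℝ) (z : ℝ) : ℝ :=
  ∑' n : ℕ,
    Real.Gamma (γ + n) / (Real.Gamma γ * Real.Gamma (1 + n) * Real.Gamma (μ + ρ * n)) * z ^ n

open MeasureTheory ProbabilityTheory Filter Topology Set

theorem mem_integrableExpSet_of_differentiableOn_ball {Ω : Type*} [MeasurableSpace Ω]
    {ν : Measure Ω} {X : Ω → ℝ} (hX : ∀ᵐ ω ∂ν, X ω ≤ 0) {a r s : ℝ} {f : ℂ → ℂ}
    (ha : a ∈ interior (integrableExpSet X ν)) (hf : DifferentiableOn ℂ f (Metric.ball (a : ℂ) r))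
    (hfa : f =ᶠ[𝓝 (a : ℂ)] complexMGF X ν) (hs : a - r < s) (hsa : s < a) :
    s ∈ integrableExpSet X ν := by
  have hXm : AEMeasurable X ν := aemeasurable_of_mem_interior_integrableExpSet ha
  have hder (n : ℕ) : iteratedDeriv n f (a : ℂ) =
      ((∫ ω, X ω ^ n * Real.exp (a * X ω) ∂ν : ℝ) : ℂ) := by
    rw [(hfa.iteratedDeriv_eq n), iteratedDeriv_complexMGF (by simpa using ha),
      ← integral_complex_ofReal]
    congr 1 with ω
    push_cast
    rfl
  have hmem : (s : ℂ) ∈ Metric.ball (a : ℂ) r := by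
    rw [Metric.mem_ball, dist_eq_norm, ← Complex.ofReal_sub, Complex.norm_real, Real.norm_eq_abs,
      abs_lt]
    constructor <;> linarith
  have hsum := (Complex.hasSum_taylorSeries_on_ball hf hmem).summable
  let F : ℕ → Ω → ℝ := fun n ω ↦ ((s - a) * X ω) ^ n / n.factorial * Real.exp (a * X ω)
  have hFint (n : ℕ) : Integrable (F n) ν := by
    have := (integrable_pow_mul_exp_of_mem_interior_integrableExpSet ha n).const_mul
      ((s - a) ^ n / n.factorial)
    refine this.congr (ae_of_all _ fun ω ↦ ?_)
    simp only [F, mul_pow]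
    ring
  have hFnn (n : ℕ) : 0 ≤ᵐ[ν] F n := by
    filter_upwards [hX] with ω hω
    have : 0 ≤ (s - a) * X ω := mul_nonneg_of_nonpos_of_nonpos (by linarith) hω
    simp only [F, Pi.zero_apply]
    positivity
  have hFsum : Summable fun n ↦ ∫ ω, F n ω ∂ν := by
    rw [← Complex.summable_ofReal]
    refine hsum.congr fun n ↦ ?_
    have : ∫ ω, F n ω ∂ν =
        (s - a) ^ n / n.factorial * ∫ ω, X ω ^ n * Real.exp (a * X ω) ∂ν := by
      rw [← integral_const_mul]
      congr 1 with ω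
      simp only [F, mul_pow]
      ring
    rw [this, hder]
    push_cast
    simp only [smul_eq_mul]
    ring
  have hpt (ω : Ω) : HasSum (fun n ↦ F n ω) (Real.exp (s * X ω)) := by
    have := (NormedSpace.expSeries_div_hasSum_exp ((s - a) * X ω)).mul_right (Real.exp (a * X ω))
    rw [← Real.exp_eq_exp_ℝ, ← Real.exp_add] at this
    rwa [show (s - a) * X ω + a * X ω = s * X ω by ring] at this
  refine ⟨by fun_prop, ?_⟩
  rw [hasFiniteIntegral_iff_ofReal (ae_of_all _ fun ω ↦ (Real.exp_pos _).le)]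
  have key : ∫⁻ ω, ENNReal.ofReal (Real.exp (s * X ω)) ∂ν
      = ∑' n, ∫⁻ ω, ENNReal.ofReal (F n ω) ∂ν := by
    rw [← lintegral_tsum fun n ↦ (hFint n).aemeasurable.ennreal_ofReal]
    refine lintegral_congr_ae ?_
    filter_upwards [ae_all_iff.2 hFnn] with ω hω
    rw [← (hpt ω).tsum_eq, ENNReal.ofReal_tsum_of_nonneg hω (hpt ω).summable]
  rw [key]
  simp_rw [← ofReal_integral_eq_lintegral_ofReal (hFint _) (hFnn _)]
  rw [← ENNReal.ofReal_tsum_of_nonneg (fun n ↦ integral_nonneg_of_ae (hFnn n)) hFsum]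
  exact ENNReal.ofReal_lt_top

theorem complexMGF_eqOn_of_convex {Ω : Type*} [MeasurableSpace Ω]
    {ν : Measure Ω} {X : Ω → ℝ} {U : Set ℂ} (hU : IsOpen U) (hUc : Convex ℝ U)
    (hpos : ∀ s : ℝ, 0 < s → (s : ℂ) ∈ U) {f : ℂ → ℂ} (hf : DifferentiableOn ℂ f U)
    {b c : ℝ} (hc : 0 ≤ c) (hint : Ioi c ⊆ integrableExpSet X ν)
    (heq : ∀ s : ℝ, b < s → f s = complexMGF X ν s) :
    EqOn f (complexMGF X ν) (U ∩ {z | c < z.re}) := by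
  have hVo : IsOpen (U ∩ {z : ℂ | c < z.re}) :=
    hU.inter (isOpen_lt continuous_const Complex.continuous_re)
  have hsub : Ioi c ⊆ interior (integrableExpSet X ν) := interior_maximal hint isOpen_Ioi
  have hx : c < max b c + 1 := by linarith [le_max_right b c]
  refine AnalyticOnNhd.eqOn_of_preconnected_of_frequently_eq (z₀ := ((max b c + 1 : ℝ) : ℂ))
    ((hf.mono inter_subset_left).analyticOnNhd hVo)
    (analyticOnNhd_complexMGF.mono fun z hz ↦ hsub hz.2)
    (hUc.inter (convex_halfSpace_re_gt c)).isPreconnected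
    ⟨hpos _ (by linarith), by simpa using hx⟩ ?_
  have ht : Tendsto (fun x : ℝ ↦ (x : ℂ)) (𝓝[>] (max b c + 1)) (𝓝[≠] ((max b c + 1 : ℝ) : ℂ)) := by
    refine tendsto_nhdsWithin_iff.2
      ⟨(Complex.continuous_ofReal.tendsto _).mono_left nhdsWithin_le_nhds, ?_⟩
    filter_upwards [self_mem_nhdsWithin] with x hx
    simpa only [mem_compl_iff, mem_singleton_iff, Complex.ofReal_inj] using (ne_of_gt hx)
  refine ht.frequently (Eventually.frequently ?_)
  filter_upwards [self_mem_nhdsWithin] with x hx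
  exact heq x (by have := mem_Ioi.1 hx; linarith [le_max_left b c])

theorem Ioi_subset_integrableExpSet_of_convex {Ω : Type*} [MeasurableSpace Ω]
    {ν : Measure Ω} {X : Ω → ℝ} (hXm : AEMeasurable X ν) (hX : ∀ᵐ ω ∂ν, X ω ≤ 0) {U : Set ℂ}
    (hU : IsOpen U) (hUc : Convex ℝ U)
    (hpos : ∀ s : ℝ, 0 < s → (s : ℂ) ∈ U) {f : ℂ → ℂ} (hf : DifferentiableOn ℂ f U)
    {b : ℝ} (hint : Ioi b ⊆ integrableExpSet X ν)
    (heq : ∀ s : ℝ, b < s → f s = complexMGF X ν s) :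
    Ioi 0 ⊆ integrableExpSet X ν := by
  have hup {s t : ℝ} (hs : s ∈ integrableExpSet X ν) (hst : s ≤ t) : t ∈ integrableExpSet X ν := by
    refine Integrable.mono hs (by fun_prop) ?_
    filter_upwards [hX] with ω hω
    simp only [Real.norm_eq_abs, Real.abs_exp, Real.exp_le_exp]
    nlinarith
  set S := integrableExpSet X ν ∩ Ioi 0 with hS
  have hbdd : BddBelow S := ⟨0, fun x hx ↦ (mem_Ioi.1 hx.2).le⟩
  have hne : S.Nonempty := ⟨max b 0 + 1, hint (by simp [lt_add_of_le_of_pos]), by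
    simp only [mem_Ioi]; positivity⟩
  set σ := sInf S with hσ
  have hσ0 : 0 ≤ σ := le_csInf hne fun x hx ↦ (mem_Ioi.1 hx.2).le
  have hIoi : Ioi σ ⊆ integrableExpSet X ν := fun x hx ↦ by
    obtain ⟨y, hy, hyx⟩ := exists_lt_of_csInf_lt hne (mem_Ioi.1 hx)
    exact hup hy.1 hyx.le
  rcases hσ0.eq_or_lt with h0 | h0
  · rwa [← h0] at hIoi
  exfalso
  obtain ⟨ε, hε, hball⟩ := Metric.isOpen_iff.1 hU _ (hpos σ h0)
  set δ := min ε σ with hδ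
  have hδ0 : 0 < δ := lt_min hε h0
  have hδε : δ ≤ ε := min_le_left _ _
  have hδσ : δ ≤ σ := min_le_right _ _
  have ha : σ < σ + δ / 4 := by linarith
  have hV : U ∩ {z : ℂ | σ < z.re} ∈ 𝓝 ((σ + δ / 4 : ℝ) : ℂ) :=
    (hU.inter (isOpen_lt continuous_const Complex.continuous_re)).mem_nhds
      ⟨hpos _ (by linarith), by simpa using ha⟩
  have hmem : σ - δ / 8 ∈ integrableExpSet X ν := by
    refine mem_integrableExpSet_of_differentiableOn_ball hX (a := σ + δ / 4) (r := δ / 2)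
      (interior_maximal hIoi isOpen_Ioi ha) (hf.mono (Subset.trans ?_ hball))
      (Filter.eventuallyEq_of_mem hV
        (complexMGF_eqOn_of_convex hU hUc hpos hf hσ0 hIoi heq)) (by linarith) (by linarith)
    refine Metric.ball_subset_ball' ?_
    rw [dist_eq_norm, ← Complex.ofReal_sub, Complex.norm_real, Real.norm_eq_abs,
      abs_of_pos (by linarith)]
    linarith
  have := csInf_le hbdd (show σ - δ / 8 ∈ S from ⟨hmem, by simp only [mem_Ioi]; linarith⟩)
  linarith

theorem Real.Gamma_add_natCast_div {γ : ℝ} (hγ : 0 < γ) (n : ℕ) :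
    Real.Gamma (γ + n) / (Real.Gamma γ * Real.Gamma (1 + n)) = Ring.choose (γ + n - 1) n := by
  have h1 : Real.Gamma (γ + n) = (ascPochhammer ℝ n).eval γ * Real.Gamma γ := by
    induction n with
    | zero => simp
    | succ n ih =>
      rw [Nat.cast_succ, ← add_assoc, Real.Gamma_add_one (by positivity), ih,
        ascPochhammer_succ_eval]
      ring
  have h2 : (n.factorial : ℝ) * Ring.choose (γ + n - 1) n = (ascPochhammer ℝ n).eval γ := by
    rw [← Ring.multichoose_eq, ← nsmul_eq_mul, Ring.factorial_nsmul_multichoose_eq_ascPochhammer,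
      Polynomial.ascPochhammer_smeval_eq_eval]
  have h3 : (n.factorial : ℝ) ≠ 0 := by positivity
  have h4 := (Real.Gamma_pos_of_pos hγ).ne'
  rw [h1, ← h2, add_comm 1, Real.Gamma_nat_eq_factorial]
  field_simp

theorem Real.hasSum_Gamma_add_natCast_div_mul_pow {γ : ℝ} (hγ : 0 < γ) {x : ℝ} (hx : |x| < 1) :
    HasSum (fun n : ℕ ↦ Real.Gamma (γ + n) / (Real.Gamma γ * Real.Gamma (1 + n)) * x ^ n)
      ((1 - x) ^ (-γ)) := by
  have := (Real.one_div_one_sub_rpow_hasFPowerSeriesOnBall_zero γ).hasSum (y := x)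
    (by simpa [enorm_eq_nnnorm, ← NNReal.coe_lt_coe] using hx)
  simp only [FormalMultilinearSeries.ofScalars_apply_eq, zero_add, smul_eq_mul] at this
  rw [Real.rpow_neg (by linarith [(abs_lt.1 hx).2]), ← one_div]
  simpa only [Real.Gamma_add_natCast_div hγ] using this

theorem integrableOn_rpow_mul_exp_neg_mul {a s : ℝ} (ha : 0 < a) (hs : 0 < s) :
    IntegrableOn (fun t : ℝ ↦ t ^ (a - 1) * Real.exp (-(s * t))) (Ioi 0) := by
  refine not_imp_comm.1 integral_undef ?_
  rw [Real.integral_rpow_mul_exp_neg_mul_Ioi ha hs]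
  have := Real.Gamma_pos_of_pos ha
  positivity

theorem integral_rpow_mul_mittagLeffler3 {ρ μ γ s : ℝ} (hρ : 0 < ρ) (hμ : 0 < μ) (hγ : 0 < γ)
    (hs : 1 < s) :
    ∫ t in Ioi 0, t ^ (μ - 1) * mittagLeffler3 ρ μ γ (-t ^ ρ) * Real.exp (-(s * t)) =
      s ^ (-μ) * (1 + s ^ (-ρ)) ^ (-γ) := by
  have hs0 : 0 < s := by linarith
  set c : ℕ → ℝ := fun n ↦
    Real.Gamma (γ + n) / (Real.Gamma γ * Real.Gamma (1 + n) * Real.Gamma (μ + ρ * n)) with hc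
  have ha (n : ℕ) : 0 < μ + ρ * n := by positivity
  have hc0 (n : ℕ) : 0 ≤ c n := by
    have h1 := Real.Gamma_pos_of_pos hγ
    have h2 := Real.Gamma_pos_of_pos (show 0 < γ + n by positivity)
    have h3 := Real.Gamma_pos_of_pos (show (0 : ℝ) < 1 + n by positivity)
    have h4 := Real.Gamma_pos_of_pos (ha n)
    positivity
  let F : ℕ → ℝ → ℝ := fun n t ↦
    (-1) ^ n * c n * (t ^ (μ + ρ * n - 1) * Real.exp (-(s * t)))
  have hx0 : 0 < s ^ (-ρ) := Real.rpow_pos_of_pos hs0 _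
  have hx1 : s ^ (-ρ) < 1 := Real.rpow_lt_one_of_one_lt_of_neg hs (by linarith)
  have hF (n : ℕ) : c n * ∫ t in Ioi 0, t ^ (μ + ρ * n - 1) * Real.exp (-(s * t)) =
      s ^ (-μ) * (Real.Gamma (γ + n) / (Real.Gamma γ * Real.Gamma (1 + n)) * (s ^ (-ρ)) ^ n) := by
    have h4 := (Real.Gamma_pos_of_pos (ha n)).ne'
    rw [Real.integral_rpow_mul_exp_neg_mul_Ioi (ha n) hs0, one_div, Real.inv_rpow hs0.le,
      ← Real.rpow_neg hs0.le, ← Real.rpow_mul_natCast hs0.le,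
      show -(μ + ρ * n) = -μ + -ρ * n by ring, Real.rpow_add hs0]
    simp only [hc]
    field_simp
  have hFint (n : ℕ) : Integrable (F n) (volume.restrict (Ioi 0)) :=
    (integrableOn_rpow_mul_exp_neg_mul (ha n) hs0).const_mul _
  have hFnorm (n : ℕ) : ∫ t in Ioi 0, ‖F n t‖ =
      s ^ (-μ) * (Real.Gamma (γ + n) / (Real.Gamma γ * Real.Gamma (1 + n)) * (s ^ (-ρ)) ^ n) := by
    rw [← hF, ← integral_const_mul]
    refine setIntegral_congr_fun measurableSet_Ioi fun t ht ↦ ?_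
    have ht' : 0 ≤ t ^ (μ + ρ * n - 1) := Real.rpow_nonneg (mem_Ioi.1 ht).le _
    simp only [F, norm_mul, norm_pow, norm_neg, norm_one, one_pow, one_mul, Real.norm_eq_abs,
      Real.abs_exp, abs_of_nonneg ht', abs_of_nonneg (hc0 n)]
  have hsum : Summable fun n ↦ ∫ t in Ioi 0, ‖F n t‖ := by
    simp_rw [hFnorm]
    exact (Real.hasSum_Gamma_add_natCast_div_mul_pow hγ
      (by rwa [abs_of_pos hx0])).summable.mul_left _
  have key := hasSum_integral_of_summable_integral_norm hFint hsum
  have key2 := (Real.hasSum_Gamma_add_natCast_div_mul_pow hγ (x := -s ^ (-ρ))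
    (by rwa [abs_neg, abs_of_pos hx0])).mul_left (s ^ (-μ))
  rw [sub_neg_eq_add] at key2
  refine Eq.trans ?_ (key.unique (key2.congr_fun ?_))
  · refine setIntegral_congr_fun measurableSet_Ioi fun t ht ↦ ?_
    have ht0 : 0 < t := ht
    simp only [mittagLeffler3]
    rw [← tsum_mul_left, ← tsum_mul_right]
    congr 1 with n
    simp only [F, hc]
    rw [neg_pow, ← Real.rpow_mul_natCast ht0.le,
      show μ + ρ * n - 1 = (μ - 1) + ρ * n by ring, Real.rpow_add ht0]
    ring
  · intro n
    simp only [F, integral_const_mul]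
    rw [mul_assoc, hF, neg_pow (s ^ (-ρ))]
    ring

theorem Complex.abs_arg_lt_of_abs_im_mul_cos_lt {θ : ℝ} (hθ0 : 0 ≤ θ)
    {z : ℂ} (hz : 0 < z.re) (h : |z.im| * Real.cos θ < Real.sin θ * z.re) : |z.arg| < θ := by
  have harg : |z.arg| < Real.pi / 2 := Complex.abs_arg_lt_pi_div_two_iff.2 (Or.inl hz)
  have hn : 0 < ‖z‖ := norm_pos_iff.2 fun h0 ↦ by simp [h0] at hz
  have him : |z.im| = ‖z‖ * Real.sin |z.arg| := by
    rw [← Complex.norm_mul_sin_arg, abs_mul, abs_norm,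
      Real.abs_sin_eq_sin_abs_of_abs_le_pi (Complex.abs_arg_le_pi z)]
  have hre : z.re = ‖z‖ * Real.cos |z.arg| := by
    rw [Real.cos_abs, Complex.norm_mul_cos_arg]
  rw [him, hre] at h
  by_contra! hle
  have : 0 ≤ Real.sin (|z.arg| - θ) :=
    Real.sin_nonneg_of_nonneg_of_le_pi (by linarith) (by linarith [Real.pi_pos])
  rw [Real.sin_sub] at this
  nlinarith

theorem Complex.cpow_ofReal_mem_slitPlane {z : ℂ} (hz : z ≠ 0) {a : ℝ}
    (h : |a * z.arg| < Real.pi) : z ^ (a : ℂ) ∈ Complex.slitPlane := by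
  have him : (Complex.log z * a).im = a * z.arg := by
    simp [Complex.log_im, mul_comm]
  have habs := abs_lt.1 h
  rw [Complex.mem_slitPlane_iff_arg, Complex.cpow_def_of_ne_zero hz]
  refine ⟨?_, Complex.exp_ne_zero _⟩
  rw [← Complex.log_im, Complex.log_exp (by rw [him]; exact habs.1) (by rw [him]; exact habs.2.le),
    him]
  exact habs.2.ne

theorem differentiableAt_cpow_mul_one_add_cpow {a : ℝ} (b c : ℂ) {z : ℂ} (hz : 0 < z.re)
    (harg : |a * z.arg| < Real.pi) :
    DifferentiableAt ℂ (fun z : ℂ ↦ z ^ b * (1 + z ^ (a : ℂ)) ^ c) z := by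
  have hz' : z ∈ Complex.slitPlane := Or.inl hz
  have h1 := Complex.cpow_ofReal_mem_slitPlane (Complex.slitPlane_ne_zero hz') harg
  have h2 : 1 + z ^ (a : ℂ) ∈ Complex.slitPlane := by
    rw [Complex.mem_slitPlane_iff] at h1 ⊢
    simp only [Complex.add_re, Complex.one_re, Complex.add_im, Complex.one_im, zero_add]
    exact h1.imp (fun h ↦ by linarith) id
  exact (differentiableAt_id.cpow_const hz').mul
    (((differentiableAt_const _).add (differentiableAt_id.cpow_const hz')).cpow_const h2)

theorem isOpen_sector (p q : ℝ) : IsOpen {z : ℂ | 0 < z.re ∧ |z.im| * p < q * z.re} :=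
  (isOpen_lt continuous_const Complex.continuous_re).inter
    (isOpen_lt (Complex.continuous_im.abs.mul continuous_const)
      (continuous_const.mul Complex.continuous_re))

theorem convex_sector {p : ℝ} (hp : 0 ≤ p) (q : ℝ) :
    Convex ℝ {z : ℂ | 0 < z.re ∧ |z.im| * p < q * z.re} := by
  refine convex_iff_forall_pos.2 fun z hz w hw a b ha hb _ ↦ ?_
  obtain ⟨hz1, hz2⟩ := hz
  obtain ⟨hw1, hw2⟩ := hw
  simp only [mem_ofPred_eq, Complex.add_re, Complex.real_smul, Complex.re_ofReal_mul,
    Complex.add_im, Complex.im_ofReal_mul]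
  refine ⟨by positivity, ?_⟩
  have h1 : |a * z.im + b * w.im| * p ≤ (a * |z.im| + b * |w.im|) * p := by
    refine mul_le_mul_of_nonneg_right ((abs_add_le _ _).trans ?_) hp
    rw [abs_mul, abs_mul, abs_of_pos ha, abs_of_pos hb]
  have h2 := mul_lt_mul_of_pos_left hz2 ha
  have h3 := mul_lt_mul_of_pos_left hw2 hb
  linarith

theorem norm_one_add_exp_ofReal_mul_I (φ : ℝ) :
    ‖1 + Complex.exp (φ * Complex.I)‖ = 2 * |Real.cos (φ / 2)| := by
  have : 1 + Complex.exp (φ * Complex.I) =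
      Complex.exp ((φ / 2 : ℝ) * Complex.I) * ((2 * Real.cos (φ / 2) : ℝ) : ℂ) := by
    push_cast
    rw [Complex.two_cos, mul_add, ← Complex.exp_add, ← Complex.exp_add]
    ring_nf
    rw [Complex.exp_zero, add_comm]
  rw [this, norm_mul, Complex.norm_exp_ofReal_mul_I, Complex.norm_real, one_mul, Real.norm_eq_abs,
    abs_mul, abs_two]

theorem exists_measure_mgf_eq_of_mittagLeffler3_nonneg {ρ μ γ : ℝ} (hρ : 0 < ρ) (hμ : 0 < μ)
    (hγ : 0 < γ) (h : ∀ t : ℝ, 0 < t → 0 ≤ mittagLeffler3 ρ μ γ (-t)) :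
    ∃ ν : Measure ℝ, (∀ᵐ t ∂ν, -t ≤ 0) ∧ Ioi 1 ⊆ integrableExpSet (fun t : ℝ ↦ -t) ν ∧
      ∀ s : ℝ, 1 < s → mgf (fun t : ℝ ↦ -t) ν s = s ^ (-μ) * (1 + s ^ (-ρ)) ^ (-γ) := by
  set g : ℝ → ℝ := fun t ↦ t ^ (μ - 1) * mittagLeffler3 ρ μ γ (-t ^ ρ) with hg
  have hg0 {t : ℝ} (ht : t ∈ Ioi (0 : ℝ)) : 0 ≤ g t :=
    mul_nonneg (Real.rpow_nonneg (mem_Ioi.1 ht).le _) (h _ (Real.rpow_pos_of_pos ht _))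
  have hint {s : ℝ} (hs : 1 < s) :
      Integrable (fun t ↦ g t * Real.exp (-(s * t))) (volume.restrict (Ioi 0)) := by
    refine not_imp_comm.1 integral_undef ?_
    rw [integral_rpow_mul_mittagLeffler3 hρ hμ hγ hs]
    have : 0 < s := by linarith
    positivity
  have hgm : AEMeasurable g (volume.restrict (Ioi 0)) := by
    have := (hint one_lt_two).aemeasurable.mul
      (by fun_prop : AEMeasurable (fun t : ℝ ↦ Real.exp (2 * t)) (volume.restrict (Ioi 0)))
    refine this.congr (ae_of_all _ fun t ↦ ?_)
    simp [mul_assoc, ← Real.exp_add]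
  have heq (s : ℝ) : EqOn (fun t ↦ (ENNReal.ofReal (g t)).toReal • Real.exp (s * -t))
      (fun t ↦ g t * Real.exp (-(s * t))) (Ioi 0) := fun t ht ↦ by
    simp [ENNReal.toReal_ofReal (hg0 ht)]
  refine ⟨(volume.restrict (Ioi 0)).withDensity fun t ↦ ENNReal.ofReal (g t), ?_, ?_, ?_⟩
  · refine (withDensity_absolutelyContinuous _ _).ae_le ?_
    filter_upwards [ae_restrict_mem measurableSet_Ioi] with t ht
    simpa using (mem_Ioi.1 ht).le
  · intro s hs
    refine (integrable_withDensity_iff_integrable_smul₀' hgm.ennreal_ofReal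
      (ae_of_all _ fun _ ↦ ENNReal.ofReal_lt_top)).2 ?_
    exact (integrableOn_congr_fun (heq s) measurableSet_Ioi).2 (hint hs)
  · intro s hs
    rw [mgf, integral_withDensity_eq_integral_toReal_smul₀ hgm.ennreal_ofReal
      (ae_of_all _ fun _ ↦ ENNReal.ofReal_lt_top),
      setIntegral_congr_fun measurableSet_Ioi (heq s),
      integral_rpow_mul_mittagLeffler3 hρ hμ hγ hs]

theorem laplace_bounds_of_mittagLeffler3_nonneg {ρ μ γ : ℝ} (hρ : 0 < ρ) (hμ : 0 < μ)
    (hγ : 0 < γ) (h : ∀ t : ℝ, 0 < t → 0 ≤ mittagLeffler3 ρ μ γ (-t)) :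
    (∀ s : ℝ, 0 < s → s ≤ 1 → 2 ^ (-γ) ≤ s ^ (-μ) * (1 + s ^ (-ρ)) ^ (-γ)) ∧
    ∀ ψ : ℝ, 0 ≤ ψ → ψ < Real.pi / ρ → ψ < Real.pi / 2 →
      (2 * Real.cos (ρ * ψ / 2)) ^ (-γ) ≤
        Real.cos ψ ^ (-μ) * (1 + Real.cos ψ ^ (-ρ)) ^ (-γ) := by
  obtain ⟨ν, hν, hint, hmgf⟩ := exists_measure_mgf_eq_of_mittagLeffler3_nonneg hρ hμ hγ h
  set θ := min (Real.pi / ρ) (Real.pi / 2) with hθ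
  have hθ0 : 0 < θ := lt_min (by positivity) (by positivity)
  have hθ1 : θ ≤ Real.pi / 2 := min_le_right _ _
  have hθ2 : ρ * θ ≤ Real.pi := by
    have := min_le_left (Real.pi / ρ) (Real.pi / 2)
    rwa [← hθ, le_div_iff₀ hρ, mul_comm] at this
  have hcos : 0 ≤ Real.cos θ := Real.cos_nonneg_of_neg_pi_div_two_le_of_le (by linarith) hθ1
  have hsin : 0 < Real.sin θ := Real.sin_pos_of_pos_of_lt_pi hθ0 (by linarith [Real.pi_pos])
  set U : Set ℂ := {z : ℂ | 0 < z.re ∧ |z.im| * Real.cos θ < Real.sin θ * z.re} with hU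
  set f : ℂ → ℂ := fun z ↦ z ^ ((-μ : ℝ) : ℂ) * (1 + z ^ ((-ρ : ℝ) : ℂ)) ^ ((-γ : ℝ) : ℂ) with hf
  have hUpos (s : ℝ) (hs : 0 < s) : (s : ℂ) ∈ U := ⟨by simpa, by simpa using by positivity⟩
  have hfdiff : DifferentiableOn ℂ f U := fun z hz ↦ by
    refine (differentiableAt_cpow_mul_one_add_cpow _ _ hz.1 ?_).differentiableWithinAt
    have := Complex.abs_arg_lt_of_abs_im_mul_cos_lt hθ0.le hz.1 hz.2
    rw [abs_mul, abs_neg, abs_of_pos hρ]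
    exact (mul_lt_mul_of_pos_left this hρ).trans_le hθ2
  have hfreal (s : ℝ) (hs : 0 < s) :
      f s = ((s ^ (-μ) * (1 + s ^ (-ρ)) ^ (-γ) : ℝ) : ℂ) := by
    have := Real.rpow_pos_of_pos hs (-ρ)
    simp only [hf]
    rw [Complex.ofReal_mul, Complex.ofReal_cpow hs.le, Complex.ofReal_cpow (by linarith),
      Complex.ofReal_add, Complex.ofReal_cpow hs.le, Complex.ofReal_one]
  have heq (s : ℝ) (hs : 1 < s) : f s = complexMGF (fun t : ℝ ↦ -t) ν s := by
    rw [hfreal s (by linarith), complexMGF_ofReal, hmgf s hs]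
  have hall := Ioi_subset_integrableExpSet_of_convex (by fun_prop) hν (isOpen_sector _ _)
    (convex_sector hcos _) hUpos hfdiff hint heq
  have hEq := complexMGF_eqOn_of_convex (isOpen_sector _ _) (convex_sector hcos _) hUpos hfdiff
    le_rfl hall heq
  have hmgf' (s : ℝ) (hs : 0 < s) :
      mgf (fun t : ℝ ↦ -t) ν s = s ^ (-μ) * (1 + s ^ (-ρ)) ^ (-γ) := by
    have := hEq ⟨hUpos s hs, by simpa using hs⟩
    rw [hfreal s hs, complexMGF_ofReal] at this
    exact_mod_cast this.symm
  constructor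
  · intro s hs hs1
    have h1 : mgf (fun t : ℝ ↦ -t) ν 1 ≤ mgf (fun t : ℝ ↦ -t) ν s := by
      refine integral_mono_ae (hall (mem_Ioi.2 one_pos)) (hall (mem_Ioi.2 hs)) ?_
      filter_upwards [hν] with t ht
      simp only [Real.exp_le_exp]
      nlinarith
    rw [hmgf' 1 one_pos, hmgf' s hs, Real.one_rpow, Real.one_rpow, one_mul, one_add_one_eq_two]
      at h1
    exact h1
  · intro ψ hψ0 hψ1 hψ2
    have hψθ : ψ < θ := lt_min hψ1 hψ2
    have hcosψ : 0 < Real.cos ψ := Real.cos_pos_of_mem_Ioo ⟨by linarith [Real.pi_pos], hψ2⟩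
    set z : ℂ := Complex.exp (ψ * Complex.I) with hz
    have hre : z.re = Real.cos ψ := Complex.exp_ofReal_mul_I_re ψ
    have him : z.im = Real.sin ψ := Complex.exp_ofReal_mul_I_im ψ
    have hzU : z ∈ U := by
      refine ⟨by rwa [hre], ?_⟩
      rw [hre, him, abs_of_nonneg (Real.sin_nonneg_of_nonneg_of_le_pi hψ0 (by linarith))]
      have := Real.sin_pos_of_pos_of_lt_pi (sub_pos.2 hψθ) (by linarith [Real.pi_pos])
      rw [Real.sin_sub] at this
      linarith
    have hlog : Complex.log z = ψ * Complex.I := by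
      refine Complex.log_exp ?_ ?_ <;> simp <;> linarith [Real.pi_pos]
    have hzρ : z ^ ((-ρ : ℝ) : ℂ) = Complex.exp ((-(ρ * ψ) : ℝ) * Complex.I) := by
      rw [Complex.cpow_def_of_ne_zero (Complex.exp_ne_zero _), hlog]
      congr 1
      push_cast
      ring
    have hhalf : 0 ≤ Real.cos (ρ * ψ / 2) := by
      have : ρ * ψ < Real.pi := by rwa [lt_div_iff₀ hρ, mul_comm] at hψ1
      have h0 : 0 ≤ ρ * ψ := by positivity
      exact Real.cos_nonneg_of_neg_pi_div_two_le_of_le (by linarith) (by linarith)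
    have hnorm : ‖f z‖ = (2 * Real.cos (ρ * ψ / 2)) ^ (-γ) := by
      simp only [hf]
      rw [norm_mul, Complex.norm_cpow_real, Complex.norm_cpow_real, hzρ,
        norm_one_add_exp_ofReal_mul_I, hz, Complex.norm_exp_ofReal_mul_I, Real.one_rpow, one_mul,
        neg_div, Real.cos_neg, abs_of_nonneg hhalf]
    rw [← hnorm, hEq ⟨hzU, hzU.1⟩, ← hmgf' _ hcosψ, ← hre]
    exact norm_complexMGF_le_mgf

theorem rpow_neg_mul_one_add_rpow_neg_le {ρ μ γ s : ℝ} (hγ : 0 < γ) (hs : 0 < s) :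
    s ^ (-μ) * (1 + s ^ (-ρ)) ^ (-γ) ≤ s ^ (γ * ρ - μ) := by
  have h0 := Real.rpow_pos_of_pos hs (-ρ)
  have h1 : (1 + s ^ (-ρ)) ^ (-γ) ≤ (s ^ (-ρ)) ^ (-γ) :=
    Real.rpow_le_rpow_of_nonpos h0 (by linarith) (by linarith)
  rw [← Real.rpow_mul hs.le] at h1
  refine (mul_le_mul_of_nonneg_left h1 (Real.rpow_nonneg hs.le _)).trans_eq ?_
  rw [← Real.rpow_add hs]
  ring_nf

theorem not_forall_le_rpow {a c : ℝ} (hc : 0 < c) (ha : 0 < a) :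
    ¬ ∀ s : ℝ, 0 < s → s ≤ 1 → c ≤ s ^ a := by
  intro h
  have ht : Tendsto (fun s : ℝ ↦ s ^ a) (𝓝[>] 0) (𝓝 0) := by
    have := (Real.continuousAt_rpow_const 0 a (Or.inr ha.le)).tendsto
    rw [Real.zero_rpow ha.ne'] at this
    exact this.mono_left nhdsWithin_le_nhds
  refine hc.not_ge (ge_of_tendsto ht ?_)
  filter_upwards [Ioc_mem_nhdsGT one_pos] with s hs using h s hs.1 hs.2

theorem mittagLeffler3_neg_value (ρ μ γ : ℝ) (hρ : 0 < ρ) (hμ : 0 < μ) (hγ : 0 < γ)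
    (h : 2 < ρ ∨ μ < γ * ρ ∨ (ρ = 2 ∧ μ < 3 * γ)) :
    ∃ t : ℝ, 0 < t ∧ mittagLeffler3 ρ μ γ (-t) < 0 := by
  by_contra! hcon
  obtain ⟨hA, hB⟩ := laplace_bounds_of_mittagLeffler3_nonneg hρ hμ hγ hcon
  rcases h with h | h | ⟨rfl, h⟩
  · have hθ : Real.pi / ρ < Real.pi / 2 := div_lt_div_of_pos_left Real.pi_pos two_pos h
    have hθ0 : 0 < Real.pi / ρ := by positivity
    have hcos : 0 < Real.cos (Real.pi / ρ) :=
      Real.cos_pos_of_mem_Ioo ⟨by linarith [Real.pi_pos], hθ⟩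
    have hcont : ContinuousAt (fun ψ : ℝ ↦ Real.cos ψ ^ (-μ) * (1 + Real.cos ψ ^ (-ρ)) ^ (-γ) *
        (2 * Real.cos (ρ * ψ / 2)) ^ γ) (Real.pi / ρ) := by
      have h1 : ContinuousAt (fun ψ : ℝ ↦ Real.cos ψ ^ (-ρ)) (Real.pi / ρ) :=
        Real.continuous_cos.continuousAt.rpow_const (Or.inl hcos.ne')
      have h2 : 0 < 1 + Real.cos (Real.pi / ρ) ^ (-ρ) := by positivity
      refine ((Real.continuous_cos.continuousAt.rpow_const (Or.inl hcos.ne')).mul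
        ((continuousAt_const.add h1).rpow_const (Or.inl h2.ne'))).mul
        (ContinuousAt.rpow_const (by fun_prop) (Or.inr hγ.le))
    have ht := hcont.tendsto.mono_left (nhdsWithin_le_nhds (s := Iio (Real.pi / ρ)))
    rw [mul_div_cancel₀ _ hρ.ne', Real.cos_pi_div_two, mul_zero, Real.zero_rpow hγ.ne',
      mul_zero] at ht
    refine one_pos.not_ge (ge_of_tendsto ht ?_)
    filter_upwards [Ico_mem_nhdsLT hθ0] with ψ hψ
    have hpos : 0 < 2 * Real.cos (ρ * ψ / 2) := by
      have h1 : ρ * ψ < Real.pi := by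
        have := hψ.2
        rwa [lt_div_iff₀ hρ, mul_comm] at this
      have h0 : 0 ≤ ρ * ψ := mul_nonneg hρ.le hψ.1
      exact mul_pos two_pos (Real.cos_pos_of_mem_Ioo ⟨by linarith, by linarith⟩)
    have := hB ψ hψ.1 hψ.2 (hψ.2.trans hθ)
    rwa [Real.rpow_neg hpos.le, inv_le_iff_one_le_mul₀ (by positivity)] at this
  · exact not_forall_le_rpow (Real.rpow_pos_of_pos two_pos (-γ)) (sub_pos.2 h) fun s hs hs1 ↦
      (hA s hs hs1).trans (rpow_neg_mul_one_add_rpow_neg_le hγ hs)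
  · refine not_forall_le_rpow (Real.rpow_pos_of_pos two_pos (-γ)) (sub_pos.2 h) fun s hs hs1 ↦ ?_
    have hψ : Real.arccos s < Real.pi / 2 := Real.arccos_lt_pi_div_two.2 hs
    have := (hB (Real.arccos s) (Real.arccos_nonneg s) hψ hψ).trans
      (rpow_neg_mul_one_add_rpow_neg_le hγ (by rwa [Real.cos_arccos (by linarith) hs1]))
    rw [mul_div_cancel_left₀ _ two_ne_zero, Real.cos_arccos (by linarith) hs1,
      Real.mul_rpow two_pos.le hs.le] at this
    have h1 := mul_le_mul_of_nonneg_right this (Real.rpow_nonneg hs.le γ)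
    rwa [mul_assoc, ← Real.rpow_add hs, ← Real.rpow_add hs, neg_add_cancel, Real.rpow_zero,
      mul_one, show γ * 2 - μ + γ = 3 * γ - μ by ring] at h1
end

section
/- Let ρ, μ, γ > 0. If either (ρ ≤ 1 and μ ≥ ρ·γ), or (1 < ρ ≤ 2, 2μ ≥ 3γρ, and 2·(μ/ρ − γ)·(μ/ρ − γ + 1/2) ≥ γ), then the three-parametric Mittag-Leffler function is non-negative on the whole real line: E^γ_{ρ,μ}(z) ≥ 0 for every real z. -/
open Finset in
/-- The rising factorial `x (x + 1) ⋯ (x + n - 1)`. -/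
noncomputable def poch (x : ℝ) (n : ℕ) : ℝ := ∏ i ∈ range n, (x + i)

@[simp] lemma poch_zero (x : ℝ) : poch x 0 = 1 := by simp [poch]

lemma poch_succ (x : ℝ) (n : ℕ) : poch x (n + 1) = poch x n * (x + n) := by
  simp [poch, Finset.prod_range_succ]

lemma poch_add (x : ℝ) (m n : ℕ) : poch x (m + n) = poch x m * poch (x + m) n := by
  simp [poch, Finset.prod_range_add, add_assoc]

lemma poch_succ_left (x : ℝ) (n : ℕ) : poch x (n + 1) = x * poch (x + 1) n := by
  rw [add_comm, poch_add]
  simp [poch]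

lemma poch_pos {x : ℝ} (hx : 0 < x) (n : ℕ) : 0 < poch x n :=
  Finset.prod_pos fun i _ => by positivity

lemma poch_nonneg {x : ℝ} (hx : 0 ≤ x) (n : ℕ) : 0 ≤ poch x n :=
  Finset.prod_nonneg fun i _ => by positivity

lemma poch_mono {x y : ℝ} (hx : 0 ≤ x) (hxy : x ≤ y) (n : ℕ) : poch x n ≤ poch y n :=
  Finset.prod_le_prod (fun i _ => by positivity) fun i _ => by linarith

lemma poch_le {x R : ℝ} (hx : 0 ≤ x) (hR : 1 ≤ R) (hxR : x ≤ R) (n : ℕ) :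
    poch x n ≤ R ^ n * n.factorial := by
  induction n with
  | zero => simp
  | succ n ih =>
    rw [poch_succ, Nat.factorial_succ, pow_succ]
    have : x + n ≤ R * (n + 1) := by nlinarith [(Nat.cast_nonneg n : (0 : ℝ) ≤ n)]
    calc poch x n * (x + n) ≤ (R ^ n * n.factorial) * (R * (n + 1)) := by gcongr
      _ = _ := by push_cast; ring

lemma le_poch {x r : ℝ} (hr : 0 ≤ r) (hr1 : r ≤ 1) (hrx : r ≤ x) (n : ℕ) :
    r ^ n * n.factorial ≤ poch x n := by
  induction n with
  | zero => simp
  | succ n ih =>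
    rw [poch_succ, Nat.factorial_succ, pow_succ]
    have : r * (n + 1) ≤ x + n := by nlinarith [(Nat.cast_nonneg n : (0 : ℝ) ≤ n)]
    calc r ^ n * r * ((n + 1) * n.factorial : ℕ) = (r ^ n * n.factorial) * (r * (n + 1)) := by
          push_cast; ring
      _ ≤ _ := by gcongr; exact poch_nonneg (hr.trans hrx) n

lemma poch_reflect (x : ℝ) (n : ℕ) : poch (1 - x - n) n = (-1) ^ n * poch x n := by
  induction n generalizing x with
  | zero => simp
  | succ n ih =>
    rw [poch_succ, poch_succ_left x, show (1 - x - ((n + 1 : ℕ) : ℝ)) = 1 - (x + 1) - n by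
      push_cast; ring, ih, pow_succ]
    ring

lemma poch_two_mul (x : ℝ) (n : ℕ) :
    poch (2 * x) (2 * n) = 4 ^ n * poch x n * poch (x + 1 / 2) n := by
  induction n with
  | zero => simp
  | succ n ih =>
    rw [show 2 * (n + 1) = 2 * n + 1 + 1 by ring, poch_succ, poch_succ, ih, poch_succ x,
      poch_succ (x + 1 / 2)]
    push_cast; ring

lemma poch_ne_zero_of_le {x : ℝ} {m n : ℕ} (h : poch x n ≠ 0) (hmn : m ≤ n) : poch x m ≠ 0 := by
  obtain ⟨k, rfl⟩ := Nat.exists_eq_add_of_le hmn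
  rw [poch_add] at h
  exact left_ne_zero_of_mul h

open Finset in
/-- The Chu-Vandermonde identity. -/
lemma sum_poch_mul_poch (x y : ℝ) (n : ℕ) :
    ∑ p ∈ antidiagonal n, poch x p.1 / p.1.factorial * (poch y p.2 / p.2.factorial)
      = poch (x + y) n / n.factorial := by
  induction n with
  | zero => simp
  | succ n ih =>
    have hn : ((n : ℝ) + 1) ≠ 0 := by positivity
    have key : ((n : ℝ) + 1) * ∑ p ∈ antidiagonal (n + 1),
        poch x p.1 / p.1.factorial * (poch y p.2 / p.2.factorial) =
        (x + y + n) * ∑ p ∈ antidiagonal n,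
          poch x p.1 / p.1.factorial * (poch y p.2 / p.2.factorial) := by
      have e1 : ((n : ℝ) + 1) * ∑ p ∈ antidiagonal (n + 1),
          poch x p.1 / p.1.factorial * (poch y p.2 / p.2.factorial) =
          ∑ p ∈ antidiagonal (n + 1),
            p.1 * (poch x p.1 / p.1.factorial * (poch y p.2 / p.2.factorial)) +
          ∑ p ∈ antidiagonal (n + 1),
            p.2 * (poch x p.1 / p.1.factorial * (poch y p.2 / p.2.factorial)) := by
        rw [mul_sum, ← sum_add_distrib]
        refine sum_congr rfl fun p hp => ?_
        have : ((p.1 : ℝ) + p.2) = n + 1 := by exact_mod_cast mem_antidiagonal.1 hp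
        rw [← this]; ring
      rw [e1, Nat.sum_antidiagonal_succ, Nat.sum_antidiagonal_succ', mul_sum]
      simp only [Nat.cast_zero, zero_mul, zero_add]
      rw [← sum_add_distrib]
      refine sum_congr rfl fun p hp => ?_
      have : ((p.1 : ℝ) + p.2) = n := by exact_mod_cast mem_antidiagonal.1 hp
      rw [← this, poch_succ, poch_succ, Nat.factorial_succ, Nat.factorial_succ]
      have h1 : (p.1.factorial : ℝ) ≠ 0 := by positivity
      have h2 : (p.2.factorial : ℝ) ≠ 0 := by positivity
      push_cast
      field_simp
      ring
    rw [ih] at key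
    rw [← mul_left_cancel_iff_of_pos (by positivity : (0 : ℝ) < n + 1), key, poch_succ,
      Nat.factorial_succ]
    push_cast
    field_simp

/-- The coefficients of the Gauss hypergeometric series `₂F₁(A, B; C; X)`. -/
noncomputable def gaussCoeff (A B C : ℝ) (n : ℕ) : ℝ :=
  poch A n * poch B n / (poch C n * n.factorial)

lemma gaussCoeff_succ (A B C : ℝ) (n : ℕ) (h : poch C (n + 1) ≠ 0) :
    (n + 1) * (C + n) * gaussCoeff A B C (n + 1) = (A + n) * (B + n) * gaussCoeff A B C n := by
  rw [poch_succ] at h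
  have h1 := left_ne_zero_of_mul h
  have h2 := right_ne_zero_of_mul h
  have h3 : (n.factorial : ℝ) ≠ 0 := by positivity
  simp only [gaussCoeff, poch_succ, Nat.factorial_succ]
  push_cast
  field_simp

open Finset in
/-- The Pfaff-Saalschütz identity, as a coefficient of Euler's transformation
`₂F₁(A, B; C; X) = (1 - X) ^ (C - A - B) ₂F₁(C - A, C - B; C; X)`. -/
lemma sum_poch_mul_gaussCoeff (A B C : ℝ) (n : ℕ) (hC : poch C n ≠ 0) :
    ∑ p ∈ antidiagonal n,
      poch (A + B - C) p.1 / p.1.factorial * gaussCoeff (C - A) (C - B) C p.2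
      = gaussCoeff A B C n := by
  induction n with
  | zero => simp [gaussCoeff]
  | succ n ih =>
    specialize ih (poch_ne_zero_of_le hC n.le_succ)
    have hCn : C + n ≠ 0 := by rw [poch_succ] at hC; exact right_ne_zero_of_mul hC
    have hn : ((n : ℝ) + 1) ≠ 0 := by positivity
    have key : ((n : ℝ) + 1) * (C + n) * ∑ p ∈ antidiagonal (n + 1),
        poch (A + B - C) p.1 / p.1.factorial * gaussCoeff (C - A) (C - B) C p.2 =
        (A + n) * (B + n) * ∑ p ∈ antidiagonal n,
          poch (A + B - C) p.1 / p.1.factorial * gaussCoeff (C - A) (C - B) C p.2 := by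
      have e1 : ((n : ℝ) + 1) * (C + n) * ∑ p ∈ antidiagonal (n + 1),
          poch (A + B - C) p.1 / p.1.factorial * gaussCoeff (C - A) (C - B) C p.2 =
          ∑ p ∈ antidiagonal (n + 1), p.1 * (n + p.2 + C) *
            (poch (A + B - C) p.1 / p.1.factorial * gaussCoeff (C - A) (C - B) C p.2) +
          ∑ p ∈ antidiagonal (n + 1), p.2 * (C + p.2 - 1) *
            (poch (A + B - C) p.1 / p.1.factorial * gaussCoeff (C - A) (C - B) C p.2) := by
        rw [mul_sum, ← sum_add_distrib]
        refine sum_congr rfl fun p hp => ?_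
        have : (p.1 : ℝ) = n + 1 - p.2 := by
          rw [eq_sub_iff_add_eq]; exact_mod_cast mem_antidiagonal.1 hp
        rw [this]; ring
      rw [e1, Nat.sum_antidiagonal_succ, Nat.sum_antidiagonal_succ', mul_sum]
      simp only [Nat.cast_zero, zero_mul, zero_add, add_zero]
      rw [← sum_add_distrib]
      refine sum_congr rfl fun p hp => ?_
      have hp' := mem_antidiagonal.1 hp
      have : (p.1 : ℝ) = n - p.2 := by
        rw [eq_sub_iff_add_eq]; exact_mod_cast hp'
      have h1 : (p.1.factorial : ℝ) ≠ 0 := by positivity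
      have e2 := gaussCoeff_succ (C - A) (C - B) C p.2
        (poch_ne_zero_of_le hC (by omega))
      have e3 : ((p.1 : ℝ) + 1) * (poch (A + B - C) (p.1 + 1) / (p.1 + 1).factorial) =
          (A + B - C + p.1) * (poch (A + B - C) p.1 / p.1.factorial) := by
        rw [poch_succ, Nat.factorial_succ]
        push_cast
        field_simp
      push_cast
      calc _ = (n + p.2 + C) * gaussCoeff (C - A) (C - B) C p.2 *
              (((p.1 : ℝ) + 1) * (poch (A + B - C) (p.1 + 1) / (p.1 + 1).factorial)) +
            (poch (A + B - C) p.1 / p.1.factorial) *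
              ((p.2 + 1) * (C + p.2) * gaussCoeff (C - A) (C - B) C (p.2 + 1)) := by ring
        _ = _ := by rw [e2, e3, this]; ring
    rw [ih, ← gaussCoeff_succ A B C n hC] at key
    exact mul_left_cancel₀ (mul_ne_zero hn hCn) key

open Finset PowerSeries in
/-- A product of two Gauss series whose Euler exponents cancel is unchanged by transforming both
factors. -/
lemma sum_gaussCoeff_mul_gaussCoeff (A B C A' B' C' : ℝ) (n : ℕ) (hC : poch C n ≠ 0)
    (hC' : poch C' n ≠ 0) (h : A + B - C + (A' + B' - C') = 0) :
    ∑ p ∈ antidiagonal n, gaussCoeff A B C p.1 * gaussCoeff A' B' C' p.2 =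
      ∑ p ∈ antidiagonal n,
        gaussCoeff (C - A) (C - B) C p.1 * gaussCoeff (C' - A') (C' - B') C' p.2 := by
  let e : ℝ → PowerSeries ℝ := fun s => mk fun n => poch s n / n.factorial
  let g : ℝ → ℝ → ℝ → PowerSeries ℝ := fun a b c => mk (gaussCoeff a b c)
  have he : e (A + B - C) * e (A' + B' - C') = 1 := by
    ext m
    rw [coeff_mul]
    simp only [e, coeff_mk]
    rw [sum_poch_mul_poch, h, coeff_one]
    rcases m with _ | m
    · simp
    · rw [poch_succ_left]; simp
  have hg : ∀ a b c : ℝ, ∀ m ≤ n, poch c n ≠ 0 →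
      coeff m (e (a + b - c) * g (c - a) (c - b) c) = gaussCoeff a b c m := by
    intro a b c m hm hc
    rw [coeff_mul]
    simp only [e, g, coeff_mk]
    exact sum_poch_mul_gaussCoeff a b c m (poch_ne_zero_of_le hc hm)
  calc _ = coeff n ((e (A + B - C) * g (C - A) (C - B) C) *
          (e (A' + B' - C') * g (C' - A') (C' - B') C')) := by
        rw [coeff_mul]
        refine sum_congr rfl fun p hp => ?_
        have := mem_antidiagonal.1 hp
        rw [hg _ _ _ _ (by omega) hC, hg _ _ _ _ (by omega) hC']
    _ = coeff n (g (C - A) (C - B) C * g (C' - A') (C' - B') C') := by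
        rw [mul_mul_mul_comm, he, one_mul]
    _ = _ := by
        rw [coeff_mul]
        simp only [g, coeff_mk]

lemma alternating_sum_of_poch {z : ℝ} (hz : -1 < z) (τ : ℕ → ℝ) (m : ℕ)
    (h0 : τ 0 * poch (z + 1) (m + 1) = 1)
    (hs : ∀ i : ℕ, τ (i + 1) * poch (z + i + 1) (m + 2) = z + 2 * (i + 1)) (J : ℕ) :
    ∑ i ∈ Finset.range (J + 1), (-1) ^ i * (m + 1).choose i * τ i =
      (-1) ^ J * m.choose J / poch (z + J + 1) (m + 1) := by
  have hJ : ∀ J : ℕ, 0 < z + J + 1 := fun J => by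
    have := (Nat.cast_nonneg J : (0 : ℝ) ≤ J); linarith
  induction J with
  | zero =>
    have := (poch_pos (by simpa using hJ 0) (m + 1) : 0 < poch (z + 1) (m + 1)).ne'
    simp only [zero_add, Finset.sum_range_one, pow_zero, one_mul, Nat.choose_zero_right,
      Nat.cast_one, Nat.cast_zero, add_zero]
    rw [eq_div_iff this, h0]
  | succ J ih =>
    rw [Finset.sum_range_succ, ih]
    have hP : 0 < poch (z + J + 1 + 1) m := poch_pos (by linarith [hJ J]) m
    have hp1 : poch (z + J + 1) (m + 1) = (z + J + 1) * poch (z + J + 1 + 1) m :=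
      poch_succ_left _ _
    have hp2 : poch (z + J + 1) (m + 2) = (z + J + 1) * (poch (z + J + 1 + 1) m *
        (z + J + 1 + 1 + m)) := by
      rw [poch_succ_left, poch_succ]
    have hp3 : poch (z + (J + 1 : ℕ) + 1) (m + 1) = poch (z + J + 1 + 1) m *
        (z + J + 1 + 1 + m) := by
      rw [← poch_succ]; congr 1; push_cast; ring
    have hz2 : 0 < z + J + 1 + 1 + m := by
      have := (Nat.cast_nonneg m : (0 : ℝ) ≤ m); linarith [hJ J]
    have hτ : τ (J + 1) = (z + 2 * (J + 1)) / ((z + J + 1) * (poch (z + J + 1 + 1) m *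
        (z + J + 1 + 1 + m))) := by
      rw [eq_div_iff (by have := hJ J; positivity), ← hp2, hs]
    have hc : (m.choose (J + 1) : ℝ) * (J + 1) = m.choose J * (m - J) := by
      rcases le_or_gt J m with hle | hlt
      · rw [← Nat.cast_sub hle]; exact_mod_cast Nat.choose_succ_right_eq m J
      · simp [Nat.choose_eq_zero_of_lt hlt, Nat.choose_eq_zero_of_lt (Nat.lt_succ_of_lt hlt)]
    rw [hτ, hp1, hp3, Nat.choose_succ_succ', pow_succ]
    have := hJ J
    push_cast
    field_simp
    linear_combination (-1) * hc

open Finset in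
lemma sum_antidiagonal_assoc (f : ℕ → ℕ → ℕ → ℝ) (N : ℕ) :
    ∑ p ∈ antidiagonal N, ∑ q ∈ antidiagonal p.1, f q.1 q.2 p.2 =
      ∑ p ∈ antidiagonal N, ∑ q ∈ antidiagonal p.2, f p.1 q.1 q.2 := by
  rw [sum_sigma', sum_sigma']
  refine sum_nbij' (fun x => ⟨(x.2.1, x.2.2 + x.1.2), (x.2.2, x.1.2)⟩)
    (fun x => ⟨(x.1.1 + x.2.1, x.2.2), (x.1.1, x.2.1)⟩) ?_ ?_ ?_ ?_ ?_
  · rintro ⟨⟨a, b⟩, ⟨c, d⟩⟩; simp; omega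
  · rintro ⟨⟨a, b⟩, ⟨c, d⟩⟩; simp; omega
  · rintro ⟨⟨a, b⟩, ⟨c, d⟩⟩; simp +contextual
  · rintro ⟨⟨a, b⟩, ⟨c, d⟩⟩; simp +contextual
  · rintro ⟨⟨a, b⟩, ⟨c, d⟩⟩; simp

/-- The well-poised weight `(y - 1 + 2 n) (y)_{n - 1}`, read as `1` for `n = 0`. -/
noncomputable def wellPoised (y : ℝ) : ℕ → ℝ
  | 0 => 1
  | n + 1 => (y - 1 + 2 * (n + 1)) * poch y n

lemma wellPoised_pos {y : ℝ} (hy : 0 < y) (n : ℕ) : 0 < wellPoised y n := by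
  rcases n with _ | n
  · simp [wellPoised]
  · have := poch_pos hy n
    have : 0 < y - 1 + 2 * ((n : ℝ) + 1) := by
      have := (Nat.cast_nonneg n : (0 : ℝ) ≤ n); linarith
    simp only [wellPoised]; positivity

lemma wellPoised_succ_mul (y : ℝ) (n k : ℕ) :
    wellPoised y (n + 1) * poch ((n + 1 : ℕ) + y - 1) k =
      (y - 1 + 2 * (n + 1)) * poch y (n + k) := by
  rw [wellPoised, poch_add, mul_assoc]
  congr 3
  push_cast; ring

open Finset in
/-- The orthogonality relation behind the inversion of Bailey pairs. -/
lemma sum_wellPoised {y : ℝ} (hy : 0 < y) (k M : ℕ) :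
    ∑ p ∈ antidiagonal M, (-1) ^ p.1 * (wellPoised y (k + p.1) * poch ((k + p.1 : ℕ) + y - 1) k) /
      (p.1.factorial * p.2.factorial * poch y (2 * k + p.1 + M)) = if M = 0 then 1 else 0 := by
  have hpy : ∀ n, poch y n ≠ 0 := fun n => (poch_pos hy n).ne'
  rcases M with _ | m
  · rcases k with _ | k
    · simp [wellPoised]
    · simp only [Nat.antidiagonal_zero, sum_singleton, add_zero, pow_zero, one_mul,
        Nat.factorial_zero, Nat.cast_one, if_true]
      rw [wellPoised_succ_mul, div_eq_one_iff_eq (hpy _), show 2 * (k + 1) = k + (k + 1) + 1 by ring,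
        poch_succ]
      push_cast; ring
  · rw [if_neg m.succ_ne_zero]
    set τ : ℕ → ℝ := fun i => wellPoised y (k + i) * poch ((k + i : ℕ) + y - 1) k /
      poch y (2 * k + i + (m + 1)) with hτ
    have hsum := alternating_sum_of_poch (z := y + 2 * k - 1)
      (by have := (Nat.cast_nonneg k : (0 : ℝ) ≤ k); linarith) τ m ?_ ?_ (m + 1)
    · rw [Nat.choose_succ_self] at hsum
      simp only [Nat.cast_zero, mul_zero, zero_div] at hsum
      rw [Nat.sum_antidiagonal_eq_sum_range_succ_mk]
      have : ∀ i ∈ range (m + 1 + 1), (-1 : ℝ) ^ i * (wellPoised y (k + i) *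
          poch ((k + i : ℕ) + y - 1) k) / (i.factorial * (m + 1 - i).factorial *
            poch y (2 * k + i + (m + 1))) =
          ((-1) ^ i * (m + 1).choose i * τ i) / (m + 1).factorial := by
        intro i hi
        have hi' : i ≤ m + 1 := by simpa [Nat.lt_succ_iff] using hi
        rw [Nat.cast_choose ℝ hi']
        simp only [hτ]
        have h1 := hpy (2 * k + i + (m + 1))
        have h2 : (i.factorial : ℝ) ≠ 0 := by positivity
        have h3 : ((m + 1 - i).factorial : ℝ) ≠ 0 := by positivity
        have h4 : ((m + 1).factorial : ℝ) ≠ 0 := by positivity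
        field_simp
      simp only
      rw [sum_congr rfl this, ← sum_div, hsum, zero_div]
    · simp only [hτ, add_zero]
      rcases k with _ | k
      · simp [wellPoised]
        have := hpy (m + 1)
        field_simp
      · rw [wellPoised_succ_mul, div_mul_eq_mul_div, div_eq_one_iff_eq (hpy _), poch_add y (2 * (k + 1)),
          show 2 * (k + 1) = k + (k + 1) + 1 by ring, poch_succ y]
        have : y + 2 * ((k + 1 : ℕ) : ℝ) - 1 + 1 = y + ((k + (k + 1) + 1 : ℕ) : ℝ) := by
          push_cast; ring
        rw [this]
        push_cast; ring
    · intro i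
      simp only [hτ]
      rw [← add_assoc k i 1, wellPoised_succ_mul, div_mul_eq_mul_div,
        div_eq_iff (hpy _), show 2 * k + (i + 1) + (m + 1) = (k + i + k) + (m + 2) by ring,
        poch_add y (k + i + k)]
      have : y + 2 * (k : ℝ) - 1 + i + 1 = y + ((k + i + k : ℕ) : ℝ) := by
        push_cast; ring
      rw [this]
      push_cast; ring

open Finset in
/-- Inversion of Bailey pairs. -/
lemma bailey_inversion {y : ℝ} (hy : 0 < y) (δ S : ℕ → ℝ)
    (hS : ∀ n, S n = ∑ p ∈ antidiagonal n,
      (-1) ^ p.1 * poch (n + y - 1) p.1 / p.2.factorial * δ p.1) (N : ℕ) :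
    ∑ p ∈ antidiagonal N, (-1) ^ p.1 * (wellPoised y p.1 * S p.1) /
      (p.2.factorial * poch y (2 * p.1 + p.2)) = δ N := by
  let f : ℕ → ℕ → ℕ → ℝ := fun k i j => δ k * ((-1) ^ i * (wellPoised y (k + i) *
    poch ((k + i : ℕ) + y - 1) k) / (i.factorial * j.factorial * poch y (2 * k + i + (i + j))))
  have h1 : ∑ p ∈ antidiagonal N, (-1) ^ p.1 * (wellPoised y p.1 * S p.1) /
      (p.2.factorial * poch y (2 * p.1 + p.2)) =
      ∑ p ∈ antidiagonal N, ∑ q ∈ antidiagonal p.1, f q.1 q.2 p.2 := by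
    refine sum_congr rfl fun p _ => ?_
    rw [hS, mul_sum, mul_sum, sum_div]
    refine sum_congr rfl fun q hq => ?_
    have hq' := mem_antidiagonal.1 hq
    simp only [f]
    rw [← hq', show 2 * (q.1 + q.2) + p.2 = 2 * q.1 + q.2 + (q.2 + p.2) by ring, pow_add]
    have : ((-1 : ℝ) ^ q.1) * (-1) ^ q.1 = 1 := by rw [← mul_pow]; simp
    have h2 : (q.2.factorial : ℝ) ≠ 0 := by positivity
    have h3 : (p.2.factorial : ℝ) ≠ 0 := by positivity
    have h4 := (poch_pos hy (2 * q.1 + q.2 + (q.2 + p.2))).ne'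
    field_simp
    linear_combination (wellPoised y (q.1 + q.2) *
      poch ((q.1 + q.2 : ℕ) + y - 1) q.1 * δ q.1) * this
  rw [h1, sum_antidiagonal_assoc]
  have h2 : ∀ p ∈ antidiagonal N, ∑ q ∈ antidiagonal p.2, f p.1 q.1 q.2 =
      if p.2 = 0 then δ p.1 else 0 := by
    intro p _
    have := sum_wellPoised hy p.1 p.2
    rw [show (if p.2 = 0 then δ p.1 else 0) = δ p.1 * (if p.2 = 0 then 1 else 0) by simp, ← this,
      mul_sum]
    refine sum_congr rfl fun q hq => ?_
    simp only [f]
    rw [mem_antidiagonal.1 hq]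
  rw [sum_congr rfl h2, Nat.sum_antidiagonal_eq_sum_range_succ_mk, sum_range_succ]
  simp only [Nat.sub_self, if_true]
  rw [sum_eq_zero, zero_add]
  intro i hi
  rw [if_neg]
  have := mem_range.1 hi
  omega

open Finset in
/-- Sears' transformation for the balanced `₄F₃` series that occurs in the expansion of
`₁F₂(a; a + β, a + β + 1/2)` in squares of Bessel functions. -/
lemma sears_transformation {a β : ℝ} (ha : 0 < a) (hβ : 0 < β) (n : ℕ) :
    ∑ p ∈ antidiagonal n, (-1) ^ p.1 * poch (n + (a + 2 * β) - 1) p.1 / p.2.factorial *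
      (poch a p.1 * poch (a / 2 + β + 1 / 2) p.1 / (p.1.factorial * poch (a + β) p.1 *
        poch (a + β + 1 / 2) p.1 * poch (a / 2 + β) p.1)) =
    (∑ p ∈ antidiagonal n, poch (β - 1 / 2 + p.2) p.1 * (poch (a / 2) p.1 * poch a p.1 /
      (poch (a + β + 1 / 2) p.1 * p.1.factorial)) * (poch (β - a / 2) p.2 * poch β p.2 /
        p.2.factorial)) / (poch (a / 2 + β) n * poch (a + β) n) := by
  have refl : ∀ x : ℝ, 0 < x → ∀ p ∈ antidiagonal n,
      poch (1 - x - n) p.2 = (-1) ^ p.2 * (poch x n / poch x p.1) := by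
    intro x hx p hp
    have hp' := mem_antidiagonal.1 hp
    have : (n : ℝ) = p.1 + p.2 := by exact_mod_cast hp'.symm
    have h1 := (poch_pos hx p.1).ne'
    rw [← hp', poch_add, mul_div_cancel_left₀ _ h1, ← poch_reflect]
    congr 1
    push_cast; ring
  have key := sum_gaussCoeff_mul_gaussCoeff (n + (a + 2 * β) - 1) (a / 2 + β + 1 / 2)
    (a + β + 1 / 2) (1 - (a / 2 + β) - n) (1 - (a + β) - n) (1 - a - n) n
    (poch_pos (by positivity) n).ne' (by
      rw [poch_reflect]
      exact mul_ne_zero (by simp) (poch_pos ha n).ne') (by ring)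
  have han := (poch_pos ha n).ne'
  have hhn := (poch_pos (by positivity : 0 < a / 2 + β) n).ne'
  have hbn := (poch_pos (by positivity : 0 < a + β) n).ne'
  rw [eq_div_iff (by positivity)]
  have hsq : ∀ m : ℕ, ((-1 : ℝ) ^ m) * (-1) ^ m = 1 := fun m => by rw [← mul_pow]; simp
  have e1 : ∀ p ∈ antidiagonal n, gaussCoeff (n + (a + 2 * β) - 1) (a / 2 + β + 1 / 2)
      (a + β + 1 / 2) p.1 * gaussCoeff (1 - (a / 2 + β) - n) (1 - (a + β) - n) (1 - a - n) p.2 =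
      ((-1) ^ n / poch a n) * ((-1) ^ p.1 * poch (n + (a + 2 * β) - 1) p.1 / p.2.factorial *
      (poch a p.1 * poch (a / 2 + β + 1 / 2) p.1 / (p.1.factorial * poch (a + β) p.1 *
        poch (a + β + 1 / 2) p.1 * poch (a / 2 + β) p.1)) *
          (poch (a / 2 + β) n * poch (a + β) n)) := by
    intro p hp
    rw [gaussCoeff, gaussCoeff, refl a ha p hp, refl _ (by positivity) p hp,
      refl _ (by positivity) p hp, ← mem_antidiagonal.1 hp, pow_add]
    have h1 := (poch_pos ha p.1).ne'
    have h2 := (poch_pos (by positivity : 0 < a / 2 + β) p.1).ne'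
    have h3 := (poch_pos (by positivity : 0 < a + β) p.1).ne'
    have h4 := (poch_pos (by positivity : 0 < a + β + 1 / 2) p.1).ne'
    have h5 : (p.1.factorial : ℝ) ≠ 0 := by positivity
    have h6 : (p.2.factorial : ℝ) ≠ 0 := by positivity
    rw [mem_antidiagonal.1 hp]
    rcases neg_one_pow_eq_or ℝ p.1 with h7 | h7 <;>
    rcases neg_one_pow_eq_or ℝ p.2 with h8 | h8 <;> rw [h7, h8] <;> field_simp
  have e2 : ∀ p ∈ antidiagonal n,
      gaussCoeff (a + β + 1 / 2 - (n + (a + 2 * β) - 1))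
        (a + β + 1 / 2 - (a / 2 + β + 1 / 2)) (a + β + 1 / 2) p.1 *
      gaussCoeff (1 - a - n - (1 - (a / 2 + β) - n)) (1 - a - n - (1 - (a + β) - n))
        (1 - a - n) p.2 =
      ((-1) ^ n / poch a n) * (poch (β - 1 / 2 + p.2) p.1 * (poch (a / 2) p.1 * poch a p.1 /
      (poch (a + β + 1 / 2) p.1 * p.1.factorial)) * (poch (β - a / 2) p.2 * poch β p.2 /
        p.2.factorial)) := by
    intro p hp
    have hn : (n : ℝ) = p.1 + p.2 := by exact_mod_cast (mem_antidiagonal.1 hp).symm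
    rw [gaussCoeff, gaussCoeff, refl a ha p hp,
      show a + β + 1 / 2 - (n + (a + 2 * β) - 1) = 1 - (β - 1 / 2 + p.2) - p.1 by rw [hn]; ring,
      poch_reflect, show a + β + 1 / 2 - (a / 2 + β + 1 / 2) = a / 2 by ring,
      show 1 - a - n - (1 - (a / 2 + β) - n) = β - a / 2 by ring,
      show 1 - a - n - (1 - (a + β) - n) = β by ring]
    have hpow : (-1 : ℝ) ^ n = (-1) ^ p.1 * (-1) ^ p.2 := by
      rw [← pow_add, mem_antidiagonal.1 hp]
    rw [hpow]
    have h1 := (poch_pos ha p.1).ne'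
    have h4 := (poch_pos (by positivity : 0 < a + β + 1 / 2) p.1).ne'
    have h5 : (p.1.factorial : ℝ) ≠ 0 := by positivity
    have h6 : (p.2.factorial : ℝ) ≠ 0 := by positivity
    rcases neg_one_pow_eq_or ℝ p.1 with h7 | h7 <;>
    rcases neg_one_pow_eq_or ℝ p.2 with h8 | h8 <;> rw [h7, h8] <;> field_simp
  rw [sum_congr rfl e1, sum_congr rfl e2, ← mul_sum, ← mul_sum, ← sum_mul] at key
  exact mul_left_cancel₀ (div_ne_zero (by simp) han) key

open Finset in
lemma sears_nonneg {a β : ℝ} (ha : 0 < a) (hβ : a / 2 ≤ β) (h : a ≤ 2 * β * (β + 1 / 2)) (n : ℕ) :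
    0 ≤ ∑ p ∈ antidiagonal n, poch (β - 1 / 2 + p.2) p.1 * (poch (a / 2) p.1 * poch a p.1 /
      (poch (a + β + 1 / 2) p.1 * p.1.factorial)) * (poch (β - a / 2) p.2 * poch β p.2 /
        p.2.factorial) := by
  have hβ0 : 0 < β := by linarith
  have hθ : 0 ≤ β - a / 2 := by linarith
  have term_nonneg : ∀ p : ℕ × ℕ, 0 ≤ β - 1 / 2 + p.2 →
      0 ≤ poch (β - 1 / 2 + p.2) p.1 * (poch (a / 2) p.1 * poch a p.1 /
      (poch (a + β + 1 / 2) p.1 * p.1.factorial)) * (poch (β - a / 2) p.2 * poch β p.2 /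
        p.2.factorial) := by
    intro p hp
    have h1 := poch_nonneg hp p.1
    have h2 := poch_pos (by positivity : 0 < a / 2) p.1
    have h3 := poch_pos ha p.1
    have h4 := poch_pos (by positivity : 0 < a + β + 1 / 2) p.1
    have h5 := poch_nonneg hθ p.2
    have h6 := poch_pos hβ0 p.2
    positivity
  rcases le_or_gt (1 / 2) β with hb | hb
  · refine sum_nonneg fun p _ => term_nonneg p ?_
    have := (Nat.cast_nonneg p.2 : (0 : ℝ) ≤ p.2)
    linarith
  rcases n with _ | m
  · simp
  have key : ∀ m : ℕ, ((1 / 2 - β) * poch (β + 1 / 2) m) *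
      (poch (a / 2) (m + 1) * poch a (m + 1)) ≤
      poch (β - a / 2) (m + 1) * poch β (m + 1) * poch (a + β + 1 / 2) (m + 1) := by
    intro m
    induction m with
    | zero =>
      simp only [poch_succ, poch_zero, Nat.cast_zero, add_zero, one_mul, mul_one]
      have : 0 ≤ (2 * β * (β + 1 / 2) - a) * (a + 2 * β) := mul_nonneg (by linarith) (by linarith)
      nlinarith
    | succ m ih =>
      have hk : (1 : ℝ) ≤ ((m + 1 : ℕ) : ℝ) := by exact_mod_cast Nat.le_add_left 1 m
      rw [poch_succ _ m, poch_succ _ (m + 1), poch_succ _ (m + 1), poch_succ _ (m + 1),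
        poch_succ _ (m + 1), poch_succ _ (m + 1)]
      have e : β + 1 / 2 + (m : ℝ) = β - 1 / 2 + ((m + 1 : ℕ) : ℝ) := by push_cast; ring
      rw [e]
      set k : ℝ := ((m + 1 : ℕ) : ℝ)
      have ha2 : a ≤ 2 * β := by nlinarith
      have step : (β - 1 / 2 + k) * ((a / 2 + k) * (a + k)) ≤
          (β - a / 2 + k) * (β + k) * (a + β + 1 / 2 + k) := by
        have q2 : 0 ≤ k ^ 2 * (2 * β + 1 - a) := mul_nonneg (sq_nonneg k) (by linarith)
        have q1 : 0 ≤ k * ((β - a / 2) * (a + 2 * β + 1 / 2) + β * (a + β + 1 / 2) - a * a / 2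
            + (1 / 2 - β) * (3 * a / 2)) := by
          refine mul_nonneg (by linarith) ?_
          nlinarith [mul_nonneg hθ (by positivity : 0 ≤ a + 2 * β + 1 / 2), mul_pos ha hβ0,
            mul_nonneg (by linarith : 0 ≤ 1 / 2 - β) ha.le]
        have q0 : 0 ≤ (β - a / 2) * β * (a + β + 1 / 2) + (1 / 2 - β) * (a / 2 * a) := by
          have : 0 ≤ 1 / 2 - β := by linarith
          positivity
        nlinarith
      have h1 := poch_pos (by positivity : 0 < β + 1 / 2) m
      have h2 := poch_pos (by positivity : 0 < a / 2) (m + 1)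
      have h3 := poch_pos ha (m + 1)
      have h4 := poch_pos (by positivity : 0 < a + β + 1 / 2) (m + 1)
      have h5 := poch_nonneg hθ (m + 1)
      have h6 := poch_pos hβ0 (m + 1)
      have h7 : 0 < β - 1 / 2 + k := by linarith
      calc _ = ((1 / 2 - β) * poch (β + 1 / 2) m * (poch (a / 2) (m + 1) * poch a (m + 1))) *
            ((β - 1 / 2 + k) * ((a / 2 + k) * (a + k))) := by ring
        _ ≤ (poch (β - a / 2) (m + 1) * poch β (m + 1) * poch (a + β + 1 / 2) (m + 1)) *
            ((β - a / 2 + k) * (β + k) * (a + β + 1 / 2 + k)) := by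
          refine mul_le_mul ih step (by positivity) (by positivity)
        _ = _ := by ring
  have hsub : ({(m + 1, 0), (0, m + 1)} : Finset (ℕ × ℕ)) ⊆ antidiagonal (m + 1) := by
    intro p hp
    simp only [mem_insert, mem_singleton] at hp
    rcases hp with rfl | rfl <;> simp
  refine le_trans ?_ (sum_le_sum_of_subset_of_nonneg hsub fun p hp hp' => term_nonneg p ?_)
  · rw [sum_pair (by simp)]
    simp only [Nat.cast_zero, add_zero, poch_zero, Nat.factorial_zero, Nat.cast_one, one_mul,
      mul_one, div_one]
    rw [poch_succ_left (β - 1 / 2), show β - 1 / 2 + 1 = β + 1 / 2 by ring]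
    have h4 := poch_pos (by positivity : 0 < a + β + 1 / 2) (m + 1)
    have h5 : (0 : ℝ) < (m + 1).factorial := by positivity
    have : (β - 1 / 2) * poch (β + 1 / 2) m * (poch (a / 2) (m + 1) * poch a (m + 1) /
        (poch (a + β + 1 / 2) (m + 1) * (m + 1).factorial)) +
        poch (β - a / 2) (m + 1) * poch β (m + 1) / (m + 1).factorial =
        (poch (β - a / 2) (m + 1) * poch β (m + 1) * poch (a + β + 1 / 2) (m + 1) -
          ((1 / 2 - β) * poch (β + 1 / 2) m) * (poch (a / 2) (m + 1) * poch a (m + 1))) /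
        (poch (a + β + 1 / 2) (m + 1) * (m + 1).factorial) := by
      generalize poch (a + β + 1 / 2) (m + 1) = X at h4 ⊢
      generalize ((m + 1).factorial : ℝ) = Y at h5 ⊢
      generalize poch (β + 1 / 2) m = A
      generalize poch (a / 2) (m + 1) = B
      generalize poch (β - a / 2) (m + 1) = D
      field_simp
      ring
    rw [this]
    exact div_nonneg (sub_nonneg.2 (key m)) (by positivity)
  · have hp1 := mem_antidiagonal.1 hp
    have : 1 ≤ p.2 := by
      by_contra hlt
      apply hp'
      have h2 : p.2 = 0 := by omega
      have h1 : p.1 = m + 1 := by omega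
      simp [Prod.ext_iff, h1, h2]
    have : (1 : ℝ) ≤ p.2 := by exact_mod_cast this
    linarith

open Finset in
/-- The coefficients of the square of the Bessel-type series `₀F₁(; d; X)`. -/
lemma sum_bessel_sq {d : ℝ} (hd : 0 < d) (N : ℕ) :
    ∑ p ∈ antidiagonal N, 1 / (p.1.factorial * poch d p.1) * (1 / (p.2.factorial * poch d p.2)) =
      poch (2 * d + N - 1) N / (N.factorial * poch d N ^ 2) := by
  have hdN := (poch_pos hd N).ne'
  have refl : ∀ p ∈ antidiagonal N, poch (1 - d - N) p.1 = (-1) ^ p.1 * (poch d N / poch d p.2) := by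
    intro p hp
    have hp' := mem_antidiagonal.1 hp
    have h1 := (poch_pos hd p.2).ne'
    rw [← hp', add_comm, poch_add, mul_div_cancel_left₀ _ h1, ← poch_reflect]
    congr 1
    push_cast; ring
  have key := sum_poch_mul_poch (1 - d - N) (1 - d - N) N
  rw [show 1 - d - N + (1 - d - N) = 1 - (2 * d + N - 1) - N by ring, poch_reflect] at key
  have e : ∀ p ∈ antidiagonal N, poch (1 - d - N) p.1 / p.1.factorial *
      (poch (1 - d - N) p.2 / p.2.factorial) = ((-1) ^ N * poch d N ^ 2) *
      (1 / (p.1.factorial * poch d p.1) * (1 / (p.2.factorial * poch d p.2))) := by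
    intro p hp
    have hs := refl p.swap (by simpa [add_comm] using hp)
    simp only [Prod.fst_swap, Prod.snd_swap] at hs
    rw [refl p hp, hs]
    have h1 := (poch_pos hd p.1).ne'
    have h2 := (poch_pos hd p.2).ne'
    rw [show (-1 : ℝ) ^ N = (-1) ^ p.1 * (-1) ^ p.2 by rw [← pow_add, mem_antidiagonal.1 hp]]
    field_simp
  rw [sum_congr rfl e, ← mul_sum] at key
  have hc : (-1 : ℝ) ^ N ≠ 0 := by simp
  have hf : (N.factorial : ℝ) ≠ 0 := by positivity
  rw [eq_div_iff (by positivity)]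
  rw [eq_div_iff hf] at key
  refine mul_left_cancel₀ hc ?_
  rw [← key]; ring

lemma pow_div_factorial_mul_poch_le {d : ℝ} (hd : 1 / 2 ≤ d) {t : ℝ} (ht : 0 ≤ t) (j : ℕ) :
    t ^ j / (j.factorial * poch d j) ≤ (2 * t) ^ j / j.factorial := by
  have h1 : (1 : ℝ) ≤ j.factorial := by exact_mod_cast Nat.one_le_iff_ne_zero.2 j.factorial_ne_zero
  have h2 := le_poch (by norm_num : (0 : ℝ) ≤ 1 / 2) (by norm_num) hd j
  have h3 : (1 / 2 : ℝ) ^ j ≤ poch d j :=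
    le_trans (le_mul_of_one_le_right (by positivity) h1) h2
  have h4 : 0 < poch d j := lt_of_lt_of_le (by positivity) h3
  rw [div_le_div_iff₀ (by positivity) (by positivity)]
  have h5 : (2 * t) ^ j * (1 / 2) ^ j = t ^ j := by rw [← mul_pow]; congr 1; ring
  calc t ^ j * j.factorial = (2 * t) ^ j * (j.factorial * (1 / 2) ^ j) := by rw [← h5]; ring
    _ ≤ (2 * t) ^ j * (j.factorial * poch d j) := by gcongr

lemma poch_two_mul_sub_one_le {d : ℝ} (hd : 1 / 2 < d) (j : ℕ) :
    poch (2 * d + j - 1) j ≤ 4 ^ j * poch d j := by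
  have h0 : 0 < 2 * d - 1 := by linarith
  have h1 := poch_two_mul (d - 1 / 2) j
  rw [show 2 * (d - 1 / 2) = 2 * d - 1 by ring, show d - 1 / 2 + 1 / 2 = d by ring, two_mul j,
    poch_add, show 2 * d - 1 + j = 2 * d + j - 1 by ring] at h1
  have h2 := poch_mono (by linarith : 0 ≤ d - 1 / 2) (by linarith : d - 1 / 2 ≤ 2 * d - 1) j
  have h3 := poch_pos h0 j
  have h4 := poch_pos (by linarith : 0 < d) j
  refine le_of_mul_le_mul_left ?_ h3
  calc _ = (4 ^ j * poch d j) * poch (d - 1 / 2) j := by rw [h1]; ring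
    _ ≤ (4 ^ j * poch d j) * poch (2 * d - 1) j := by gcongr
    _ = _ := by ring

open Finset in
lemma tsum_bessel_sq {d : ℝ} (hd : 1 / 2 < d) {t : ℝ} (ht : 0 ≤ t) :
    ∑' j : ℕ, (-t) ^ j * (poch (2 * d + j - 1) j / (j.factorial * poch d j ^ 2)) =
      (∑' i : ℕ, (-t) ^ i / (i.factorial * poch d i)) ^ 2 := by
  have hd0 : 0 < d := by linarith
  have hs : Summable fun i : ℕ => ‖(-t) ^ i / (i.factorial * poch d i)‖ := by
    refine Summable.of_nonneg_of_le (fun _ => norm_nonneg _) (fun i => ?_)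
      (Real.summable_pow_div_factorial (2 * t))
    have := poch_pos hd0 i
    rw [norm_div, norm_pow, norm_neg, Real.norm_of_nonneg ht, Real.norm_of_nonneg (by positivity)]
    exact pow_div_factorial_mul_poch_le hd.le ht i
  rw [sq, tsum_mul_tsum_eq_tsum_sum_antidiagonal_of_summable_norm hs hs]
  refine tsum_congr fun j => ?_
  rw [← sum_bessel_sq hd0, mul_sum]
  refine sum_congr rfl fun p hp => ?_
  rw [← mem_antidiagonal.1 hp, pow_add]
  ring

open Finset in
lemma tsum_sum_antidiagonal_eq {g : ℕ × ℕ → ℝ} (hg : Summable g) :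
    ∑' N, ∑ p ∈ antidiagonal N, g p = ∑' n, ∑' j, g (n, j) := by
  let e : (Σ n : ℕ, antidiagonal n) ≃ ℕ × ℕ := HasAntidiagonal.sigmaAntidiagonalEquivProd
  rw [← hg.tsum_prod, ← Equiv.tsum_eq e g, (e.summable_iff.2 hg).tsum_sigma (f := fun c => g (e c))]
  refine tsum_congr fun N => ?_
  rw [tsum_fintype, ← sum_coe_sort]
  rfl

open Finset in
lemma tsum_squares_nonneg {t : ℝ} (ht : 0 ≤ t) {C d : ℕ → ℝ} (hC : ∀ n, 0 ≤ C n) {A K : ℝ}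
    (hCK : ∀ n, C n ≤ A * (K ^ n / n.factorial)) (hd : ∀ n, 1 / 2 < d n) :
    0 ≤ ∑' N, ∑ p ∈ antidiagonal N, C p.1 * ((-t) ^ p.2 *
      (poch (2 * d p.1 + p.2 - 1) p.2 / (p.2.factorial * poch (d p.1) p.2 ^ 2))) := by
  have hsum : Summable fun p : ℕ × ℕ => C p.1 * ((-t) ^ p.2 *
      (poch (2 * d p.1 + p.2 - 1) p.2 / (p.2.factorial * poch (d p.1) p.2 ^ 2))) := by
    have h1 : Summable C := Summable.of_nonneg_of_le hC hCK
      ((Real.summable_pow_div_factorial K).mul_left A)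
    have h2 := Real.summable_pow_div_factorial (2 * (4 * t))
    refine Summable.of_norm_bounded (h1.mul_of_nonneg h2 hC fun j => by positivity) fun p => ?_
    have hd0 : 0 < d p.1 := by linarith [hd p.1]
    have h3 := poch_pos hd0 p.2
    have h4 : 0 ≤ poch (2 * d p.1 + p.2 - 1) p.2 := poch_nonneg (by
      have := hd p.1
      have := (Nat.cast_nonneg p.2 : (0 : ℝ) ≤ p.2)
      linarith) _
    rw [norm_mul, norm_mul, norm_pow, norm_neg, Real.norm_of_nonneg ht,
      Real.norm_of_nonneg (hC p.1), Real.norm_of_nonneg (by positivity)]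
    refine mul_le_mul_of_nonneg_left ?_ (hC p.1)
    refine le_trans ?_ (pow_div_factorial_mul_poch_le (hd p.1).le (by positivity : 0 ≤ 4 * t) p.2)
    calc _ ≤ t ^ p.2 * ((4 ^ p.2 * poch (d p.1) p.2) / (p.2.factorial * poch (d p.1) p.2 ^ 2)) := by
          gcongr
          exact poch_two_mul_sub_one_le (hd p.1) p.2
      _ = _ := by rw [mul_pow]; field_simp
  rw [tsum_sum_antidiagonal_eq hsum]
  refine tsum_nonneg fun n => ?_
  dsimp only
  rw [tsum_mul_left, tsum_bessel_sq (hd n) ht]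
  exact mul_nonneg (hC n) (sq_nonneg _)

lemma factorial_add_le (n k : ℕ) :
    ((n + k).factorial : ℝ) ≤ 2 ^ (n + k) * n.factorial * k.factorial := by
  have h := Nat.choose_le_two_pow (n + k) k
  have h2 := Nat.add_choose_mul_factorial_mul_factorial n k
  have : (n + k).factorial ≤ 2 ^ (n + k) * n.factorial * k.factorial := by
    rw [← h2]; gcongr
  exact_mod_cast this

lemma wellPoised_mul_abs_poch_le {y : ℝ} (hy : 0 < y) {n k : ℕ} (hk : k ≤ n) :
    wellPoised y n * |poch (n + y - 1) k| ≤
      2 * (4 * (y + 1) ^ 2) ^ n * n.factorial * k.factorial := by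
  rcases n with _ | n
  · obtain rfl : k = 0 := by omega
    simp [wellPoised]
  have hn := (Nat.cast_nonneg n : (0 : ℝ) ≤ n)
  rw [← abs_of_pos (wellPoised_pos hy (n + 1)), ← abs_mul, wellPoised_succ_mul, abs_of_pos
    (mul_pos (by linarith) (poch_pos hy _))]
  have h1 := poch_le hy.le (by linarith : 1 ≤ y + 1) (by linarith) (n + k)
  have h2 : y - 1 + 2 * ((n : ℝ) + 1) ≤ 2 * (y + 1) * (n + 1 + k) := by
    have := (Nat.cast_nonneg k : (0 : ℝ) ≤ k)
    nlinarith [mul_nonneg hy.le hn, mul_nonneg hy.le this]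
  have h3 := factorial_add_le (n + 1) k
  have h4 : ((n + 1 + k).factorial : ℝ) = (n + 1 + k) * (n + k).factorial := by
    rw [show n + 1 + k = n + k + 1 by ring, Nat.factorial_succ]; push_cast; ring
  have hR : (2 * (y + 1)) ^ (n + 1 + k) ≤ (2 * (y + 1)) ^ (2 * (n + 1)) :=
    pow_le_pow_right₀ (by linarith) (by omega)
  calc _ ≤ (2 * (y + 1) * (n + 1 + k)) * ((y + 1) ^ (n + k) * (n + k).factorial) := by
        gcongr
        exact (poch_pos hy _).le
    _ = 2 * (y + 1) ^ (n + 1 + k) * (n + 1 + k).factorial := by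
        rw [h4, show n + 1 + k = n + k + 1 by ring, pow_succ (y + 1)]; ring
    _ ≤ 2 * (y + 1) ^ (n + 1 + k) * (2 ^ (n + 1 + k) * (n + 1).factorial * k.factorial) := by
        gcongr
    _ = 2 * (2 * (y + 1)) ^ (n + 1 + k) * ((n + 1).factorial * k.factorial) := by
        rw [mul_pow 2 (y + 1)]; ring
    _ ≤ 2 * (2 * (y + 1)) ^ (2 * (n + 1)) * ((n + 1).factorial * k.factorial) := by gcongr
    _ = _ := by rw [pow_mul, mul_pow 2 (y + 1)]; norm_num; ring

open Finset in
lemma wellPoised_mul_sum_le {y r : ℝ} (hy : 0 < y) (hr : 0 < r) (hr1 : r ≤ 1) {δ : ℕ → ℝ}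
    (hδ : ∀ k, |δ k| ≤ 1 / (k.factorial * (r ^ k * k.factorial))) (n : ℕ) :
    wellPoised y n * ∑ p ∈ antidiagonal n, (-1) ^ p.1 * poch (n + y - 1) p.1 / p.2.factorial * δ p.1
      ≤ 2 * (8 * (y + 1) ^ 2 / r) ^ n := by
  have h2n : ∑ p ∈ antidiagonal n, (n.factorial : ℝ) / (p.1.factorial * p.2.factorial) = 2 ^ n := by
    rw [← one_add_one_eq_two, (Commute.all (1 : ℝ) 1).add_pow']
    refine sum_congr rfl fun p hp => ?_
    rw [← mem_antidiagonal.1 hp, Nat.choose_symm_add, ← Nat.add_choose_mul_factorial_mul_factorial]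
    simp only [one_pow, mul_one, nsmul_eq_mul]
    push_cast
    field_simp
  calc _ ≤ ∑ p ∈ antidiagonal n, 2 * (4 * (y + 1) ^ 2 / r) ^ n *
        (n.factorial / (p.1.factorial * p.2.factorial)) := by
        rw [mul_sum]
        refine sum_le_sum fun p hp => ?_
        have hp' := mem_antidiagonal.1 hp
        have hk : p.1 ≤ n := by omega
        have hrk : r ^ n ≤ r ^ p.1 := pow_le_pow_of_le_one hr.le hr1 hk
        refine (le_abs_self _).trans ?_
        rw [abs_mul, abs_mul, abs_div, abs_mul, abs_pow, abs_neg, abs_one, one_pow, one_mul,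
          abs_of_pos (wellPoised_pos hy n), Nat.abs_cast]
        calc _ = (wellPoised y n * |poch (n + y - 1) p.1|) / p.2.factorial * |δ p.1| := by ring
          _ ≤ (2 * (4 * (y + 1) ^ 2) ^ n * n.factorial * p.1.factorial) / p.2.factorial *
              (1 / (p.1.factorial * (r ^ n * p.1.factorial))) := by
            refine mul_le_mul ?_ ((hδ p.1).trans (by gcongr)) (abs_nonneg _) (by positivity)
            exact div_le_div_of_nonneg_right (wellPoised_mul_abs_poch_le hy hk) (by positivity)
          _ = _ := by rw [div_pow]; field_simp
    _ = _ := by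
        rw [← mul_sum, h2n, mul_assoc, ← mul_pow]
        congr 2
        ring

/-- Positivity of a `₁F₂` on the negative half-line, as a sum of squares of Bessel-type series. -/
lemma hypergeometric_nonneg {a β : ℝ} (ha : 0 < a) (hβ : a / 2 ≤ β)
    (h : a ≤ 2 * β * (β + 1 / 2)) (z : ℝ) :
    0 ≤ ∑' N : ℕ, poch a N / (N.factorial * poch (2 * (a + β)) (2 * N)) * z ^ N := by
  have hβ0 : 0 < β := by linarith
  rcases le_or_gt 0 z with hz | hz
  · refine tsum_nonneg fun N => ?_
    have := poch_pos ha N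
    have := poch_pos (by positivity : 0 < 2 * (a + β)) (2 * N)
    positivity
  obtain ⟨t, ht, rfl⟩ : ∃ t : ℝ, 0 ≤ t ∧ z = -16 * t := ⟨-z / 16, by linarith, by ring⟩
  obtain ⟨y, hy⟩ : ∃ y, y = a + 2 * β := ⟨_, rfl⟩
  have hy0 : 0 < y := by rw [hy]; positivity
  have hyh : a / 2 + β = y / 2 := by rw [hy]; ring
  let δ : ℕ → ℝ := fun p => poch a p * poch (y / 2 + 1 / 2) p / (p.factorial * poch (a + β) p *
        poch (a + β + 1 / 2) p * poch (y / 2) p)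
  let S : ℕ → ℝ := fun n => ∑ p ∈ Finset.HasAntidiagonal.antidiagonal n,
      (-1) ^ p.1 * poch (n + y - 1) p.1 / p.2.factorial * δ p.1
  have hw := wellPoised_pos hy0
  have hS : ∀ n, 0 ≤ S n := fun n => by
    have h1 := sears_transformation ha hβ0 n
    have h2 := sears_nonneg ha hβ h n
    have h3 := poch_pos (by positivity : 0 < a / 2 + β) n
    have h4 := poch_pos (by positivity : 0 < a + β) n
    have h5 := div_nonneg h2 (mul_pos h3 h4).le
    rw [← h1, ← hy, hyh] at h5
    exact h5
  have hp : ∀ n, 0 < poch (y / 2 + 1 / 2) n := poch_pos (by positivity)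
  have hph : ∀ n, 0 < poch (y / 2) n := poch_pos (by positivity)
  have hpa : ∀ n, 0 < poch a n := poch_pos ha
  have hpa1 : ∀ n, 0 < poch (a + β) n := poch_pos (by positivity)
  have hpa2 : ∀ n, 0 < poch (a + β + 1 / 2) n := poch_pos (by positivity)
  have hpy : ∀ n, 0 < poch y n := poch_pos hy0
  obtain ⟨r, hr0, hr1, hry⟩ : ∃ r : ℝ, 0 < r ∧ r ≤ 1 ∧ r ≤ y / 2 :=
    ⟨min 1 (y / 2), by positivity, min_le_left _ _, min_le_right _ _⟩
  have hδ : ∀ k, |δ k| ≤ 1 / (k.factorial * (r ^ k * k.factorial)) := fun k => by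
    have h1 := hp k
    have h2 := hph k
    have h3 := hpa k
    have h4 := hpa1 k
    have h5 := hpa2 k
    have h6 := le_poch hr0.le hr1 hry k
    have h7 := poch_mono ha.le (by linarith : a ≤ a + β) k
    have h8 := poch_mono (by positivity) (by linarith : y / 2 + 1 / 2 ≤ a + β + 1 / 2) k
    rw [abs_of_pos (by positivity)]
    calc δ k ≤ poch (a + β) k * poch (a + β + 1 / 2) k / (k.factorial * poch (a + β) k *
        poch (a + β + 1 / 2) k * poch (y / 2) k) := by simp only [δ]; gcongr
      _ = 1 / (k.factorial * poch (y / 2) k) := by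
        generalize poch (a + β + 1 / 2) k = X at h5 ⊢
        field_simp
      _ ≤ _ := by gcongr
  have hCS : ∀ n, wellPoised y n * S n ≤ 2 * (8 * (y + 1) ^ 2 / r) ^ n :=
    wellPoised_mul_sum_le hy0 hr0 hr1 hδ
  let C : ℕ → ℝ := fun n => wellPoised y n * S n / poch (y / 2 + 1 / 2) n ^ 2 * t ^ n
  have hC : ∀ n, 0 ≤ C n := fun n => by
    have := hw n
    have := hS n
    positivity
  have hCK : ∀ n, C n ≤ 2 * ((32 * (y + 1) ^ 2 / r * t) ^ n / n.factorial) := fun n => by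
    have h1 := le_poch (by norm_num : (0 : ℝ) ≤ 1 / 2) (by norm_num)
      (by linarith : 1 / 2 ≤ y / 2 + 1 / 2) n
    have h2 : (1 : ℝ) ≤ n.factorial := by
      exact_mod_cast Nat.one_le_iff_ne_zero.2 n.factorial_ne_zero
    have h3 : ((1 / 2 : ℝ) ^ n) ^ 2 * n.factorial ≤ poch (y / 2 + 1 / 2) n ^ 2 :=
      calc _ ≤ ((1 / 2 : ℝ) ^ n) ^ 2 * (n.factorial * n.factorial) := by
            gcongr; exact le_mul_of_one_le_left (by positivity) h2
        _ = ((1 / 2 : ℝ) ^ n * n.factorial) ^ 2 := by ring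
        _ ≤ _ := by gcongr
    calc C n ≤ 2 * (8 * (y + 1) ^ 2 / r) ^ n / (((1 / 2 : ℝ) ^ n) ^ 2 * n.factorial) * t ^ n := by
          exact mul_le_mul_of_nonneg_right (div_le_div₀ (by positivity) (hCS n) (by positivity) h3)
            (by positivity)
      _ = _ := by
        have e : (32 * (y + 1) ^ 2 / r * t) ^ n = (8 * (y + 1) ^ 2 / r) ^ n * t ^ n * 4 ^ n := by
          rw [← mul_pow, ← mul_pow]; congr 1; ring
        have e2 : ((1 / 2 : ℝ) ^ n) ^ 2 = 1 / 4 ^ n := by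
          rw [← pow_mul, mul_comm, pow_mul, ← one_div_pow]; norm_num
        rw [e, e2]; field_simp
  have key := tsum_squares_nonneg ht hC hCK (d := fun n => y / 2 + 1 / 2 + n)
    fun n => by have := (Nat.cast_nonneg n : (0 : ℝ) ≤ n); linarith
  convert key using 3 with N
  have hB := bailey_inversion hy0 δ S (fun _ => rfl) N
  have e1 : poch a N / (N.factorial * poch (2 * (a + β)) (2 * N)) * (-16 * t) ^ N =
      ((-4 * t) ^ N * poch (y / 2) N / poch (y / 2 + 1 / 2) N) * δ N := by
    have h1 := hp N
    have h2 := hph N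
    have h4 := hpa1 N
    have h5 := hpa2 N
    rw [poch_two_mul, show -16 * t = 4 * (-4 * t) by ring, mul_pow 4 (-4 * t)]
    simp only [δ]
    generalize poch (y / 2 + 1 / 2) N = A at *
    generalize poch (y / 2) N = A2 at *
    generalize poch (a + β + 1 / 2) N = A3 at *
    generalize poch (a + β) N = A4 at *
    field_simp
  rw [e1, ← hB, Finset.mul_sum]
  refine Finset.sum_congr rfl fun p hpN => ?_
  obtain ⟨n, j⟩ := p
  obtain rfl := Finset.HasAntidiagonal.mem_antidiagonal.1 hpN
  dsimp only [C]
  have h1 := poch_two_mul (y / 2) (n + j)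
  rw [show 2 * (y / 2) = y by ring, show 2 * (n + j) = 2 * n + j + j by ring, poch_add,
    poch_add (y / 2 + 1 / 2)] at h1
  rw [poch_add (y / 2 + 1 / 2), show 2 * (y / 2 + 1 / 2 + (n : ℝ)) + j - 1 =
    y + ((2 * n + j : ℕ) : ℝ) by push_cast; ring]
  have h2 := hpy (2 * n + j)
  have h3 := hp n
  have h4 : 0 < poch (y / 2 + 1 / 2 + n) j := poch_pos (by positivity) j
  have h5 := hph (n + j)
  have h6 : poch (y + ((2 * n + j : ℕ) : ℝ)) j = 4 ^ (n + j) * poch (y / 2) (n + j) *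
      (poch (y / 2 + 1 / 2) n * poch (y / 2 + 1 / 2 + n) j) / poch y (2 * n + j) := by
    rw [eq_div_iff h2.ne', ← h1]; ring
  have h7 : (-4 * t) ^ (n + j) * (-1) ^ n = 4 ^ (n + j) * t ^ n * (-t) ^ j := by
    rw [show -4 * t = 4 * (-t) by ring, mul_pow, pow_add (-t), neg_pow t n]
    have : (-1 : ℝ) ^ n * (-1) ^ n = 1 := by rw [← mul_pow]; norm_num
    linear_combination 4 ^ (n + j) * t ^ n * (-t) ^ j * this
  rw [h6]
  generalize poch (y / 2 + 1 / 2 + n) j = A1 at *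
  generalize poch (y / 2 + 1 / 2) n = A2 at *
  generalize poch (y / 2) (n + j) = A3 at *
  generalize poch y (2 * n + j) = A4 at *
  generalize wellPoised y n * S n = W at *
  have e : (-4 * t) ^ (n + j) * A3 / (A2 * A1) * ((-1) ^ n * W / (j.factorial * A4)) =
      ((-4 * t) ^ (n + j) * (-1) ^ n) * (A3 / (A2 * A1) * (W / (j.factorial * A4))) := by ring
  rw [e, h7]
  field_simp

/-- `b` is the coefficient sequence of an entire function that is non-negative on `ℝ`. -/
def NonnegEntire (b : ℕ → ℝ) : Prop :=
  (∀ z : ℝ, Summable fun n => b n * z ^ n) ∧ ∀ z : ℝ, 0 ≤ ∑' n, b n * z ^ n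

namespace NonnegEntire

lemma scale {b : ℕ → ℝ} (hb : NonnegEntire b) {K : ℝ} (hK : 0 ≤ K) (l : ℝ) :
    NonnegEntire fun n => b n * (K * l ^ n) := by
  have e : ∀ z : ℝ, (fun n => b n * (K * l ^ n) * z ^ n) = fun n => K * (b n * (l * z) ^ n) :=
    fun z => by ext n; rw [mul_pow]; ring
  constructor
  · intro z
    rw [e]
    exact (hb.1 _).mul_left K
  · intro z
    rw [e, tsum_mul_left]
    exact mul_nonneg hK (hb.2 _)

open MeasureTheory Set in
/-- `∑ bₙ zⁿ / (n + d)` is the integral of `u ^ (d - 1) ∑ bₙ (z u)ⁿ` over `0 < u ≤ 1`. -/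
lemma tsum_div_nonneg {b : ℕ → ℝ} (hb : NonnegEntire b) {d : ℝ} (hd : 0 < d) (z : ℝ) :
    0 ≤ ∑' n : ℕ, b n * z ^ n / (n + d) := by
  have hs : ∀ n : ℕ, -1 < (n : ℝ) + d - 1 := fun n => by
    have := (Nat.cast_nonneg n : (0 : ℝ) ≤ n); linarith
  have hmom : ∀ n : ℕ, ∫ u in Ioc (0 : ℝ) 1, u ^ ((n : ℝ) + d - 1) = 1 / (n + d) := fun n => by
    have : (n : ℝ) + d ≠ 0 := by positivity
    rw [← intervalIntegral.integral_of_le zero_le_one, integral_rpow (Or.inl (hs n))]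
    simp [this]
  have hI : ∀ n : ℕ, IntegrableOn (fun u : ℝ => u ^ ((n : ℝ) + d - 1)) (Ioc 0 1) := fun n =>
    (intervalIntegrable_iff_integrableOn_Ioc_of_le zero_le_one).1
      (intervalIntegral.intervalIntegrable_rpow' (hs n))
  have hsum : Summable fun n : ℕ =>
      ∫ u in Ioc (0 : ℝ) 1, ‖b n * z ^ n * u ^ ((n : ℝ) + d - 1)‖ := by
    have e : ∀ n : ℕ, ∫ u in Ioc (0 : ℝ) 1, ‖b n * z ^ n * u ^ ((n : ℝ) + d - 1)‖ =
        ‖b n * z ^ n‖ * (1 / (n + d)) := fun n => by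
      rw [← hmom, ← integral_const_mul]
      refine setIntegral_congr_fun measurableSet_Ioc fun u hu => ?_
      simp only [norm_mul, Real.norm_of_nonneg (Real.rpow_nonneg hu.1.le _)]
    simp only [e]
    refine Summable.of_nonneg_of_le (fun n => by positivity) (fun n => ?_)
      ((hb.1 z).norm.mul_right (1 / d))
    have := (Nat.cast_nonneg n : (0 : ℝ) ≤ n)
    gcongr
    linarith
  have key := hasSum_integral_of_summable_integral_norm
    (F := fun (n : ℕ) (u : ℝ) => b n * z ^ n * u ^ ((n : ℝ) + d - 1))
    (μ := volume.restrict (Ioc (0 : ℝ) 1)) (fun n => (hI n).const_mul _) hsum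
  simp only [integral_const_mul, hmom, mul_one_div] at key
  rw [key.tsum_eq]
  refine setIntegral_nonneg measurableSet_Ioc fun u hu => ?_
  have e : ∀ n : ℕ, b n * z ^ n * u ^ ((n : ℝ) + d - 1) = u ^ (d - 1) * (b n * (z * u) ^ n) :=
    fun n => by
      rw [add_sub_assoc, Real.rpow_add hu.1, Real.rpow_natCast, mul_pow]; ring
  simp only [e, tsum_mul_left]
  exact mul_nonneg (Real.rpow_nonneg hu.1.le _) (hb.2 _)

lemma mul_add_div {b : ℕ → ℝ} (hb : NonnegEntire b) {p q d : ℝ} (hp : 0 ≤ p) (hq : 0 ≤ q)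
    (hd : 0 < d) : NonnegEntire fun n => b n * (p + q / (n + d)) := by
  have h1 : ∀ z : ℝ, Summable fun n : ℕ => b n * z ^ n / (n + d) := fun z => by
    refine Summable.of_norm_bounded ((hb.1 z).norm.mul_right (1 / d)) fun n => ?_
    have := (Nat.cast_nonneg n : (0 : ℝ) ≤ n)
    rw [norm_div, Real.norm_of_nonneg (by positivity : 0 ≤ (n : ℝ) + d), div_eq_mul_one_div]
    gcongr
    linarith
  have e : ∀ z : ℝ, (fun n : ℕ => b n * (p + q / (n + d)) * z ^ n) =
      fun n : ℕ => p * (b n * z ^ n) + q * (b n * z ^ n / (n + d)) := fun z => by ext n; ring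
  constructor
  · intro z
    rw [e]
    exact ((hb.1 z).mul_left p).add ((h1 z).mul_left q)
  · intro z
    rw [e, ((hb.1 z).mul_left p).tsum_add ((h1 z).mul_left q), tsum_mul_left, tsum_mul_left]
    exact add_nonneg (mul_nonneg hp (hb.2 z)) (mul_nonneg hq (hb.tsum_div_nonneg hd z))

lemma mul_prod {b : ℕ → ℝ} (hb : NonnegEntire b) {p : ℝ} {q d : ℕ → ℝ} (hp : 0 ≤ p)
    (hq : ∀ j, 0 ≤ q j) (hd : ∀ j, 0 < d j) (N : ℕ) :
    NonnegEntire fun n => b n * ∏ j ∈ Finset.range N, (p + q j / (n + d j)) := by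
  induction N with
  | zero => simpa using hb
  | succ N ih =>
    simp only [Finset.prod_range_succ, ← mul_assoc]
    exact ih.mul_add_div hp (hq N) (hd N)

open Filter Topology in
lemma tsum_nonneg_of_tendsto {b : ℕ → ℕ → ℝ} {B D : ℕ → ℝ} (hb : ∀ N, NonnegEntire (b N))
    (hB : ∀ n, Tendsto (fun N => b N n) atTop (𝓝 (B n))) (hD : ∀ N n, |b N n| ≤ D n) {z : ℝ}
    (hz : Summable fun n => D n * |z| ^ n) : 0 ≤ ∑' n, B n * z ^ n := by
  refine ge_of_tendsto' (tendsto_tsum_of_dominated_convergence hz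
    (fun n => (hB n).mul_const (z ^ n)) (Eventually.of_forall fun N n => ?_)) fun N => (hb N).2 z
  rw [norm_mul, norm_pow, Real.norm_eq_abs, Real.norm_eq_abs]
  exact mul_le_mul_of_nonneg_right (hD N n) (by positivity)

end NonnegEntire

open Finset in
/-- Euler's product approximation of `Γ(s) / Γ(t)`. -/
noncomputable def gammaRatioSeq (s t : ℝ) (N : ℕ) : ℝ :=
  (N : ℝ) ^ (s - t) * ∏ j ∈ range (N + 1), (t + j) / (s + j)

open Filter Topology in
lemma tendsto_gammaRatioSeq {s t : ℝ} (hs : 0 < s) (ht : 0 < t) :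
    Tendsto (gammaRatioSeq s t) atTop (𝓝 (Real.Gamma s / Real.Gamma t)) := by
  refine ((Real.GammaSeq_tendsto_Gamma s).div (Real.GammaSeq_tendsto_Gamma t)
    (Real.Gamma_pos_of_pos ht).ne').congr' ?_
  filter_upwards [eventually_gt_atTop 0] with N hN
  have hN' : (0 : ℝ) < N := by exact_mod_cast hN
  have h1 : 0 < ∏ j ∈ Finset.range (N + 1), (s + j) := Finset.prod_pos fun j _ => by positivity
  have h2 : 0 < ∏ j ∈ Finset.range (N + 1), (t + j) := Finset.prod_pos fun j _ => by positivity
  have h3 : 0 < (N : ℝ) ^ t := Real.rpow_pos_of_pos hN' t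
  simp only [Pi.div_apply, Real.GammaSeq, gammaRatioSeq, Finset.prod_div_distrib,
    Real.rpow_sub hN']
  field_simp

lemma gammaRatioSeq_nonneg {s t : ℝ} (hs : 0 < s) (ht : 0 < t) (N : ℕ) :
    0 ≤ gammaRatioSeq s t N :=
  mul_nonneg (by positivity) (Finset.prod_nonneg fun j _ => by positivity)

lemma monotone_gammaRatioSeq {s t : ℝ} (ht : 0 < t) (hts : t ≤ s) :
    Monotone (gammaRatioSeq s t) := by
  have hs : 0 < s := ht.trans_le hts
  refine monotone_nat_of_le_succ fun N => ?_
  have hprod : 0 ≤ ∏ j ∈ Finset.range (N + 1), (t + j) / (s + j) :=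
    Finset.prod_nonneg fun j _ => by positivity
  have key : (N : ℝ) ^ (s - t) * (s + (N + 1 : ℕ)) ≤
      ((N + 1 : ℕ) : ℝ) ^ (s - t) * (t + (N + 1 : ℕ)) := by
    rcases Nat.eq_zero_or_pos N with rfl | hN
    · rcases hts.eq_or_lt with rfl | h
      · simp
      · rw [Nat.cast_zero, Real.zero_rpow (by linarith)]
        simp; linarith
    have hN' : (0 : ℝ) < N := by exact_mod_cast hN
    have hx : 0 ≤ s - t := by linarith
    push_cast
    have h1 : 1 + (s - t) / (N + 1) ≤ (((N : ℝ) + 1) / N) ^ (s - t) := by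
      have h2 := Real.one_sub_inv_le_log_of_pos (by positivity : 0 < ((N : ℝ) + 1) / N)
      have h3 : 1 - (((N : ℝ) + 1) / N)⁻¹ = 1 / (N + 1) := by field_simp; ring
      rw [h3] at h2
      rw [Real.rpow_def_of_pos (by positivity)]
      refine le_trans ?_ (Real.add_one_le_exp _)
      have := mul_le_mul_of_nonneg_right h2 hx
      rw [div_eq_mul_one_div]
      linarith
    rw [Real.div_rpow (by positivity) hN'.le, le_div_iff₀ (by positivity)] at h1
    have h4 : (s + (N + 1)) ≤ (1 + (s - t) / (N + 1)) * (t + (N + 1)) := by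
      have : 0 ≤ (s - t) / (N + 1) * t := by positivity
      have h5 : (s - t) / (N + 1) * (N + 1) = s - t := by field_simp
      nlinarith
    calc (N : ℝ) ^ (s - t) * (s + (N + 1)) ≤
          (N : ℝ) ^ (s - t) * ((1 + (s - t) / (N + 1)) * (t + (N + 1))) := by gcongr
      _ = (1 + (s - t) / (N + 1)) * (N : ℝ) ^ (s - t) * (t + (N + 1)) := by ring
      _ ≤ _ := by gcongr
  have hsN : 0 < s + (N + 1 : ℕ) := by positivity
  rw [gammaRatioSeq, gammaRatioSeq, Finset.prod_range_succ _ (N + 1)]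
  calc _ = (N : ℝ) ^ (s - t) * (s + (N + 1 : ℕ)) / (s + (N + 1 : ℕ)) *
        ∏ j ∈ Finset.range (N + 1), (t + j) / (s + j) := by field_simp
    _ ≤ ((N + 1 : ℕ) : ℝ) ^ (s - t) * (t + (N + 1 : ℕ)) / (s + (N + 1 : ℕ)) *
        ∏ j ∈ Finset.range (N + 1), (t + j) / (s + j) := by gcongr
    _ = _ := by ring

namespace NonnegEntire

open Filter Topology in
lemma mul_gamma_ratio {b : ℕ → ℝ} (hb : NonnegEntire b) (hb0 : ∀ n, 0 ≤ b n) {γ m : ℝ}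
    (hγ : 0 < γ) (hm : γ ≤ m) :
    NonnegEntire fun n => b n * (Real.Gamma (γ + n) / Real.Gamma (m + n)) := by
  have hm0 : 0 < m := hγ.trans_le hm
  have hle : ∀ N n : ℕ, gammaRatioSeq (γ + n) (m + n) N ≤ gammaRatioSeq γ m N := fun N n => by
    simp only [gammaRatioSeq, add_sub_add_right_eq_sub]
    refine mul_le_mul_of_nonneg_left (Finset.prod_le_prod (fun j _ => by positivity) fun j _ => ?_)
      (by positivity)
    have : 0 ≤ (n : ℝ) * (m - γ) := mul_nonneg (by positivity) (by linarith)
    rw [div_le_div_iff₀ (by positivity) (by positivity)]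
    nlinarith
  obtain ⟨K, hK⟩ := (tendsto_gammaRatioSeq hγ hm0).bddAbove_range
  have hK' : ∀ N, gammaRatioSeq γ m N ≤ K := fun N => hK ⟨N, rfl⟩
  have hlim : ∀ n : ℕ, Tendsto (fun N => b n * gammaRatioSeq (γ + n) (m + n) N) atTop
      (𝓝 (b n * (Real.Gamma (γ + n) / Real.Gamma (m + n)))) := fun n =>
    (tendsto_gammaRatioSeq (by positivity) (by positivity)).const_mul _
  have hD : ∀ N n : ℕ, |b n * gammaRatioSeq (γ + n) (m + n) N| ≤ b n * K := fun N n => by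
    rw [abs_of_nonneg (mul_nonneg (hb0 n)
      (gammaRatioSeq_nonneg (by positivity) (by positivity) N))]
    exact mul_le_mul_of_nonneg_left ((hle N n).trans (hK' N)) (hb0 n)
  have hsum : ∀ z : ℝ, Summable fun n => b n * K * |z| ^ n := fun z => by
    simpa only [mul_right_comm] using (hb.1 |z|).mul_right K
  constructor
  · intro z
    refine Summable.of_norm_bounded (hsum z) fun n => ?_
    rw [norm_mul, norm_pow, Real.norm_eq_abs, Real.norm_eq_abs]
    exact mul_le_mul_of_nonneg_right (le_of_tendsto' (hlim n).abs fun N => hD N n) (by positivity)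
  · intro z
    refine tsum_nonneg_of_tendsto (fun N => ?_) hlim hD (hsum z)
    have h1 := (hb.mul_prod (p := 1) (q := fun _ => m - γ) (d := fun j => γ + j) zero_le_one
      (fun _ => by linarith) (fun j => by positivity) (N + 1)).scale
      (K := (N : ℝ) ^ (γ - m)) (by positivity) 1
    convert h1 using 2 with n
    rw [one_pow, mul_one, gammaRatioSeq, add_sub_add_right_eq_sub, mul_comm ((N : ℝ) ^ (γ - m)),
      mul_assoc]
    congr 2
    refine Finset.prod_congr rfl fun j _ => ?_
    have : (n : ℝ) + (γ + j) ≠ 0 := by positivity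
    have : γ + n + j ≠ 0 := by positivity
    field_simp
    ring

open Filter Topology in
lemma tsum_mul_gamma_ratio_nonneg {b : ℕ → ℝ} (hb : NonnegEntire b) (hb0 : ∀ n, 0 ≤ b n)
    {τ σ m : ℝ} (hτ : 0 < τ) (hσ : 0 < σ) (hσ1 : σ ≤ 1) (hm : 0 < m) (z : ℝ) :
    0 ≤ ∑' n : ℕ, b n * (Real.Gamma (τ * (n + m)) / Real.Gamma (σ * (τ * (n + m)))) * z ^ n := by
  have hs : ∀ n : ℕ, 0 < τ * ((n : ℝ) + m) := fun n => by positivity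
  have ht : ∀ n : ℕ, 0 < σ * (τ * ((n : ℝ) + m)) := fun n => by positivity
  by_cases hsum : Summable fun n : ℕ =>
    b n * (Real.Gamma (τ * (n + m)) / Real.Gamma (σ * (τ * (n + m)))) * z ^ n
  swap
  · rw [tsum_eq_zero_of_not_summable hsum]
  have hlim := fun n : ℕ => tendsto_gammaRatioSeq (hs n) (ht n)
  have hle : ∀ N n : ℕ, gammaRatioSeq (τ * (n + m)) (σ * (τ * (n + m))) N ≤
      Real.Gamma (τ * (n + m)) / Real.Gamma (σ * (τ * (n + m))) := fun N n =>
    (monotone_gammaRatioSeq (ht n) (mul_le_of_le_one_left (hs n).le hσ1)).ge_of_tendsto (hlim n) N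
  refine tsum_nonneg_of_tendsto
    (b := fun N n => b n * gammaRatioSeq (τ * (n + m)) (σ * (τ * (n + m))) (N + 1))
    (fun N => ?_) (fun n => ((tendsto_add_atTop_iff_nat 1).2 (hlim n)).const_mul _)
    (fun N n => ?_) ?_ (D := fun n =>
      b n * (Real.Gamma (τ * (n + m)) / Real.Gamma (σ * (τ * (n + m)))))
  · have h1 := (hb.mul_prod (p := σ) (q := fun j => (1 - σ) * j / τ) (d := fun j => m + j / τ) hσ.le
      (fun j => div_nonneg (mul_nonneg (by linarith) (by positivity)) hτ.le)
      (fun j => by positivity) (N + 1 + 1)).scale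
      (K := ((N + 1 : ℕ) : ℝ) ^ (τ * (1 - σ) * m)) (by positivity)
      (((N + 1 : ℕ) : ℝ) ^ (τ * (1 - σ)))
    convert h1 using 2 with n
    have hN : (0 : ℝ) < ((N + 1 : ℕ) : ℝ) := by positivity
    rw [gammaRatioSeq, ← Real.rpow_natCast (_ ^ (τ * (1 - σ))), ← Real.rpow_mul hN.le,
      ← Real.rpow_add hN, show τ * (1 - σ) * m + τ * (1 - σ) * n =
        τ * (n + m) - σ * (τ * (n + m)) by ring, mul_assoc, mul_comm (_ ^ _)]
    congr 2
    refine Finset.prod_congr rfl fun j _ => ?_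
    have h2 : 0 < τ * ((n : ℝ) + m) + j := by positivity
    have h3 : 0 < (n : ℝ) + (m + j / τ) := by positivity
    have h4 : (n : ℝ) + (m + j / τ) = (τ * (n + m) + j) / τ := by field_simp; ring
    rw [h4]
    field_simp
    ring
  · rw [abs_of_nonneg (mul_nonneg (hb0 n) (gammaRatioSeq_nonneg (hs n) (ht n) _))]
    exact mul_le_mul_of_nonneg_left (hle (N + 1) n) (hb0 n)
  · refine hsum.norm.congr fun n => ?_
    have h1 := Real.Gamma_pos_of_pos (hs n)
    have h2 := Real.Gamma_pos_of_pos (ht n)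
    rw [norm_mul, norm_pow, Real.norm_of_nonneg (mul_nonneg (hb0 n) (by positivity)),
      Real.norm_eq_abs]

end NonnegEntire

lemma Gamma_add_natCast {x : ℝ} (hx : 0 < x) (n : ℕ) :
    Real.Gamma (x + n) = Real.Gamma x * poch x n := by
  induction n with
  | zero => simp
  | succ n ih =>
    have : x + n ≠ 0 := by positivity
    rw [Nat.cast_succ, ← add_assoc, Real.Gamma_add_one this, ih, poch_succ]
    ring

lemma Gamma_one_add_natCast (n : ℕ) : Real.Gamma (1 + n) = n.factorial := by
  rw [add_comm, Real.Gamma_nat_eq_factorial]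

lemma nonnegEntire_exp : NonnegEntire fun n => 1 / n.factorial := by
  have e : ∀ z : ℝ, (fun n : ℕ => 1 / (n.factorial : ℝ) * z ^ n) = fun n => z ^ n / n.factorial :=
    fun z => by ext n; ring
  constructor
  · intro z
    rw [e]
    exact Real.summable_pow_div_factorial z
  · intro z
    rw [e, (NormedSpace.expSeries_div_hasSum_exp z).tsum_eq, ← Real.exp_eq_exp_ℝ]
    exact (Real.exp_pos z).le

lemma nonnegEntire_hypergeometric {a m : ℝ} (ha : 0 < a) (ham : 3 * a ≤ 2 * m)
    (h : a ≤ 2 * (m - a) * (m - a + 1 / 2)) :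
    NonnegEntire fun n => poch a n / (n.factorial * poch (2 * m) (2 * n)) := by
  have hm : 0 < m := by linarith
  constructor
  · intro z
    refine Summable.of_norm_bounded (Real.summable_pow_div_factorial |z|) fun n => ?_
    have h1 := poch_pos ha n
    have h2 := poch_pos hm n
    have h3 := poch_mono ha.le (by linarith : a ≤ m) n
    have h4 := le_poch (by norm_num : (0 : ℝ) ≤ 1 / 2) (by norm_num)
      (by linarith : 1 / 2 ≤ m + 1 / 2) n
    have h5 : (1 : ℝ) ≤ n.factorial := by
      exact_mod_cast Nat.one_le_iff_ne_zero.2 n.factorial_ne_zero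
    have h6 : (1 / 2 : ℝ) ^ n ≤ poch (m + 1 / 2) n :=
      (le_mul_of_one_le_right (by positivity) h5).trans h4
    have h7 : 1 ≤ 4 ^ n * poch (m + 1 / 2) n :=
      calc (1 : ℝ) ≤ 2 ^ n := one_le_pow₀ (by norm_num)
        _ = 4 ^ n * (1 / 2) ^ n := by rw [← mul_pow]; norm_num
        _ ≤ _ := by gcongr
    have h8 : poch a n ≤ poch (2 * m) (2 * n) := by
      rw [poch_two_mul]
      calc poch a n ≤ poch m n * 1 := by rw [mul_one]; exact h3
        _ ≤ poch m n * (4 ^ n * poch (m + 1 / 2) n) := by gcongr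
        _ = _ := by ring
    have h9 : 0 < poch (2 * m) (2 * n) := h1.trans_le h8
    rw [norm_mul, norm_pow, Real.norm_of_nonneg (by positivity), Real.norm_eq_abs,
      div_mul_eq_mul_div, div_le_div_iff₀ (by positivity) (by positivity)]
    calc poch a n * |z| ^ n * n.factorial
        ≤ poch (2 * m) (2 * n) * |z| ^ n * n.factorial := by gcongr
      _ = _ := by ring
  · intro z
    have := hypergeometric_nonneg ha (by linarith : a / 2 ≤ m - a) h z
    rwa [add_sub_cancel] at this

theorem mittagLeffler3_nonneg (ρ μ γ : ℝ) (hρ : 0 < ρ) (hμ : 0 < μ) (hγ : 0 < γ)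
    (h : (ρ ≤ 1 ∧ ρ * γ ≤ μ) ∨
         (1 < ρ ∧ ρ ≤ 2 ∧ 3 * γ * ρ ≤ 2 * μ ∧ γ ≤ 2 * (μ / ρ - γ) * (μ / ρ - γ + 1 / 2))) :
    ∀ z : ℝ, 0 ≤ mittagLeffler3 ρ μ γ z := by
  intro z
  have hm : 0 < μ / ρ := by positivity
  have hG := Real.Gamma_pos_of_pos hγ
  have hμn : ∀ n : ℕ, ρ * (n + μ / ρ) = μ + ρ * n := fun n => by field_simp; ring
  rcases h with ⟨hρ1, h⟩ | ⟨-, hρ2, h1, h2⟩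
  · have hb := nonnegEntire_exp.mul_gamma_ratio (fun n => by positivity) hγ
      (by rwa [le_div_iff₀ hρ, mul_comm] : γ ≤ μ / ρ)
    have hpos : ∀ n : ℕ, 0 < Real.Gamma (μ / ρ + n) := fun n => Real.Gamma_pos_of_pos (by positivity)
    have key := hb.tsum_mul_gamma_ratio_nonneg (fun n => by
      have := hpos n
      have := Real.Gamma_pos_of_pos (by positivity : 0 < γ + n)
      positivity) one_pos hρ hρ1 hm z
    have := mul_nonneg (one_div_pos.2 hG).le key
    rw [← tsum_mul_left] at this
    refine this.trans_eq (tsum_congr fun n => ?_)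
    have hn := (hpos n).ne'
    rw [one_mul, hμn, Gamma_one_add_natCast, add_comm (n : ℝ)]
    field_simp
  · have hb := nonnegEntire_hypergeometric hγ
      (by rw [mul_div_assoc', le_div_iff₀ hρ]; exact h1) h2
    have key := hb.tsum_mul_gamma_ratio_nonneg (fun n => by
      have := poch_pos hγ n
      have := poch_pos (by positivity : 0 < 2 * (μ / ρ)) (2 * n)
      positivity) two_pos (by positivity : 0 < ρ / 2) (by linarith) hm z
    have hG2 := Real.Gamma_pos_of_pos (by positivity : 0 < 2 * (μ / ρ))
    have := mul_nonneg (one_div_pos.2 hG2).le key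
    rw [← tsum_mul_left] at this
    refine this.trans_eq (tsum_congr fun n => ?_)
    have hp := poch_pos (by positivity : 0 < 2 * (μ / ρ)) (2 * n)
    rw [show ρ / 2 * (2 * (n + μ / ρ)) = ρ * (n + μ / ρ) by ring, hμn, Gamma_one_add_natCast,
      show 2 * ((n : ℝ) + μ / ρ) = 2 * (μ / ρ) + ((2 * n : ℕ) : ℝ) by push_cast; ring,
      Gamma_add_natCast hγ, Gamma_add_natCast (by positivity)]
    generalize poch (2 * (μ / ρ)) (2 * n) = X at hp ⊢
    generalize Real.Gamma (2 * (μ / ρ)) = Y at hG2 ⊢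
    field_simp
end
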